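/- arXiv:1304.0242 — 4 statements merged into one kernel-verified Lean document; each statement's English description precedes it below -/
import Mathlib

section
/- Let k ≥ 2 and let r > n satisfy k·r ≤ (k−1)·2n. If 𝓕 ⊆ 𝓟^r(M_n) is k-wise intersecting, then |𝓕| ≤ 2^{2n−r}·C(n−1, 2n−r) + 2^{2n−r−1}·C(n−1, 2n−r−1). -/
/-- The partner of a vertex `v` in the perfect matching `Mₙ` on `{1,…,2n}`:
vertices `i` and `i+n` (for `1 ≤ i ≤ n`) are joined by an edge. -/
def partnerMn (n v : ℕ) : ℕ := if v ≤ n then v + n else v - n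

/-- `A` is an independent set of vertices of the perfect matching graph `Mₙ`. -/
def IsIndepMn (n : ℕ) (A : Finset ℕ) : Prop :=
  A ⊆ Finset.Icc 1 (2 * n) ∧ ∀ i ∈ Finset.Icc 1 n, ¬(i ∈ A ∧ i + n ∈ A)

/-- The independence number `α(Mₙ)` of the perfect matching graph `Mₙ`. -/
noncomputable def indepNumMn (n : ℕ) : ℕ := sSup {k : ℕ | ∃ A : Finset ℕ, IsIndepMn n A ∧ A.card = k}

/-- `𝓘ʳ(Mₙ)`: the family of all independent `r`-subsets of `V(Mₙ)`. -/
def famI (n r : ℕ) : Set (Finset ℕ) := {A | A.card = r ∧ IsIndepMn n A}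

/-- `𝓜ʳ(Mₙ)`: the family of all `r`-subsets of `V(Mₙ)` containing an
independent set of maximum size `α(Mₙ)`. -/
def famM (n r : ℕ) : Set (Finset ℕ) :=
  {A | A ⊆ Finset.Icc 1 (2 * n) ∧ A.card = r ∧
    ∃ B ⊆ A, IsIndepMn n B ∧ B.card = indepNumMn n}

/-- `𝓟ʳ(Mₙ) = 𝓘ʳ(Mₙ) ∪ 𝓜ʳ(Mₙ)`. -/
def famP (n r : ℕ) : Set (Finset ℕ) := famI n r ∪ famM n r

/-- A family is `k`-wise intersecting: any `k` (not necessarily distinct) members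
have a common element. -/
def KWiseIntersecting (k : ℕ) (𝓕 : Finset (Finset ℕ)) : Prop :=
  ∀ f : Fin k → Finset ℕ, (∀ i, f i ∈ 𝓕) → ∃ v, ∀ i, v ∈ f i

namespace KW

open Finset
open scoped Pointwise

/-- Circle lemma: starts of `s`-arcs, no `k` of which cover the circle. -/
lemma circle (N s k : ℕ) (hs : 1 ≤ s) (hk : 2 ≤ k) (hsN : s ≤ N) (hks : N ≤ k * s)
    (G : Finset ℕ) (hG : G ⊆ range N)
    (h : ∀ f : Fin k → ℕ, (∀ i, f i ∈ G) → ∃ y < N, ∀ i, ∀ a < s, (f i + a) % N ≠ y) :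
    G.card ≤ N - s := by
  rcases G.eq_empty_or_nonempty with rfl | ⟨g0, hg0⟩
  · simp
  have hg0N : g0 < N := by simpa using hG hg0
  have ex : ∀ j ∈ Icc 1 s, ∃ x, 1 ≤ x ∧ x < N ∧ x % s = j % s ∧ (g0 + x) % N ∉ G := by
    intro j hj
    rw [mem_Icc] at hj
    by_contra hcon
    push Not at hcon
    have hmem : ∀ q, j + q * s < N → (g0 + (j + q * s)) % N ∈ G := by
      intro q hq
      exact hcon _ (by omega) hq (by simp)
    have getT : ∀ y < N, ∃ t < N, y = (g0 + t) % N := by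
      intro y hy
      rcases le_or_gt g0 y with hc | hc
      · exact ⟨y - g0, by omega, by rw [Nat.add_sub_cancel' hc, Nat.mod_eq_of_lt hy]⟩
      · refine ⟨y + N - g0, by omega, ?_⟩
        rw [show g0 + (y + N - g0) = y + N by omega, Nat.add_mod_right, Nat.mod_eq_of_lt hy]
    by_cases hc : j + (k - 1) * s < N
    · obtain ⟨y, hy, hcov⟩ := h (fun i => (g0 + (j + i.1 * s)) % N) (by
        intro i
        apply hmem
        have : i.1 * s ≤ (k - 1) * s := Nat.mul_le_mul_right _ (by omega)
        omega)
      obtain ⟨t, ht, rfl⟩ := getT y hy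
      obtain ⟨u, hu, hut⟩ : ∃ u < N, (g0 + t) % N = (g0 + (j + u)) % N := by
        rcases le_or_gt j t with hjt | hjt
        · exact ⟨t - j, by omega, by rw [Nat.add_sub_cancel' hjt]⟩
        · refine ⟨t + N - j, by omega, ?_⟩
          rw [show g0 + (j + (t + N - j)) = g0 + t + N by omega, Nat.add_mod_right]
      have hq : u / s < k := by
        rw [Nat.div_lt_iff_lt_mul hs]; omega
      apply hcov ⟨u / s, hq⟩ (u % s) (Nat.mod_lt _ hs)
      rw [hut]
      simp only [Nat.mod_add_mod]
      congr 1
      have := Nat.div_add_mod' u s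
      omega
    · obtain ⟨y, hy, hcov⟩ := h
        (fun i => if i.1 = 0 then g0 else
          if j + (i.1 - 1) * s < N then (g0 + (j + (i.1 - 1) * s)) % N else g0) (by
        intro i
        split_ifs with h1 h2
        · exact hg0
        · exact hmem _ h2
        · exact hg0)
      obtain ⟨t, ht, rfl⟩ := getT y hy
      rcases lt_or_ge t s with hts | hts
      · exact hcov ⟨0, by omega⟩ t hts (by simp)
      · have hd := Nat.div_add_mod' (t - j) s
        have hq : (t - j) / s < k - 1 := by
          rw [Nat.div_lt_iff_lt_mul hs]; omega
        apply hcov ⟨(t - j) / s + 1, by omega⟩ ((t - j) % s) (Nat.mod_lt _ hs)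
        have hlt : j + (t - j) / s * s < N := by omega
        simp only [Nat.add_sub_cancel, Nat.succ_ne_zero, if_false, hlt, if_true, Nat.mod_add_mod]
        congr 1
        omega
  choose! x hx1 hxN hxs hxG using ex
  have hcard : (Icc 1 s).card ≤ (range N \ G).card := by
    apply card_le_card_of_injOn (fun j => (g0 + x j) % N)
    · intro j hj
      have hj' : j ∈ Icc 1 s := hj
      simp only [coe_sdiff, Set.mem_sdiff, mem_coe, mem_range]
      exact ⟨Nat.mod_lt _ (by omega), hxG j hj'⟩
    · intro j hj j' hj' heq
      have hj1 : j ∈ Icc 1 s := hj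
      have hj2 : j' ∈ Icc 1 s := hj'
      have e1 : x j % N = x j' % N := Nat.ModEq.add_left_cancel' g0 heq
      rw [Nat.mod_eq_of_lt (hxN j hj1), Nat.mod_eq_of_lt (hxN j' hj2)] at e1
      have e2 : j % s = j' % s := by rw [← hxs j hj1, ← hxs j' hj2, e1]
      rw [mem_Icc] at hj1 hj2
      rcases Nat.lt_or_ge j s with a | a <;> rcases Nat.lt_or_ge j' s with b | b
      · rwa [Nat.mod_eq_of_lt a, Nat.mod_eq_of_lt b] at e2
      · have : j' = s := by omega
        subst this
        rw [Nat.mod_eq_of_lt a, Nat.mod_self] at e2; omega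
      · have : j = s := by omega
        subst this
        rw [Nat.mod_eq_of_lt b, Nat.mod_self] at e2; omega
      · omega
  rw [card_sdiff_of_subset hG, card_range, Nat.card_Icc] at hcard
  have := card_le_card hG
  rw [card_range] at this
  omega

/-- Averaging over a transitive group action. -/
lemma avg {G α ι : Type*} [Group G] [Fintype G] [MulAction G α] [DecidableEq α] [Fintype ι]
    (X F : Finset α) (hX : ∀ x ∈ X, ∀ y ∈ X, ∃ g : G, g • x = y)
    (hinv : ∀ g : G, ∀ x ∈ X, g • x ∈ X) (hF : F ⊆ X) (P : ι → α) (hP : ∀ p, P p ∈ X) (m : ℕ)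
    (h : ∀ g : G, (univ.filter (fun p => g • P p ∈ F)).card ≤ m) :
    Fintype.card ι * F.card ≤ m * X.card := by
  have hc : ∀ x ∈ X, ∀ y ∈ X,
      X.card * (univ.filter (fun g : G => g • x = y)).card = Fintype.card G := by
    intro x hx y hy
    have h1 : Fintype.card G = ∑ z ∈ X, (univ.filter (fun g : G => g • x = z)).card := by
      rw [← card_univ]
      exact card_eq_sum_card_fiberwise (fun g _ => hinv g x hx)
    rw [h1, ← smul_eq_mul, ← sum_const]
    apply sum_congr rfl
    intro z hz
    obtain ⟨g0, hg0⟩ := hX y hy z hz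
    apply card_bij (fun g _ => g0 * g)
    · intro g hg
      simp only [mem_filter, mem_univ, true_and] at hg ⊢
      rw [mul_smul, hg, hg0]
    · intro a _ b _ hab
      exact mul_left_cancel hab
    · intro b hb
      simp only [mem_filter, mem_univ, true_and] at hb
      refine ⟨g0⁻¹ * b, ?_, by simp⟩
      simp only [mem_filter, mem_univ, true_and]
      rw [mul_smul, hb, ← hg0, inv_smul_smul]
  have hsum : ∑ g : G, (univ.filter (fun p => g • P p ∈ F)).card
      = ∑ p : ι, ∑ y ∈ F, (univ.filter (fun g : G => g • P p = y)).card := by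
    have : ∀ p : ι, ∑ y ∈ F, (univ.filter (fun g : G => g • P p = y)).card
        = (univ.filter (fun g : G => g • P p ∈ F)).card := by
      intro p
      rw [card_eq_sum_card_fiberwise (f := fun g : G => g • P p) (t := F)]
      · apply sum_congr rfl
        intro y hy
        congr 1
        ext g
        simp only [mem_filter, mem_univ, true_and]
        constructor
        · rintro rfl; exact ⟨hy, rfl⟩
        · exact fun h => h.2
      · intro g hg
        simpa using hg
    rw [sum_congr rfl (fun p _ => this p)]
    simp only [card_filter]
    exact sum_comm
  have hle : ∑ g : G, (univ.filter (fun p => g • P p ∈ F)).card ≤ Fintype.card G * m := by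
    calc _ ≤ ∑ g : G, m := sum_le_sum (fun g _ => h g)
      _ = _ := by simp
  rw [hsum] at hle
  have h2 : X.card * ∑ p : ι, ∑ y ∈ F, (univ.filter (fun g : G => g • P p = y)).card
      = Fintype.card ι * F.card * Fintype.card G := by
    rw [mul_sum]
    simp only [mul_sum]
    have : ∀ p : ι, ∑ y ∈ F, X.card * (univ.filter (fun g : G => g • P p = y)).card
        = F.card * Fintype.card G := by
      intro p
      rw [← smul_eq_mul (a := F.card), ← sum_const]
      exact sum_congr rfl (fun y hy => hc _ (hP p) y (hF hy))
    simp only [this, sum_const, card_univ, smul_eq_mul, mul_assoc]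
  have hG : 0 < Fintype.card G := Fintype.card_pos
  have h3 := Nat.mul_le_mul_left X.card hle
  rw [h2] at h3
  refine Nat.le_of_mul_le_mul_right (c := Fintype.card G) ?_ hG
  calc _ ≤ _ := h3
    _ = _ := by ring

/-- Vertices. -/
abbrev V (n : ℕ) := Fin n × Bool

/-- The other end of the edge. -/
def tau {n : ℕ} (v : V n) : V n := (v.1, !v.2)

/-- Automorphisms of the matching. -/
def H (n : ℕ) : Subgroup (Equiv.Perm (V n)) where
  carrier := {g | ∀ v, g (tau v) = tau (g v)}
  mul_mem' := by
    intro a b ha hb v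
    simp only [Set.mem_ofPred_eq] at ha hb
    simp [ha, hb]
  one_mem' := by intro v; simp
  inv_mem' := by
    intro a ha v
    simp only [Set.mem_ofPred_eq] at ha
    rw [Equiv.Perm.inv_eq_iff_eq, ha]
    simp

/-- Independent sets of size `s`. -/
def X (n s : ℕ) : Finset (Finset (V n)) :=
  univ.filter (fun A => A.card = s ∧ ∀ v ∈ A, tau v ∉ A)

lemma mem_X {n s : ℕ} {A : Finset (V n)} : A ∈ X n s ↔ A.card = s ∧ ∀ v ∈ A, tau v ∉ A := by
  simp [X]

lemma fst_inj {n s : ℕ} {A : Finset (V n)} (hA : A ∈ X n s) : Set.InjOn Prod.fst (A : Set (V n)) := by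
  rintro ⟨i, b⟩ hi ⟨j, c⟩ hj hij
  simp only at hij
  subst hij
  have := (mem_X.1 hA).2 _ hi
  cases b <;> cases c <;> simp_all [tau]

lemma card_X (n s : ℕ) : (X n s).card ≤ 2 ^ s * n.choose s := by
  have h1 : ((powersetCard s (univ : Finset (Fin n))).sigma (fun T => T.powerset)).card
      = 2 ^ s * n.choose s := by
    rw [card_sigma, sum_congr rfl (g := fun _ => 2 ^ s)]
    · simp [card_powersetCard, mul_comm]
    · intro T hT
      rw [card_powerset, (mem_powersetCard.1 hT).2]
  rw [← h1]
  apply card_le_card_of_injOn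
    (fun A => ⟨A.image Prod.fst, univ.filter (fun i => (i, true) ∈ A)⟩)
  · intro A hA
    simp only [coe_sigma, Set.mem_sigma_iff, mem_coe, mem_powersetCard, mem_powerset]
    refine ⟨⟨subset_univ _, ?_⟩, ?_⟩
    · rw [card_image_of_injOn (fst_inj hA)]
      exact (mem_X.1 hA).1
    · intro i hi
      simp only [mem_filter, mem_univ, true_and] at hi
      exact mem_image_of_mem Prod.fst hi
  · have main : ∀ A ∈ X n s, ∀ B ∈ X n s, A.image Prod.fst = B.image Prod.fst →
        (univ.filter (fun i => (i, true) ∈ A)) = univ.filter (fun i => (i, true) ∈ B) → A ⊆ B := by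
      rintro A hA B hB h1 h2 ⟨i, b⟩ hi
      have ht : ∀ i, (i, true) ∈ A ↔ (i, true) ∈ B := by
        intro i
        have := congrArg (fun S => i ∈ S) h2
        simpa using this
      cases b with
      | true => exact (ht i).1 hi
      | false =>
        have : i ∈ B.image Prod.fst := h1 ▸ mem_image_of_mem Prod.fst hi
        obtain ⟨⟨i', c⟩, hc, rfl⟩ := mem_image.1 this
        cases c with
        | false => exact hc
        | true => exact absurd ((ht _).2 hc) ((mem_X.1 hA).2 _ hi)
    intro A hA B hB hAB
    simp only [Sigma.mk.injEq, heq_eq_eq] at hAB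
    exact Subset.antisymm (main A hA B hB hAB.1 hAB.2) (main B hB A hA hAB.1.symm hAB.2.symm)

/-- Signed permutation. -/
def sp {n : ℕ} (σ : Equiv.Perm (Fin n)) (ε : Fin n → Bool) : Equiv.Perm (V n) where
  toFun v := (σ v.1, xor v.2 (ε v.1))
  invFun v := (σ.symm v.1, xor v.2 (ε (σ.symm v.1)))
  left_inv := by rintro ⟨i, b⟩; simp
  right_inv := by rintro ⟨i, b⟩; simp

lemma sp_mem {n : ℕ} (σ : Equiv.Perm (Fin n)) (ε : Fin n → Bool) : sp σ ε ∈ H n := by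
  rintro ⟨i, b⟩
  simp [sp, tau]

lemma X_inv {n s : ℕ} (g : H n) (A : Finset (V n)) (hA : A ∈ X n s) : g • A ∈ X n s := by
  rw [mem_X] at hA ⊢
  refine ⟨by rw [card_smul_finset, hA.1], ?_⟩
  intro v hv hv'
  rw [mem_smul_finset] at hv hv'
  obtain ⟨w, hw, rfl⟩ := hv
  obtain ⟨u, hu, hu'⟩ := hv'
  have hg : (g : Equiv.Perm (V n)) (tau w) = tau ((g : Equiv.Perm (V n)) w) := g.2 w
  have : u = tau w := by
    apply (g : Equiv.Perm (V n)).injective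
    rw [hg]
    exact hu'
  subst this
  exact hA.2 _ hw hu

lemma X_trans {n s : ℕ} (A : Finset (V n)) (hA : A ∈ X n s) (B : Finset (V n)) (hB : B ∈ X n s) :
    ∃ g : H n, g • A = B := by
  classical
  have c1 := card_image_of_injOn (fst_inj hA)
  have c2 := card_image_of_injOn (fst_inj hB)
  rw [(mem_X.1 hA).1] at c1
  rw [(mem_X.1 hB).1] at c2
  let e : {x // x ∈ A.image Prod.fst} ≃ {x // x ∈ B.image Prod.fst} :=
    Finset.equivOfCardEq (c1.trans c2.symm)
  let σ : Equiv.Perm (Fin n) := e.extendSubtype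
  have hσ : ∀ i ∈ A.image Prod.fst, σ i ∈ B.image Prod.fst := fun i hi =>
    e.extendSubtype_mem i hi
  let ε : Fin n → Bool := fun i => xor (decide ((i, true) ∈ A)) (decide ((σ i, true) ∈ B))
  refine ⟨⟨sp σ ε, sp_mem σ ε⟩, ?_⟩
  apply eq_of_subset_of_card_le
  · intro v hv
    rw [mem_smul_finset] at hv
    obtain ⟨⟨i, b⟩, hw, rfl⟩ := hv
    change (σ i, xor b (ε i)) ∈ B
    have hi := hσ i (mem_image_of_mem Prod.fst hw)
    have hb : decide ((i, true) ∈ A) = b := by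
      cases b with
      | true => simpa using hw
      | false => simpa [tau] using (mem_X.1 hA).2 _ hw
    obtain ⟨⟨i', c⟩, hc, hc'⟩ := mem_image.1 hi
    simp only at hc'
    subst hc'
    have hcc : decide ((σ i, true) ∈ B) = c := by
      cases c with
      | true => simpa using hc
      | false => simpa [tau] using (mem_X.1 hB).2 _ hc
    have : xor b (ε i) = c := by
      simp only [ε, hb, hcc]
      cases b <;> cases c <;> rfl
    rw [this]
    exact hc
  · rw [card_smul_finset, (mem_X.1 hA).1, (mem_X.1 hB).1]

/-- Position on the circle. -/
def pos {n : ℕ} (hn : 0 < n) (p : ℕ) : V n := (⟨p % n, Nat.mod_lt _ hn⟩, decide (n ≤ p % (2 * n)))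

/-- Arc. -/
def arc {n : ℕ} (hn : 0 < n) (s p : ℕ) : Finset (V n) := (range s).image (fun a => pos hn (p + a))

lemma arc_aux {n : ℕ} (hn : 0 < n) {s p a b : ℕ} (hsn : s ≤ n) (ha : a < s) (hb : b < s)
    (h : (pos hn (p + a)).1 = (pos hn (p + b)).1) : a = b := by
  simp only [pos, Fin.mk.injEq] at h
  have : a % n = b % n := Nat.ModEq.add_left_cancel' p h
  rwa [Nat.mod_eq_of_lt (by omega), Nat.mod_eq_of_lt (by omega)] at this

lemma arc_mem {n : ℕ} (hn : 0 < n) {s : ℕ} (hsn : s ≤ n) (p : ℕ) : arc hn s p ∈ X n s := by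
  rw [mem_X]
  constructor
  · rw [arc, card_image_of_injOn, card_range]
    intro a ha b hb h
    simp only [coe_range, Set.mem_Iio] at ha hb
    exact arc_aux hn hsn ha hb (congrArg Prod.fst h)
  · intro v hv hv'
    simp only [arc, mem_image, mem_range] at hv hv'
    obtain ⟨a, ha, rfl⟩ := hv
    obtain ⟨b, hb, h⟩ := hv'
    have := arc_aux hn (p := p) hsn hb ha (by rw [h]; rfl)
    subst this
    have h2 := congrArg Prod.snd h
    simp [tau] at h2

lemma pos_mod {n : ℕ} (hn : 0 < n) (p : ℕ) : pos hn (p % (2 * n)) = pos hn p := by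
  simp only [pos, Nat.mod_mod]
  congr 2
  exact Nat.mod_mod_of_dvd p (Dvd.intro_left 2 rfl)

lemma pos_surj {n : ℕ} (hn : 0 < n) {x y : ℕ} (hx : x < 2 * n) (hy : y < 2 * n)
    (h : pos hn x = pos hn y) : x = y := by
  simp only [pos, Prod.mk.injEq, Fin.mk.injEq, decide_eq_decide, Nat.mod_eq_of_lt hx,
    Nat.mod_eq_of_lt hy] at h
  have h1 : ∀ z, z < 2 * n → n ≤ z → z % n = z - n := by
    intro z hz hz'
    rw [Nat.mod_eq_sub_mod hz', Nat.mod_eq_of_lt (by omega)]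
  rcases lt_or_ge x n with a | a
  · have b : y < n := by omega
    rw [Nat.mod_eq_of_lt a, Nat.mod_eq_of_lt b] at h
    exact h.1
  · have b : n ≤ y := h.2.1 a
    rw [h1 x hx a, h1 y hy b] at h
    omega

/-- Label of a vertex. -/
def lab {n : ℕ} (v : V n) : ℕ := v.1.1 + 1 + (if v.2 then n else 0)

lemma lab_inj {n : ℕ} : Function.Injective (lab (n := n)) := by
  rintro ⟨⟨i, hi⟩, b⟩ ⟨⟨j, hj⟩, c⟩ h
  cases b <;> cases c <;> simp [lab] at h ⊢ <;> omega

lemma lab_surj {n x : ℕ} (hx : x ∈ Icc 1 (2 * n)) : ∃ v : V n, lab v = x := by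
  rw [mem_Icc] at hx
  by_cases h : x ≤ n
  · exact ⟨(⟨x - 1, by omega⟩, false), by simp [lab]; omega⟩
  · exact ⟨(⟨x - n - 1, by omega⟩, true), by simp [lab]; omega⟩

lemma lab_mem {n : ℕ} (v : V n) : lab v ∈ Icc 1 (2 * n) := by
  obtain ⟨⟨i, hi⟩, b⟩ := v
  cases b <;> simp [lab] <;> omega

/-- Complement, transported. -/
def co (n : ℕ) (A : Finset ℕ) : Finset (V n) := univ.filter (fun v => lab v ∉ A)

lemma image_co {n : ℕ} (A : Finset ℕ) : (co n A).image lab = Icc 1 (2 * n) \ A := by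
  ext x
  simp only [co, mem_image, mem_filter, mem_univ, true_and, mem_sdiff]
  constructor
  · rintro ⟨v, hv, rfl⟩
    exact ⟨lab_mem v, hv⟩
  · rintro ⟨h1, h2⟩
    obtain ⟨v, rfl⟩ := lab_surj h1
    exact ⟨v, h2, rfl⟩

lemma indep_image {n : ℕ} (B : Finset ℕ) (hB : IsIndepMn n B) :
    (B.image (fun v => if v ≤ n then v else v - n)).card = B.card ∧
    B.image (fun v => if v ≤ n then v else v - n) ⊆ Icc 1 n := by
  constructor
  · apply card_image_of_injOn
    intro x hx y hy h
    have hx1 := mem_Icc.1 (hB.1 hx)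
    have hy1 := mem_Icc.1 (hB.1 hy)
    have hx' : x ∈ B := hx
    have hy' : y ∈ B := hy
    dsimp only at h
    split_ifs at h with a b b
    · exact h
    · exfalso
      apply hB.2 x (mem_Icc.2 ⟨by omega, a⟩)
      exact ⟨hx', by rwa [h, Nat.sub_add_cancel (by omega)]⟩
    · exfalso
      apply hB.2 y (mem_Icc.2 ⟨by omega, b⟩)
      exact ⟨hy', by rwa [← h, Nat.sub_add_cancel (by omega)]⟩
    · omega
  · intro y hy
    obtain ⟨x, hx, rfl⟩ := mem_image.1 hy
    have hx1 := mem_Icc.1 (hB.1 hx)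
    rw [mem_Icc]
    split_ifs <;> omega

lemma indep_card {n : ℕ} (B : Finset ℕ) (hB : IsIndepMn n B) : B.card ≤ n := by
  obtain ⟨h1, h2⟩ := indep_image B hB
  have := card_le_card h2
  rw [h1, Nat.card_Icc] at this
  omega

lemma le_indepNum (n : ℕ) : n ≤ indepNumMn n := by
  apply le_csSup
  · refine ⟨n, ?_⟩
    rintro _ ⟨A, hA, rfl⟩
    exact indep_card A hA
  · refine ⟨Icc 1 n, ⟨?_, ?_⟩, by simp⟩
    · intro x hx
      rw [mem_Icc] at hx ⊢
      omega
    · intro i hi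
      simp only [mem_Icc] at hi ⊢
      omega

lemma indep_hits {n : ℕ} (B : Finset ℕ) (hB : IsIndepMn n B) (hc : n ≤ B.card) :
    ∀ i ∈ Icc 1 n, i ∈ B ∨ i + n ∈ B := by
  obtain ⟨h1, h2⟩ := indep_image B hB
  have heq := eq_of_subset_of_card_le h2 (by rw [h1, Nat.card_Icc]; omega)
  intro i hi
  rw [← heq] at hi
  obtain ⟨x, hx, hxi⟩ := mem_image.1 hi
  split_ifs at hxi with h
  · left; rwa [← hxi]
  · right; rwa [← hxi, Nat.sub_add_cancel (by omega)]

lemma famP_spec {n r s : ℕ} (hs : r + s = 2 * n) (hnr : n < r) (A : Finset ℕ) (hA : A ∈ famP n r) :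
    A ⊆ Icc 1 (2 * n) ∧ co n A ∈ X n s := by
  rcases hA with ⟨h1, h2⟩ | ⟨h1, h2, B, hBA, hB, hBc⟩
  · have := indep_card A h2
    omega
  · refine ⟨h1, ?_⟩
    rw [mem_X]
    constructor
    · rw [← card_image_of_injective _ lab_inj, image_co, card_sdiff_of_subset h1, Nat.card_Icc, h2]
      omega
    · have hits := indep_hits B hB (hBc ▸ le_indepNum n)
      rintro ⟨⟨i, hi⟩, b⟩ hv hv'
      have := hits (i + 1) (mem_Icc.2 ⟨by omega, by omega⟩)
      replace hv := (mem_filter.1 hv).2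
      replace hv' := (mem_filter.1 hv').2
      cases b <;> simp [lab, tau] at hv hv' <;> rcases this with h | h
      · exact hv (hBA h)
      · exact hv' (hBA h)
      · exact hv' (hBA h)
      · exact hv (hBA h)

lemma main (n r k s : ℕ) (hn : 1 ≤ n) (hs : r + s = 2 * n) (hs1 : 1 ≤ s) (hsn : s ≤ n)
    (hnr : n < r) (hk : 2 ≤ k) (hks : 2 * n ≤ k * s)
    (𝓕 : Finset (Finset ℕ)) (h𝓕 : ↑𝓕 ⊆ famP n r) (hint : KWiseIntersecting k 𝓕) :
    2 * n * 𝓕.card ≤ r * (2 ^ s * n.choose s) := by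
  classical
  have hn0 : 0 < n := hn
  have hcard : (𝓕.image (co n)).card = 𝓕.card := by
    apply card_image_of_injOn
    intro A hA B hB h
    have hA' := (famP_spec hs hnr A (h𝓕 hA)).1
    have hB' := (famP_spec hs hnr B (h𝓕 hB)).1
    have h2 : Icc 1 (2 * n) \ A = Icc 1 (2 * n) \ B := by
      rw [← image_co, ← image_co, h]
    rw [← Finset.sdiff_sdiff_eq_self hA', h2, Finset.sdiff_sdiff_eq_self hB']
  have : Fintype (H n) := Fintype.ofFinite _
  have key := avg (G := H n) (X n s) (𝓕.image (co n)) X_trans X_inv ?_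
    (fun p : Fin (2 * n) => arc hn0 s p.1) (fun p => arc_mem hn0 hsn _) r ?_
  · rw [hcard, Fintype.card_fin] at key
    exact key.trans (Nat.mul_le_mul_left _ (card_X n s))
  · intro A hA
    obtain ⟨B, hB, rfl⟩ := mem_image.1 hA
    exact (famP_spec hs hnr B (h𝓕 hB)).2
  · intro g
    have hc := circle (2 * n) s k hs1 hk (by omega) hks
      ((univ.filter (fun p : Fin (2 * n) => g • arc hn0 s p.1 ∈ 𝓕.image (co n))).image Fin.val)
      (by intro x hx
          obtain ⟨p, _, rfl⟩ := mem_image.1 hx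
          exact mem_range.2 p.2) ?_
    · rw [card_image_of_injective _ Fin.val_injective] at hc
      exact hc.trans (by omega)
    · intro f hf
      by_contra hcon
      push Not at hcon
      have hA : ∀ i, ∃ A ∈ 𝓕, co n A = g • arc hn0 s (f i) := by
        intro i
        obtain ⟨p, hp, hpf⟩ := mem_image.1 (hf i)
        rw [← hpf]
        exact mem_image.1 (mem_filter.1 hp).2
      choose A hA1 hA2 using hA
      obtain ⟨v, hv⟩ := hint A hA1
      have hi0 : 0 < k := by omega
      have hvI := (famP_spec hs hnr _ (h𝓕 (hA1 ⟨0, hi0⟩))).1 (hv ⟨0, hi0⟩)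
      obtain ⟨w, rfl⟩ := lab_surj hvI
      have hposs : ∃ y < 2 * n, pos hn0 y = g⁻¹ • w := by
        have hinj : Function.Injective (fun y : Fin (2 * n) => pos hn0 y.1) := by
          intro x y h
          exact Fin.ext (pos_surj hn0 x.2 y.2 h)
        have hb := (Fintype.bijective_iff_injective_and_card _).2 ⟨hinj, by simp [mul_comm]⟩
        obtain ⟨y, hy⟩ := hb.2 (g⁻¹ • w)
        exact ⟨y.1, y.2, hy⟩
      obtain ⟨y, hy, hyw⟩ := hposs
      obtain ⟨i, a, ha, hia⟩ := hcon y hy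
      have h1 : w ∈ co n (A i) := by
        rw [hA2, ← Finset.inv_smul_mem_iff, ← hyw, ← hia, pos_mod]
        exact mem_image_of_mem _ (mem_range.2 ha)
      exact (mem_filter.1 h1).2 (hv i)

end KW

/-- If `k·r ≤ (k−1)·2n`, `r > n` and `𝓕 ⊆ 𝓟ʳ(Mₙ)` is `k`-wise intersecting, then
`|𝓕| ≤ 2^(2n−r)·C(n−1, 2n−r) + 2^(2n−r−1)·C(n−1, 2n−r−1)`. -/
theorem kwise_matching_bound_large (n r k : ℕ) (hn : 1 ≤ n) (hnr : n < r)
    (hk : 2 ≤ k) (hkr : k * r ≤ (k - 1) * (2 * n))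
    (𝓕 : Finset (Finset ℕ)) (h𝓕 : ↑𝓕 ⊆ famP n r)
    (hint : KWiseIntersecting k 𝓕) :
    𝓕.card ≤ 2 ^ (2 * n - r) * (n - 1).choose (2 * n - r)
        + 2 ^ (2 * n - r - 1) * (n - 1).choose (2 * n - r - 1) := by
  obtain ⟨k, rfl⟩ : ∃ k', k = k' + 2 := ⟨k - 2, by omega⟩
  obtain ⟨s, hs⟩ : ∃ s, r + s = 2 * n := by
    refine ⟨2 * n - r, ?_⟩
    have : r ≤ 2 * n := by
      by_contra hlt
      push Not at hlt
      simp only [show k + 2 - 1 = k + 1 by omega] at hkr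
      nlinarith
    omega
  have hks : 2 * n ≤ (k + 2) * s := by
    simp only [show k + 2 - 1 = k + 1 by omega] at hkr
    nlinarith
  have hs1 : 1 ≤ s := by
    rcases Nat.eq_zero_or_pos s with h | h
    · subst h; omega
    · exact h
  have hsn : s ≤ n := by omega
  have key := KW.main n r (k + 2) s hn hs hs1 hsn hnr (by omega) hks 𝓕 h𝓕 hint
  have e1 : 2 * n - r = s := by omega
  rw [e1]
  obtain ⟨t, rfl⟩ : ∃ t, s = t + 1 := ⟨s - 1, by omega⟩
  obtain ⟨m, rfl⟩ : ∃ m, n = m + 1 := ⟨n - 1, by omega⟩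
  simp only [Nat.add_sub_cancel]
  have h1 : (m + 1) * m.choose t = (m + 1).choose (t + 1) * (t + 1) := Nat.add_one_mul_choose_eq m t
  have h2 : (m + 1).choose (t + 1) = m.choose t + m.choose (t + 1) := Nat.choose_succ_succ m t
  have h3 : 2 * (m + 1) * (2 ^ (t + 1) * m.choose (t + 1) + 2 ^ t * m.choose t)
      = r * (2 ^ (t + 1) * (m + 1).choose (t + 1)) := by
    zify at h1 h2 hs ⊢
    have hr : (r : ℤ) = 2 * (m + 1) - (t + 1) := by linarith
    have h4 : (m.choose (t + 1) : ℤ) = (m + 1).choose (t + 1) - m.choose t := by linarith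
    rw [hr, h4, pow_succ]
    linear_combination (-2 * (2:ℤ) ^ t) * h1
  have h5 : 2 * (m + 1) * 𝓕.card ≤ 2 * (m + 1) * (2 ^ (t + 1) * m.choose (t + 1) + 2 ^ t * m.choose t) := by
    rw [h3]; exact key
  exact Nat.le_of_mul_le_mul_left h5 (by omega)
end

section
/- Let k ≥ 2 and let r ≥ 1 satisfy k·r < (k−1)·2n. Suppose 𝓕 ⊆ 𝓟^r(M_n) is k-wise intersecting and |𝓕| equals 2^{r−1}·C(n−1, r−1) if r ≤ n, and equals 2^{2n−r}·C(n−1, 2n−r) + 2^{2n−r−1}·C(n−1, 2n−r−1) if r > n. Then there exists a vertex x of M_n such that 𝓕 = 𝓟^r_x(M_n). -/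
/-- arc of length `l` starting at `a` -/
def arcZ {N : ℕ} [NeZero N] (a : ZMod N) (l : ℕ) : Finset (ZMod N) :=
  Finset.univ.filter (fun v => (v - a).val < l)

theorem mem_arcZ {N : ℕ} [NeZero N] (a : ZMod N) (l : ℕ) (v : ZMod N) :
    v ∈ arcZ a l ↔ (v - a).val < l := by simp [arcZ]

theorem card_arcZ {N : ℕ} [NeZero N] (a : ZMod N) (l : ℕ) (hl : l ≤ N) :
    (arcZ a l).card = l := by
  have h : arcZ a l = (Finset.range l).image (fun i : ℕ => a + (i : ZMod N)) := by
    ext v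
    rw [mem_arcZ, Finset.mem_image]
    constructor
    · intro h
      refine ⟨(v - a).val, Finset.mem_range.2 h, ?_⟩
      rw [ZMod.natCast_zmod_val]; ring
    · rintro ⟨i, hi, rfl⟩
      rw [Finset.mem_range] at hi
      rw [add_sub_cancel_left, ZMod.val_natCast_of_lt (by omega)]
      exact hi
  rw [h, Finset.card_image_of_injOn, Finset.card_range]
  intro i hi j hj hij
  simp only [Finset.coe_range, Set.mem_Iio] at hi hj
  have h2 : (i : ZMod N) = (j : ZMod N) := add_left_cancel hij
  have := congrArg ZMod.val h2
  rwa [ZMod.val_natCast_of_lt (by omega), ZMod.val_natCast_of_lt (by omega)] at this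

theorem val_sub_nat {N : ℕ} [NeZero N] (A : ℕ) (hA : A ≤ N) (v : ZMod N) :
    (v - (A : ZMod N)).val = if A ≤ v.val then v.val - A else v.val + N - A := by
  have hv := v.val_lt
  split_ifs with h
  · have : v - (A : ZMod N) = ((v.val - A : ℕ) : ZMod N) := by
      rw [Nat.cast_sub h, ZMod.natCast_zmod_val]
    rw [this, ZMod.val_natCast_of_lt (by omega)]
  · have : v - (A : ZMod N) = ((v.val + N - A : ℕ) : ZMod N) := by
      rw [Nat.cast_sub (by omega)]; push_cast
      rw [ZMod.natCast_zmod_val, ZMod.natCast_self]; ring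
    rw [this, ZMod.val_natCast_of_lt (by omega)]

theorem cyc_cover {N s k : ℕ} [NeZero N] (hsN : s < N)
    (S : Finset (ZMod N))
    (hcov : ∀ f : Fin k → ZMod N, (∀ i, f i ∈ S) → ∃ v, ∀ i, v ∉ arcZ (f i) s)
    (a : ZMod N) (K : ℕ) (hK : K < k) (b : ℕ → ℕ)
    (hstep : ∀ i < K, b (i + 1) ≤ b i + s) (hend : b 0 + N ≤ b K + s)
    (hmem : ∀ i ≤ K, a + (b i : ZMod N) ∈ S) : False := by
  obtain ⟨v, hv⟩ := hcov (fun i => a + (b (min i.1 K) : ZMod N))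
    (fun i => hmem _ (min_le_right _ _))
  set d := (v - (a + (b 0 : ZMod N))).val with hd
  have hdN : d < N := ZMod.val_lt _
  have hvd : v = a + (b 0 : ZMod N) + (d : ZMod N) := by
    rw [hd, ZMod.natCast_zmod_val]; ring
  have key : ∀ i ≤ K, b i ≤ b 0 + d := by
    intro i
    induction i with
    | zero => intro _; omega
    | succ i ih =>
      intro hi
      have h1 := ih (by omega)
      by_contra hcon
      have h2 := hstep i (by omega)
      apply hv ⟨i, by omega⟩
      rw [mem_arcZ]
      have : v - (a + (b (min i K) : ZMod N)) = ((b 0 + d - b i : ℕ) : ZMod N) := by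
        rw [min_eq_left (by omega), Nat.cast_sub h1, hvd]; push_cast; ring
      show (v - (a + (b (min i K) : ZMod N))).val < s
      rw [this, ZMod.val_natCast_of_lt (by omega)]
      omega
  have h1 := key K le_rfl
  apply hv ⟨K, hK⟩
  rw [mem_arcZ]
  have : v - (a + (b (min K K) : ZMod N)) = ((b 0 + d - b K : ℕ) : ZMod N) := by
    rw [min_self, Nat.cast_sub h1, hvd]; push_cast; ring
  show (v - (a + (b (min K K) : ZMod N))).val < s
  rw [this, ZMod.val_natCast_of_lt (by omega)]
  omega

theorem cyc_surj {N s k : ℕ} [NeZero N] (hs : 1 ≤ s) (hsN : s < N) (hks : N < k * s)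
    (S : Finset (ZMod N))
    (hcov : ∀ f : Fin k → ZMod N, (∀ i, f i ∈ S) → ∃ v, ∀ i, v ∉ arcZ (f i) s)
    (a : ZMod N) (ha : a ∈ S) :
    Set.SurjOn (fun v : ZMod N => (v - a).val % s) (Sᶜ : Finset (ZMod N)) (Finset.range s) := by
  intro ρ hρ
  simp only [Finset.coe_range, Set.mem_Iio] at hρ
  by_contra hcon
  have hall : ∀ x ≤ N, x % s = ρ → a + (x : ZMod N) ∈ S := by
    intro x hx hxρ
    rcases Nat.lt_or_ge x N with h | h
    · by_contra hxS
      apply hcon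
      refine ⟨a + (x : ZMod N), by simpa using hxS, ?_⟩
      show (a + (x : ZMod N) - a).val % s = ρ
      rw [add_sub_cancel_left, ZMod.val_natCast_of_lt h, hxρ]
    · have : x = N := by omega
      subst this
      simpa using ha
  have hm : N / s < k := by
    apply Nat.div_lt_of_lt_mul; rwa [mul_comm]
  have hdm := Nat.div_add_mod N s
  have hmod := Nat.mod_lt N hs
  have hm1 : 1 ≤ N / s := Nat.div_pos hsN.le hs
  set m := N / s
  set t := N % s
  obtain ⟨c, hc1, hcs, hcρ⟩ : ∃ c, 1 ≤ c ∧ c ≤ s ∧ c % s = ρ := by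
    by_cases h0 : ρ = 0
    · exact ⟨s, hs, le_rfl, by simp [h0]⟩
    · exact ⟨ρ, by omega, by omega, Nat.mod_eq_of_lt hρ⟩
  have hcj : ∀ j, (c + s * j) % s = ρ := by intro j; rw [Nat.add_mul_mod_self_left, hcρ]
  by_cases hct : c < t
  · refine cyc_cover hsN S hcov a m hm (fun j => c + s * j) ?_ ?_ ?_
    · intro i _; show c + s * (i+1) ≤ c + s * i + s; nlinarith
    · show c + s * 0 + N ≤ c + s * m + s; nlinarith
    · intro i hi
      apply hall _ _ (hcj i)
      have := Nat.mul_le_mul_left s hi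
      omega
  · refine cyc_cover hsN S hcov a m hm (fun j => if j = 0 then 0 else c + s * (j - 1)) ?_ ?_ ?_
    · intro i _
      rcases i with _ | i
      · simp; omega
      · simp [Nat.mul_succ]; omega
    · obtain ⟨m', hm'⟩ : ∃ m', m = m' + 1 := ⟨m - 1, by omega⟩
      rw [hm'] at hdm ⊢
      simp [Nat.mul_succ] at hdm ⊢; omega
    · intro i hi
      rcases i with _ | i
      · simpa using ha
      · simp only [Nat.add_eq_zero_iff, one_ne_zero, and_false, if_false, Nat.add_sub_cancel]
        apply hall _ _ (hcj i)
        have := Nat.mul_le_mul_left s hi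
        rw [Nat.mul_succ] at this
        omega

theorem cyc_main {N s k : ℕ} [NeZero N] (hs : 1 ≤ s) (hsN : s < N) (hks : N < k * s)
    (S : Finset (ZMod N))
    (hcov : ∀ f : Fin k → ZMod N, (∀ i, f i ∈ S) → ∃ v, ∀ i, v ∉ arcZ (f i) s) :
    S.card ≤ N - s ∧ (S.card = N - s → ∃ c, ∀ v, v ∈ S ↔ v ∉ arcZ c s) := by
  have hcompl : S.card + Sᶜ.card = N := by
    rw [Finset.card_add_card_compl, ZMod.card]
  constructor
  · rcases S.eq_empty_or_nonempty with h | ⟨a, ha⟩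
    · simp [h]
    · have := Finset.card_le_card_of_surjOn _ (cyc_surj hs hsN hks S hcov a ha)
      rw [Finset.card_range] at this
      omega
  · intro hcard
    obtain ⟨a, ha, ha1⟩ : ∃ a, a ∈ S ∧ a + 1 ∉ S := by
      by_contra hcon
      push Not at hcon
      obtain ⟨a, ha⟩ : S.Nonempty := by
        rw [← Finset.card_pos]; omega
      have : ∀ i : ℕ, a + (i : ZMod N) ∈ S := by
        intro i
        induction i with
        | zero => simpa using ha
        | succ i ih =>
          have := hcon _ ih
          push_cast; rwa [← add_assoc]
      have h2 : S = Finset.univ := by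
        ext v
        have := this (v - a).val
        rw [ZMod.natCast_zmod_val, add_sub_cancel] at this
        simp [this]
      rw [h2, Finset.card_univ, ZMod.card] at hcard
      omega
    have hsurj := cyc_surj hs hsN hks S hcov a ha
    have hinj := Finset.injOn_of_surjOn_of_card_le (t := Finset.range s) (s := Sᶜ) 
      (f := fun v : ZMod N => (v - a).val % s)
      (by intro v hv; simpa using Nat.mod_lt _ hs)
      hsurj (by rw [Finset.card_range]; omega)
    have hm : N / s < k := by
      apply Nat.div_lt_of_lt_mul; rwa [mul_comm]
    have hdm := Nat.div_add_mod N s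
    have hmod := Nat.mod_lt N hs
    have hm1 : 1 ≤ N / s := Nat.div_pos hsN.le hs
    set m := N / s
    set t := N % s
    have hT : ∀ c, c < s → a + ((c + 1 : ℕ) : ZMod N) ∉ S := by
      intro c
      induction c with
      | zero => intro _; simpa using ha1
      | succ d ih =>
        intro hc hcS
        have hd := ih (by omega)
        -- uniqueness
        have huniq : ∀ j, 1 ≤ j → d + 1 + s * j ≤ N → a + ((d + 1 + s * j : ℕ) : ZMod N) ∈ S := by
          intro j hj hle
          rcases Nat.lt_or_ge (d + 1 + s * j) N with h | h
          · by_contra hns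
            have hsj : 1 ≤ s * j := Nat.mul_pos hs hj
            have heq := hinj (x₁ := a + ((d + 1 + s * j : ℕ) : ZMod N))
              (x₂ := a + ((d + 1 : ℕ) : ZMod N)) (by simpa using hns) (by simpa using hd)
              (by
                show (a + ((d + 1 + s * j : ℕ) : ZMod N) - a).val % s = (a + ((d + 1 : ℕ) : ZMod N) - a).val % s
                rw [add_sub_cancel_left, add_sub_cancel_left, ZMod.val_natCast_of_lt h, ZMod.val_natCast_of_lt (by omega),
                  Nat.add_mul_mod_self_left])
            have h3 := congrArg ZMod.val (add_left_cancel heq)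
            rw [ZMod.val_natCast_of_lt h, ZMod.val_natCast_of_lt (by omega)] at h3
            omega
          · have : d + 1 + s * j = N := by omega
            rw [this]; simpa using ha
        by_cases hct : d + 1 < t
        · refine cyc_cover hsN S hcov a m hm
            (fun j => if j = 0 then d + 2 else d + 1 + s * j) ?_ ?_ ?_
          · intro i _
            rcases i with _ | i
            · simp <;> omega
            · simp [Nat.mul_succ]; omega
          · have : m ≠ 0 := by omega
            simp [this]; omega
          · intro i hi
            rcases i with _ | i
            · exact hcS
            · simp only [Nat.add_eq_zero_iff, one_ne_zero, and_false, if_false]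
              apply huniq _ (by omega)
              have := Nat.mul_le_mul_left s hi
              omega
        · refine cyc_cover hsN S hcov a m hm
            (fun j => if j = 0 then 0 else if j = 1 then d + 2 else d + 1 + s * (j - 1)) ?_ ?_ ?_
          · intro i _
            rcases i with _ | _ | i
            · simp <;> omega
            · simp <;> omega
            · simp [Nat.mul_succ]; omega
          · obtain ⟨m', hm'⟩ : ∃ m', m = m' + 1 := ⟨m - 1, by omega⟩
            rw [hm'] at hdm ⊢
            rcases m' with _ | m'
            · simp at hdm ⊢; omega
            · simp [Nat.mul_succ] at hdm ⊢; omega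
          · intro i hi
            rcases i with _ | _ | i
            · simpa using ha
            · exact hcS
            · have h2 : i + 1 + 1 ≠ 1 := by omega
              simp only [Nat.add_eq_zero_iff, one_ne_zero, and_false, if_false, h2,
                Nat.add_sub_cancel]
              apply huniq _ (by omega)
              have := Nat.mul_le_mul_left s hi
              rw [Nat.mul_succ] at this
              omega
    have hsub : arcZ (a + 1) s ⊆ Sᶜ := by
      intro v hv
      rw [mem_arcZ] at hv
      have := hT _ hv
      push_cast at this
      rw [ZMod.natCast_zmod_val] at this
      have h4 : a + (v - (a + 1) + 1) = v := by ring
      rw [h4] at this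
      simpa using this
    have heq := Finset.eq_of_subset_of_card_le hsub (by rw [card_arcZ _ _ hsN.le]; omega)
    refine ⟨a + 1, fun v => ?_⟩
    rw [heq]; simp


abbrev Zn (m : ℕ) : Type := ZMod (2 * (m + 1))

/-- independence in the matching on `ZMod 2n` -/
def Ind {m : ℕ} (B : Finset (Zn m)) : Prop := ∀ v ∈ B, v + ((m + 1 : ℕ) : Zn m) ∉ B

/-- automorphisms of the matching -/
def InH {m : ℕ} (σ : Equiv.Perm (Zn m)) : Prop :=
  ∀ v, σ (v + ((m + 1 : ℕ) : Zn m)) = σ v + ((m + 1 : ℕ) : Zn m)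

/-- image under a permutation -/
def im {m : ℕ} (σ : Equiv.Perm (Zn m)) (B : Finset (Zn m)) : Finset (Zn m) :=
  B.map σ.toEmbedding

theorem mem_im {m : ℕ} (σ : Equiv.Perm (Zn m)) (B : Finset (Zn m)) (v : Zn m) :
    v ∈ im σ B ↔ σ.symm v ∈ B := by
  simp [im, Finset.mem_map_equiv]

theorem apply_mem_im {m : ℕ} (σ : Equiv.Perm (Zn m)) (B : Finset (Zn m)) (v : Zn m) :
    σ v ∈ im σ B ↔ v ∈ B := by simp [mem_im]

theorem im_mul {m : ℕ} (σ τ : Equiv.Perm (Zn m)) (B : Finset (Zn m)) :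
    im (σ * τ) B = im σ (im τ B) := by
  ext v; simp only [mem_im]; rfl

theorem card_im {m : ℕ} (σ : Equiv.Perm (Zn m)) (B : Finset (Zn m)) :
    (im σ B).card = B.card := by simp [im]

theorem im_compl {m : ℕ} (σ : Equiv.Perm (Zn m)) (B : Finset (Zn m)) :
    im σ Bᶜ = (im σ B)ᶜ := by
  ext v; simp [mem_im]

theorem im_inj {m : ℕ} (σ : Equiv.Perm (Zn m)) : Function.Injective (im σ) :=
  Finset.map_injective _

theorem im_symm_im {m : ℕ} (σ : Equiv.Perm (Zn m)) (B : Finset (Zn m)) :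
    im σ (im σ⁻¹ B) = B := by
  rw [← im_mul]; ext v; rw [mul_inv_cancel, mem_im]; rfl

theorem InH.mul {m : ℕ} {σ τ : Equiv.Perm (Zn m)} (h : InH σ) (h' : InH τ) : InH (σ * τ) := by
  intro v; simp only [Equiv.Perm.mul_apply]; rw [h', h]

theorem InH.inv {m : ℕ} {σ : Equiv.Perm (Zn m)} (h : InH σ) : InH σ⁻¹ := by
  intro v
  apply σ.injective
  rw [h]; simp

theorem InH.one {m : ℕ} : InH (1 : Equiv.Perm (Zn m)) := by
  intro v; simp

theorem Ind.im {m : ℕ} {σ : Equiv.Perm (Zn m)} (h : InH σ) {B : Finset (Zn m)} (hB : Ind B) :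
    Ind (im σ B) := by
  intro v hv hv'
  obtain ⟨w, rfl⟩ := σ.surjective v
  rw [← h, apply_mem_im] at hv'
  rw [apply_mem_im] at hv
  exact (hB w hv hv')

/-- rotation -/
def rot {m : ℕ} (a : Zn m) : Equiv.Perm (Zn m) := Equiv.addRight a

theorem InH.rot {m : ℕ} (a : Zn m) : InH (rot a) := by
  intro v; simp [_root_.rot]; ring

theorem im_rot {m : ℕ} (a b : Zn m) (l : ℕ) : im (rot a) (arcZ b l) = arcZ (b + a) l := by
  ext v
  rw [mem_im, mem_arcZ, mem_arcZ]
  have : (rot a).symm v - b = v - (b + a) := by simp [rot]; ring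
  rw [this]

theorem compl_arcZ {N : ℕ} [NeZero N] (a : ZMod N) (l : ℕ) (hl : l ≤ N) :
    (arcZ a l)ᶜ = arcZ (a + (l : ZMod N)) (N - l) := by
  ext v
  rw [Finset.mem_compl, mem_arcZ, mem_arcZ]
  rcases Nat.lt_or_ge l N with h | h
  · have := val_sub_nat l hl (v - a)
    have hlt := (v - a).val_lt
    rw [sub_sub] at this
    rw [this]
    split_ifs <;> omega
  · have := (v - a).val_lt
    omega

theorem val_add_half {m : ℕ} (w : Zn m) :
    (w + ((m + 1 : ℕ) : Zn m)).val = if w.val < m + 1 then w.val + (m + 1) else w.val - (m + 1) := by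
  have hw : w.val < 2 * (m + 1) := w.val_lt
  have h : w + ((m + 1 : ℕ) : Zn m) = w - ((m + 1 : ℕ) : Zn m) := by
    have : ((m + 1 : ℕ) : Zn m) + ((m + 1 : ℕ) : Zn m) = 0 := by
      rw [← Nat.cast_add, show m + 1 + (m + 1) = 2 * (m + 1) by ring]
      exact ZMod.natCast_self _
    rw [eq_sub_iff_add_eq, add_assoc, this, add_zero]
  rw [h, val_sub_nat _ (by omega)]
  split_ifs <;> omega

theorem half_add_half {m : ℕ} (v : Zn m) :
    v + ((m + 1 : ℕ) : Zn m) + ((m + 1 : ℕ) : Zn m) = v := by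
  rw [add_assoc, ← Nat.cast_add, show m + 1 + (m + 1) = 2 * (m + 1) by ring]
  have : ((2 * (m + 1) : ℕ) : Zn m) = 0 := ZMod.natCast_self _
  rw [this, add_zero]

theorem ind_arc {m : ℕ} (a : Zn m) (l : ℕ) (hl : l ≤ m + 1) : Ind (arcZ a l) := by
  intro v hv hv'
  rw [mem_arcZ] at hv hv'
  rw [add_sub_right_comm, val_add_half] at hv'
  split_ifs at hv' <;> omega

/-- coordinates -/
noncomputable def psi (m : ℕ) : Fin (m + 1) × Bool ≃ Zn m :=
  Equiv.ofBijective (fun p => ((p.1.val + if p.2 then m + 1 else 0 : ℕ) : Zn m)) (by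
    rw [Fintype.bijective_iff_injective_and_card]
    constructor
    · rintro ⟨i, b⟩ ⟨j, c⟩ h
      have hi := i.2
      have hj := j.2
      have := congrArg ZMod.val h
      simp only at this
      rw [ZMod.val_natCast_of_lt (by split_ifs <;> omega),
        ZMod.val_natCast_of_lt (by split_ifs <;> omega)] at this
      cases b <;> cases c <;> simp at this ⊢ <;> omega
    · simp [ZMod.card]; ring)

theorem val_psi {m : ℕ} (i : Fin (m + 1)) (b : Bool) :
    (psi m (i, b)).val = i.val + if b then m + 1 else 0 := by
  have hi := i.2
  show (((i.val + if b then m + 1 else 0 : ℕ) : Zn m)).val = _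
  rw [ZMod.val_natCast_of_lt (by split_ifs <;> omega)]

theorem psi_not {m : ℕ} (i : Fin (m + 1)) (b : Bool) :
    psi m (i, b) + ((m + 1 : ℕ) : Zn m) = psi m (i, !b) := by
  apply ZMod.val_injective
  have hi := i.2
  rw [val_add_half, val_psi, val_psi]
  cases b <;> simp <;> omega

/-- lift of a permutation of the edges -/
noncomputable def lft {m : ℕ} (e : Equiv.Perm (Fin (m + 1))) : Equiv.Perm (Zn m) :=
  (psi m).symm.trans ((Equiv.prodCongr e (Equiv.refl Bool)).trans (psi m))

theorem lft_psi {m : ℕ} (e : Equiv.Perm (Fin (m + 1))) (i : Fin (m + 1)) (b : Bool) :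
    lft e (psi m (i, b)) = psi m (e i, b) := by simp [lft]

theorem psi_surj {m : ℕ} (v : Zn m) : ∃ i b, v = psi m (i, b) :=
  ⟨((psi m).symm v).1, ((psi m).symm v).2, by simp⟩

theorem InH.lft {m : ℕ} (e : Equiv.Perm (Fin (m + 1))) : InH (lft e) := by
  intro v
  obtain ⟨i, b, rfl⟩ := psi_surj v
  rw [psi_not, lft_psi, lft_psi, psi_not]

/-- lift of a permutation of the non-base edges -/
noncomputable def lf {m : ℕ} (p : Equiv.Perm (Fin m)) : Equiv.Perm (Zn m) :=
  lft (Equiv.Perm.decomposeFin.symm (0, p))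

theorem lf_zero {m : ℕ} (p : Equiv.Perm (Fin m)) (b : Bool) :
    lf p (psi m (0, b)) = psi m (0, b) := by
  rw [lf, lft_psi, Equiv.Perm.decomposeFin_symm_apply_zero]

theorem lf_succ {m : ℕ} (p : Equiv.Perm (Fin m)) (i : Fin m) (b : Bool) :
    lf p (psi m (i.succ, b)) = psi m ((p i).succ, b) := by
  rw [lf, lft_psi, Equiv.Perm.decomposeFin_symm_apply_succ]; simp

theorem InH.lf {m : ℕ} (p : Equiv.Perm (Fin m)) : InH (lf p) := InH.lft _

theorem lf_one {m : ℕ} : lf (1 : Equiv.Perm (Fin m)) = 1 := by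
  ext v
  obtain ⟨i, b, rfl⟩ := psi_surj v
  refine Fin.cases ?_ (fun i => ?_) i
  · rw [lf_zero]; rfl
  · rw [lf_succ]; rfl

theorem lf_mul {m : ℕ} (p q : Equiv.Perm (Fin m)) : lf (p * q) = lf p * lf q := by
  ext v
  obtain ⟨i, b, rfl⟩ := psi_surj v
  rw [Equiv.Perm.mul_apply]
  refine Fin.cases ?_ (fun i => ?_) i
  · rw [lf_zero, lf_zero, lf_zero]
  · rw [lf_succ, lf_succ, lf_succ]; rfl

theorem psi_zero {m : ℕ} : psi m (0, false) = 0 := by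
  apply ZMod.val_injective
  rw [val_psi]; simp

theorem lf_0 {m : ℕ} (p : Equiv.Perm (Fin m)) : lf p 0 = 0 := by
  rw [← psi_zero, lf_zero]

theorem mem_arcZ_val {N : ℕ} [NeZero N] (A : ℕ) (hA : A ≤ N) (l : ℕ) (v : ZMod N) :
    v ∈ arcZ (A : ZMod N) l ↔ (A ≤ v.val ∧ v.val < A + l) ∨ (v.val < A ∧ v.val + N < A + l) := by
  rw [mem_arcZ, val_sub_nat A hA]
  have := v.val_lt
  split_ifs <;> omega

/-- An independent set through `0` is the image of an arc through `0`. -/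
theorem sort_arc {m : ℕ} (B : Finset (Zn m)) (hB : Ind B) (h0 : (0 : Zn m) ∈ B) :
    ∃ (p : Equiv.Perm (Fin m)) (a : Zn m), B = im (lf p) (arcZ a B.card) ∧
      (0 : Zn m) ∈ arcZ a B.card := by
  classical
  let g : Fin m → ℕ := fun i => if psi m (i.succ, false) ∈ B then 0 else
    if psi m (i.succ, true) ∈ B then 2 else 1
  have hg0 : ∀ i, psi m (i.succ, false) ∈ B ↔ g i ≤ 0 := by
    intro i; simp only [g]; split_ifs <;> simp_all
  have hg2 : ∀ i, psi m (i.succ, true) ∈ B ↔ ¬ g i ≤ 1 := by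
    intro i
    have := hB (psi m (i.succ, false))
    rw [psi_not] at this
    simp only [g]; split_ifs <;> simp_all
  have hmono := Tuple.monotone_sort g
  set p := Tuple.sort g with hp
  have h1 := fun i => Tuple.lt_card_le_iff_apply_le_of_monotone (j := i) (a := 0) hmono
  have h2 := fun i => Tuple.lt_card_le_iff_apply_le_of_monotone (j := i) (a := 1) hmono
  have hPQ : (Finset.univ.filter (fun i => (g ∘ p) i ≤ 0)).card ≤
      (Finset.univ.filter (fun i => (g ∘ p) i ≤ 1)).card := by
    apply Finset.card_le_card
    intro i hi
    simp only [Finset.mem_filter, Finset.mem_univ, true_and] at hi ⊢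
    omega
  have hQm : (Finset.univ.filter (fun i => (g ∘ p) i ≤ 1)).card ≤ m := by
    refine (Finset.card_le_univ _).trans ?_
    simp
  set P := (Finset.univ.filter (fun i => (g ∘ p) i ≤ 0)).card
  set Q := (Finset.univ.filter (fun i => (g ∘ p) i ≤ 1)).card
  have hBn : psi m (0, true) ∉ B := by
    have := hB 0 h0
    rwa [← psi_zero, psi_not] at this
  have hC : B = im (lf p) (arcZ ((m + 2 + Q : ℕ) : Zn m) (m + 1 - Q + P)) := by
    ext v
    obtain ⟨w, rfl⟩ := (lf p).surjective v
    rw [apply_mem_im, mem_arcZ_val _ (by omega)]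
    obtain ⟨i, b, rfl⟩ := psi_surj w
    rw [val_psi]
    refine Fin.cases ?_ (fun i => ?_) i
    · rw [lf_zero]
      cases b
      · rw [psi_zero]; simp [h0]; omega
      · simp [hBn]; omega
    · rw [lf_succ]
      have hi := i.2
      have h1i := h1 i
      have h2i := h2 i
      simp only [Function.comp_apply] at h1i h2i
      cases b
      · rw [hg0, ← h1i]
        simp only [Fin.val_succ]
        simp
        omega
      · rw [hg2, ← h2i]
        simp only [Fin.val_succ]
        simp
        omega
  have hcard : B.card = m + 1 - Q + P := by
    conv_lhs => rw [hC]
    rw [card_im, card_arcZ _ _ (by omega)]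
  refine ⟨p, ((m + 2 + Q : ℕ) : Zn m), ?_, ?_⟩
  · rw [hcard]; exact hC
  · rw [hC, mem_im] at h0
    have h3 : (lf p).symm 0 = 0 := by rw [Equiv.symm_apply_eq, lf_0]
    rw [h3] at h0
    rw [hcard]; exact h0

/-- the admissible sets -/
def Ok {m : ℕ} (B : Finset (Zn m)) : Prop := Ind B ∨ Ind Bᶜ

theorem ind_trans {m : ℕ} (B : Finset (Zn m)) (hB : Ind B) :
    ∃ σ, InH σ ∧ im σ (arcZ 0 B.card) = B := by
  rcases B.eq_empty_or_nonempty with rfl | ⟨v, hv⟩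
  · refine ⟨1, InH.one, ?_⟩
    rw [← Finset.card_eq_zero, card_im, card_arcZ _ _ (by simp)]; simp
  · obtain ⟨p, a, h, -⟩ := sort_arc (im (rot v)⁻¹ B) (hB.im (InH.rot v).inv) (by
      rw [mem_im]
      show rot v 0 ∈ B
      simpa [rot] using hv)
    refine ⟨rot v * lf p * rot a, ((InH.rot v).mul (InH.lf p)).mul (InH.rot a), ?_⟩
    rw [card_im] at h
    rw [im_mul, im_mul, im_rot, zero_add, ← h, im_symm_im]

theorem ok_trans {m : ℕ} (B : Finset (Zn m)) (hB : Ok B) :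
    ∃ σ, InH σ ∧ im σ (arcZ 0 B.card) = B := by
  rcases hB with hB | hB
  · exact ind_trans B hB
  · obtain ⟨σ, hσ, h⟩ := ind_trans Bᶜ hB
    have hc : B.card ≤ 2 * (m + 1) := by
      have := Finset.card_le_univ B
      rwa [ZMod.card] at this
    have hcc : Bᶜ.card = 2 * (m + 1) - B.card := by
      rw [Finset.card_compl, ZMod.card]
    refine ⟨σ * rot (((2 * (m + 1) - B.card : ℕ)) : Zn m), hσ.mul (InH.rot _), ?_⟩
    rw [im_mul, im_rot]
    rw [← compl_inj_iff, ← h, ← im_compl, compl_arcZ _ _ hc, hcc]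
    congr 2
    rw [zero_add, ← Nat.cast_add, Nat.sub_add_cancel hc]
    exact ZMod.natCast_self _

theorem Ok.im {m : ℕ} {σ : Equiv.Perm (Zn m)} (h : InH σ) {B : Finset (Zn m)} (hB : Ok B) :
    Ok (im σ B) := by
  rcases hB with hB | hB
  · exact Or.inl (hB.im h)
  · right; rw [← im_compl]; exact hB.im h

theorem ok_arc {m : ℕ} (a : Zn m) (l : ℕ) (hl : l ≤ 2 * (m + 1)) : Ok (arcZ a l) := by
  rcases le_total l (m + 1) with h | h
  · exact Or.inl (ind_arc a l h)
  · right; rw [compl_arcZ _ _ hl]; exact ind_arc _ _ (by omega)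


open Classical in
/-- all admissible `s`-sets -/
noncomputable def Qs (m s : ℕ) : Finset (Finset (Zn m)) :=
  Finset.univ.filter (fun B => B.card = s ∧ Ok B)

theorem mem_Qs {m s : ℕ} (B : Finset (Zn m)) : B ∈ Qs m s ↔ B.card = s ∧ Ok B := by
  simp [Qs]

open Classical in
/-- the automorphism group as a finset -/
noncomputable def Hs (m : ℕ) : Finset (Equiv.Perm (Zn m)) := Finset.univ.filter InH

theorem mem_Hs {m : ℕ} (σ : Equiv.Perm (Zn m)) : σ ∈ Hs m ↔ InH σ := by simp [Hs]

/-- starts of arcs in the family -/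
def Sset {m : ℕ} (s : ℕ) (G : Finset (Finset (Zn m))) (σ : Equiv.Perm (Zn m)) : Finset (Zn m) :=
  Finset.univ.filter (fun a => im σ (arcZ a s) ∈ G)

theorem mem_Sset {m s : ℕ} (G : Finset (Finset (Zn m))) (σ : Equiv.Perm (Zn m)) (a : Zn m) :
    a ∈ Sset s G σ ↔ im σ (arcZ a s) ∈ G := by simp [Sset]

theorem counting (m s : ℕ) (hs : s ≤ 2 * (m + 1)) :
    ∃ c : ℕ, 0 < c ∧ (Hs m).card = c * (Qs m s).card ∧
      ∀ G ⊆ Qs m s, ∑ σ ∈ Hs m, (Sset s G σ).card = 2 * (m + 1) * (c * G.card) := by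
  classical
  set c := ((Hs m).filter (fun σ => im σ (arcZ (0 : Zn m) s) = arcZ 0 s)).card with hc
  have hfib : ∀ B ∈ Qs m s, ((Hs m).filter (fun σ => im σ (arcZ (0 : Zn m) s) = B)).card = c := by
    intro B hB
    rw [mem_Qs] at hB
    obtain ⟨τ, hτ, h⟩ := ok_trans B hB.2
    rw [hB.1] at h
    symm
    apply Finset.card_nbij' (fun σ => τ * σ) (fun σ => τ⁻¹ * σ)
    · intro σ hσ
      simp only [Finset.coe_filter, Set.mem_ofPred_eq, mem_Hs] at hσ ⊢
      exact ⟨hτ.mul hσ.1, by rw [im_mul, hσ.2, h]⟩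
    · intro σ hσ
      simp only [Finset.coe_filter, Set.mem_ofPred_eq, mem_Hs] at hσ ⊢
      refine ⟨hτ.inv.mul hσ.1, ?_⟩
      apply im_inj τ
      rw [im_mul, im_symm_im, hσ.2, h]
    · intro σ _; simp
    · intro σ _; simp
  have hG : ∀ G ⊆ Qs m s, ((Hs m).filter (fun σ => im σ (arcZ (0 : Zn m) s) ∈ G)).card
      = c * G.card := by
    intro G hGQ
    rw [Finset.card_eq_sum_card_fiberwise (f := fun σ => im σ (arcZ (0 : Zn m) s)) (t := G)]
    · rw [Finset.sum_congr rfl (g := fun _ => c), Finset.sum_const, smul_eq_mul, mul_comm]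
      intro B hB
      rw [← hfib B (hGQ hB), Finset.filter_filter]
      congr 1
      ext σ
      simp only [Finset.mem_filter]
      constructor
      · rintro ⟨h1, h2, h3⟩; exact ⟨h1, h3⟩
      · rintro ⟨h1, h3⟩; exact ⟨h1, by rw [h3]; exact hB, h3⟩
    · intro σ hσ
      simp only [Finset.coe_filter, Set.mem_ofPred_eq] at hσ
      exact hσ.2
  refine ⟨c, ?_, ?_, ?_⟩
  · rw [hc, Finset.card_pos]
    refine ⟨1, ?_⟩
    simp only [Finset.mem_filter, mem_Hs]
    refine ⟨InH.one, ?_⟩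
    ext v; rw [mem_im]; rfl
  · rw [← hG _ le_rfl]
    congr 1
    symm
    rw [Finset.filter_eq_self]
    intro σ hσ
    rw [mem_Hs] at hσ
    rw [mem_Qs]
    exact ⟨by rw [card_im, card_arcZ _ _ hs], (ok_arc _ _ hs).im hσ⟩
  · intro G hGQ
    have h1 : ∑ σ ∈ Hs m, (Sset s G σ).card =
        ∑ a : Zn m, ((Hs m).filter (fun σ => im σ (arcZ a s) ∈ G)).card :=
      Finset.sum_card_bipartiteAbove_eq_sum_card_bipartiteBelow
        (fun (σ : Equiv.Perm (Zn m)) (a : Zn m) => im σ (arcZ a s) ∈ G)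
    rw [h1, Finset.sum_congr rfl (g := fun _ => c * G.card), Finset.sum_const, smul_eq_mul,
      Finset.card_univ, ZMod.card]
    intro a _
    rw [← hG G hGQ]
    apply Finset.card_nbij' (fun σ => σ * rot a) (fun σ => σ * (rot a)⁻¹)
    · intro σ hσ
      simp only [Finset.coe_filter, Set.mem_ofPred_eq, mem_Hs] at hσ ⊢
      exact ⟨hσ.1.mul (InH.rot a), by rw [im_mul, im_rot, zero_add]; exact hσ.2⟩
    · intro σ hσ
      simp only [Finset.coe_filter, Set.mem_ofPred_eq, mem_Hs] at hσ ⊢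
      refine ⟨hσ.1.mul (InH.rot a).inv, ?_⟩
      have : arcZ a s = im (rot a) (arcZ 0 s) := by rw [im_rot, zero_add]
      rw [this, ← im_mul, inv_mul_cancel_right]
      exact hσ.2
    · intro σ _; simp
    · intro σ _; simp

theorem card_star_arc {m s : ℕ} (hs : s ≤ 2 * (m + 1)) (x : Zn m) :
    (Finset.univ.filter (fun a : Zn m => x ∈ arcZ a s)).card = s := by
  refine Eq.trans ?_ (card_arcZ (0 : Zn m) s hs)
  apply Finset.card_nbij' (fun a => x - a) (fun a => x - a)
  · intro a ha
    simp only [Finset.coe_filter, Set.mem_ofPred_eq, Finset.mem_univ, true_and] at ha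
    rw [mem_arcZ] at ha
    rw [Finset.mem_coe, mem_arcZ, sub_zero]; exact ha
  · intro a ha
    rw [Finset.mem_coe, mem_arcZ, sub_zero] at ha
    simp only [Finset.coe_filter, Set.mem_ofPred_eq, Finset.mem_univ, true_and]
    rw [mem_arcZ]; simpa using ha
  · intro a _; simp
  · intro a _; simp

theorem val_lf_swap {m' : ℕ} (i : Fin m') (v : Zn (m' + 1)) :
    (lf (Equiv.swap i.castSucc i.succ) v).val =
      if v.val = i.val + 1 then i.val + 2
      else if v.val = i.val + 2 then i.val + 1
      else if v.val = i.val + 1 + (m' + 2) then i.val + 2 + (m' + 2)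
      else if v.val = i.val + 2 + (m' + 2) then i.val + 1 + (m' + 2)
      else v.val := by
  obtain ⟨j, b, rfl⟩ := psi_surj v
  have hi := i.2
  refine Fin.cases ?_ (fun j => ?_) j
  · rw [lf_zero, val_psi]
    cases b <;> simp only [Bool.false_eq_true, if_false, if_true, Fin.val_zero] <;>
      split_ifs <;> omega
  · rw [lf_succ, val_psi, val_psi, Equiv.swap_apply_def]
    have hj := j.2
    have e1 : j = i.castSucc ↔ j.val = i.val := by rw [Fin.ext_iff]; rfl
    have e2 : j = i.succ ↔ j.val = i.val + 1 := by rw [Fin.ext_iff]; rfl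
    simp only [e1, e2, Fin.val_succ]
    have e3 : i.castSucc.val = i.val := rfl
    cases b <;> simp only [Bool.false_eq_true, if_false, if_true] <;> split_ifs <;>
      (try simp only [Fin.val_succ, e3]) <;> omega

/-- the permutation `σ` is centred at position `0` -/
def Cent {m : ℕ} (s : ℕ) (G : Finset (Finset (Zn m))) (σ : Equiv.Perm (Zn m)) : Prop :=
  ∀ a, im σ (arcZ a s) ∈ G ↔ (0 : Zn m) ∉ arcZ a s

theorem step_cover {m' s k : ℕ} (hs : 1 ≤ s) (hsN : s < 2 * (m' + 1 + 1))
    (hks : 2 * (m' + 1 + 1) < k * s) (G : Finset (Finset (Zn (m' + 1))))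
    (hcov : ∀ f : Fin k → Finset (Zn (m' + 1)), (∀ i, f i ∈ G) → ∃ v, ∀ i, v ∉ f i)
    (σ : Equiv.Perm (Zn (m' + 1))) (hσ : Cent s G σ) (i : Fin m') (a : Zn (m' + 1))
    (ha : (0 : Zn (m' + 1)) ∈ arcZ a s) :
    im (σ * lf (Equiv.swap i.castSucc i.succ)) (arcZ a s) ∉ G := by
  intro hB
  set τ := lf (Equiv.swap i.castSucc i.succ) with hτ
  have hi := i.2
  obtain ⟨b0, e0, hb0, he0, hbe, hmem⟩ : ∃ b0 e0, 1 ≤ b0 ∧ e0 ≤ 2 * (m' + 1 + 1) ∧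
      e0 = b0 + (2 * (m' + 1 + 1) - s) ∧
      ∀ v : Zn (m' + 1), v ∉ arcZ a s → b0 ≤ v.val ∧ v.val < e0 := by
    have hA : a.val < 2 * (m' + 1 + 1) := a.val_lt
    have haA : a = ((a.val : ℕ) : Zn (m' + 1)) := (ZMod.natCast_zmod_val a).symm
    rw [haA, mem_arcZ_val _ hA.le] at ha
    rw [haA]
    generalize a.val = A at *
    simp only [ZMod.val_zero] at ha
    by_cases h0 : A = 0
    · refine ⟨s, 2 * (m' + 1 + 1), hs, le_rfl, by omega, ?_⟩
      intro v hv
      have hvl : v.val < 2 * (m' + 1 + 1) := v.val_lt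
      rw [mem_arcZ_val _ hA.le] at hv
      omega
    · refine ⟨A + s - 2 * (m' + 1 + 1), A, by omega, by omega, by omega, ?_⟩
      intro v hv
      have hvl : v.val < 2 * (m' + 1 + 1) := v.val_lt
      rw [mem_arcZ_val _ hA.le] at hv
      omega
  obtain ⟨k', rfl⟩ : ∃ k', k = k' + 1 := by
    refine ⟨k - 1, ?_⟩
    rcases k with _ | k
    · simp at hks
    · rfl
  have hK1 : 2 * (m' + 1 + 1) < k' * s + s := by
    have : (k' + 1) * s = k' * s + s := Nat.succ_mul k' s
    omega
  have hK2 : s = m' + 2 → 2 * s ≤ k' * s := by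
    intro h
    have : 2 ≤ k' := by
      by_contra hlt
      have : k' ≤ 1 := by omega
      have := Nat.mul_le_mul_right s this
      omega
    exact Nat.mul_le_mul_right s this
  obtain ⟨b, e, hb, he, hbe', hmem'⟩ : ∃ b e, 1 ≤ b ∧ e ≤ 2 * (m' + 1 + 1) ∧ e ≤ b + k' * s ∧
      ∀ v : Zn (m' + 1), v ∉ arcZ a s → b ≤ (τ v).val ∧ (τ v).val < e := by
    refine ⟨if b0 = i.val + 2 ∨ b0 = i.val + 2 + (m' + 2) then b0 - 1 else b0,
      if e0 = i.val + 2 ∨ e0 = i.val + 2 + (m' + 2) then e0 + 1 else e0, ?_, ?_, ?_, ?_⟩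
    · split_ifs <;> omega
    · split_ifs <;> omega
    · split_ifs <;> omega
    · intro v hv
      have h1 := hmem v hv
      rw [hτ, val_lf_swap]
      split_ifs <;> omega
  obtain ⟨v, hv⟩ := hcov (Fin.cons (im (σ * τ) (arcZ a s)) (fun j : Fin k' =>
    im σ (arcZ ((min (b + j.val * s) (2 * (m' + 1 + 1) - s) : ℕ) : Zn (m' + 1)) s))) (by
      intro j
      refine Fin.cases ?_ (fun j => ?_) j
      · exact hB
      · rw [Fin.cons_succ]
        rw [hσ, mem_arcZ_val _ (by omega)]
        simp only [ZMod.val_zero]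
        omega)
  have hv0 := hv 0
  rw [Fin.cons_zero] at hv0
  obtain ⟨y, rfl⟩ := (σ * τ).surjective v
  rw [apply_mem_im] at hv0
  have h1 := hmem' y hv0
  have hjk : ((τ y).val - b) / s < k' := by
    apply Nat.div_lt_of_lt_mul
    have := mul_comm s k'
    omega
  have h2 := hv (Fin.succ ⟨((τ y).val - b) / s, hjk⟩)
  rw [Fin.cons_succ, Equiv.Perm.mul_apply, apply_mem_im, mem_arcZ_val _ (by omega)] at h2
  have h3 := Nat.div_add_mod ((τ y).val - b) s
  have h4 := Nat.mod_lt ((τ y).val - b) hs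
  have h5 : (τ y).val < 2 * (m' + 1 + 1) := (τ y).val_lt
  simp only at h2
  rw [mul_comm] at h3
  omega

theorem cent_step {m' s k : ℕ} (hs : 1 ≤ s) (hsN : s < 2 * (m' + 1 + 1))
    (hks : 2 * (m' + 1 + 1) < k * s) (G : Finset (Finset (Zn (m' + 1))))
    (hcov : ∀ f : Fin k → Finset (Zn (m' + 1)), (∀ i, f i ∈ G) → ∃ v, ∀ i, v ∉ f i)
    (hall : ∀ σ, InH σ → ∃ c, ∀ a, im σ (arcZ a s) ∈ G ↔ a ∉ arcZ c s)
    (σ : Equiv.Perm (Zn (m' + 1))) (hH : InH σ) (hσ : Cent s G σ) (i : Fin m') :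
    Cent s G (σ * lf (Equiv.swap i.castSucc i.succ)) := by
  obtain ⟨c, hc⟩ := hall _ (hH.mul (InH.lf (Equiv.swap i.castSucc i.succ)))
  have hsub : Finset.univ.filter (fun a : Zn (m' + 1) => (0 : Zn (m' + 1)) ∈ arcZ a s)
      ⊆ arcZ c s := by
    intro a ha
    simp only [Finset.mem_filter, Finset.mem_univ, true_and] at ha
    have := step_cover hs hsN hks G hcov σ hσ i a ha
    rw [hc] at this
    simpa using this
  have heq := Finset.eq_of_subset_of_card_le hsub (by
    rw [card_star_arc hsN.le, card_arcZ _ _ hsN.le])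
  intro a
  rw [hc, ← heq]
  simp

theorem cent_all {m s k : ℕ} (hs : 1 ≤ s) (hsN : s < 2 * (m + 1))
    (hks : 2 * (m + 1) < k * s) (G : Finset (Finset (Zn m)))
    (hcov : ∀ f : Fin k → Finset (Zn m), (∀ i, f i ∈ G) → ∃ v, ∀ i, v ∉ f i)
    (hall : ∀ σ, InH σ → ∃ c, ∀ a, im σ (arcZ a s) ∈ G ↔ a ∉ arcZ c s)
    (σ : Equiv.Perm (Zn m)) (hH : InH σ) (hσ : Cent s G σ) (p : Equiv.Perm (Fin m)) :
    Cent s G (σ * lf p) := by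
  rcases m with _ | m'
  · have : p = 1 := Subsingleton.elim _ _
    rw [this, lf_one, mul_one]; exact hσ
  · have hp : p ∈ Submonoid.closure (Set.range fun i : Fin m' ↦ Equiv.swap i.castSucc i.succ) := by
      rw [Equiv.Perm.mclosure_swap_castSucc_succ]; trivial
    revert hσ hH σ
    induction hp using Submonoid.closure_induction with
    | mem x hx =>
      intro σ hH hσ
      obtain ⟨i, rfl⟩ := hx
      exact cent_step hs hsN hks G hcov hall σ hH hσ i
    | one => intro σ hH hσ; rw [lf_one, mul_one]; exact hσ
    | mul x y _ _ hx hy =>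
      intro σ hH hσ
      rw [lf_mul, ← mul_assoc]
      exact hy _ (hH.mul (InH.lf x)) (hx σ hH hσ)

theorem ind_card {m : ℕ} (B : Finset (Zn m)) (hB : Ind B) : B.card ≤ m + 1 := by
  have h : (B.map (Equiv.addRight ((m + 1 : ℕ) : Zn m)).toEmbedding) ⊆ Bᶜ := by
    intro v hv
    rw [Finset.mem_map] at hv
    obtain ⟨w, hw, rfl⟩ := hv
    exact Finset.mem_compl.2 (hB w hw)
  have := Finset.card_le_card h
  rw [Finset.card_map, Finset.card_compl, ZMod.card] at this
  omega

theorem ind_compl {m : ℕ} (B : Finset (Zn m)) (hB : Ind B) (hc : B.card = m + 1) : Ind Bᶜ := by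
  have h : (B.map (Equiv.addRight ((m + 1 : ℕ) : Zn m)).toEmbedding) ⊆ Bᶜ := by
    intro v hv
    rw [Finset.mem_map] at hv
    obtain ⟨w, hw, rfl⟩ := hv
    exact Finset.mem_compl.2 (hB w hw)
  have heq := Finset.eq_of_subset_of_card_le h (by
    rw [Finset.card_map, Finset.card_compl, ZMod.card]; omega)
  intro v hv
  rw [← heq, Finset.mem_map] at hv
  obtain ⟨w, hw, rfl⟩ := hv
  have := half_add_half w
  simp only [Equiv.coe_toEmbedding, Equiv.coe_addRight]
  rw [this]
  simpa using hw

theorem core {m s k : ℕ} (hs : 1 ≤ s) (hsN : s < 2 * (m + 1))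
    (hks : 2 * (m + 1) < k * s) (G : Finset (Finset (Zn m)))
    (hG : G ⊆ Qs m s)
    (hcov : ∀ f : Fin k → Finset (Zn m), (∀ i, f i ∈ G) → ∃ v, ∀ i, v ∉ f i)
    (hcard : (2 * (m + 1) - s) * (Qs m s).card ≤ 2 * (m + 1) * G.card) :
    ∃ x, ∀ B, B ∈ G ↔ B ∈ Qs m s ∧ x ∉ B := by
  classical
  obtain ⟨c, hc0, hcH, hcG⟩ := counting m s hsN.le
  have hcyc := fun σ => cyc_main (N := 2 * (m + 1)) hs hsN hks (Sset s G σ) (by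
    intro f hf
    obtain ⟨v, hv⟩ := hcov (fun i => im σ (arcZ (f i) s)) (fun i => (mem_Sset _ _ _).1 (hf i))
    refine ⟨σ.symm v, fun i => ?_⟩
    have := hv i
    rwa [mem_im] at this)
  have hsum := hcG G hG
  have hconst : ∑ σ ∈ Hs m, (2 * (m + 1) - s) = (2 * (m + 1) - s) * (c * (Qs m s).card) := by
    rw [Finset.sum_const, smul_eq_mul, hcH, mul_comm]
  have hge : ∑ σ ∈ Hs m, (2 * (m + 1) - s) ≤ ∑ σ ∈ Hs m, (Sset s G σ).card := by
    rw [hconst, hsum]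
    have := Nat.mul_le_mul_left c hcard
    nlinarith
  have hle : ∑ σ ∈ Hs m, (Sset s G σ).card ≤ ∑ σ ∈ Hs m, (2 * (m + 1) - s) :=
    Finset.sum_le_sum (fun σ _ => (hcyc σ).1)
  have hEq := le_antisymm hle hge
  have heach := (Finset.sum_eq_sum_iff_of_le (fun σ _ => (hcyc σ).1)).1 hEq
  have hall : ∀ σ, InH σ → ∃ c, ∀ a, im σ (arcZ a s) ∈ G ↔ a ∉ arcZ c s := by
    intro σ hσ
    obtain ⟨c, hc⟩ := (hcyc σ).2 (heach σ ((mem_Hs σ).2 hσ))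
    refine ⟨c, fun a => ?_⟩
    rw [← mem_Sset, hc]
  obtain ⟨σ, hH, hσ⟩ : ∃ σ, InH σ ∧ Cent s G σ := by
    obtain ⟨c, hc⟩ := hall 1 InH.one
    -- arcs starting in `[c, c+s)` are those containing `c + s - 1`
    refine ⟨rot (c + ((s - 1 : ℕ) : Zn m)), InH.rot _, fun a => ?_⟩
    rw [im_rot]
    have h1 := hc (a + (c + ((s - 1 : ℕ) : Zn m)))
    have h2 : ∀ B : Finset (Zn m), im 1 B = B := by intro B; ext v; rw [mem_im]; rfl
    rw [h2] at h1
    rw [h1, mem_arcZ, mem_arcZ]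
    have h3 : a + (c + ((s - 1 : ℕ) : Zn m)) - c = a + ((s - 1 : ℕ) : Zn m) := by ring
    rw [h3]
    have h4 : a + ((s - 1 : ℕ) : Zn m) = ((s - 1 : ℕ) : Zn m) - (0 - a) := by ring
    rw [h4]
    have h5 : (0 - a) = (((0 - a).val : ℕ) : Zn m) := (ZMod.natCast_zmod_val _).symm
    have h6 : (0 - a).val < 2 * (m + 1) := ZMod.val_lt _
    have h7 := val_sub_nat (0 - a).val h6.le ((s - 1 : ℕ) : Zn m)
    rw [← h5, ZMod.val_natCast_of_lt (by omega)] at h7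
    rw [h7]
    split_ifs <;> omega
  have hcent := cent_all hs hsN hks G hcov hall σ hH hσ
  have hind : ∀ B : Finset (Zn m), Ind B → σ 0 ∈ B → ∃ p a, B = im (σ * lf p) (arcZ a B.card) ∧
      (0 : Zn m) ∈ arcZ a B.card := by
    intro B hB h0
    obtain ⟨p, a, h1, h2⟩ := sort_arc (im σ⁻¹ B) (hB.im hH.inv) (by
      rw [mem_im]; exact h0)
    rw [card_im] at h1 h2
    refine ⟨p, a, ?_, h2⟩
    rw [im_mul, ← h1, im_symm_im]
  refine ⟨σ 0, ?_⟩
  set D := (Qs m s).filter (fun B => σ 0 ∉ B) with hD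
  have hDcard : D.card = G.card := by
    have h1 := hcG D (Finset.filter_subset _ _)
    have h2 : ∀ ρ ∈ Hs m, (Sset s D ρ).card = 2 * (m + 1) - s := by
      intro ρ hρ
      rw [mem_Hs] at hρ
      have h3 : Sset s D ρ = (Finset.univ.filter (fun a : Zn m => ρ.symm (σ 0) ∈ arcZ a s))ᶜ := by
        ext a
        rw [mem_Sset, hD, Finset.mem_filter, mem_Qs, mem_im]
        have h4 : (im ρ (arcZ a s)).card = s := by rw [card_im, card_arcZ _ _ hsN.le]
        have h5 : Ok (im ρ (arcZ a s)) := (ok_arc a s hsN.le).im hρ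
        simp [h4, h5]
      rw [h3, Finset.card_compl, card_star_arc hsN.le, ZMod.card]
    rw [Finset.sum_congr rfl h2, ← hEq, hsum] at h1
    have h6 := Nat.eq_of_mul_eq_mul_left (by omega) h1
    exact (Nat.eq_of_mul_eq_mul_left hc0 h6).symm
  have hGD : G = D := by
    rcases Nat.lt_or_ge (m + 1) s with hsm | hsm
    · symm
      apply Finset.eq_of_subset_of_card_le _ hDcard.symm.le
      intro B hB
      rw [hD, Finset.mem_filter, mem_Qs] at hB
      obtain ⟨⟨hBc, hBok⟩, hxB⟩ := hB
      have hBi : Ind Bᶜ := by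
        rcases hBok with h | h
        · have := ind_card B h; omega
        · exact h
      obtain ⟨p, a, h1, h2⟩ := hind Bᶜ hBi (by simpa using hxB)
      have hcc : Bᶜ.card = 2 * (m + 1) - s := by rw [Finset.card_compl, ZMod.card, hBc]
      rw [hcc] at h1 h2
      have h3 : B = im (σ * lf p) (arcZ (a + ((2 * (m + 1) - s : ℕ) : Zn m)) s) := by
        rw [← compl_inj_iff, h1, ← im_compl, compl_arcZ _ _ hsN.le]
        congr 2
        rw [add_assoc, ← Nat.cast_add, Nat.sub_add_cancel hsN.le]
        have : ((2 * (m + 1) : ℕ) : Zn m) = 0 := ZMod.natCast_self _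
        rw [this, add_zero]
      have h4 : (arcZ a (2 * (m + 1) - s))ᶜ = arcZ (a + ((2 * (m + 1) - s : ℕ) : Zn m)) s := by
        rw [compl_arcZ _ _ (by omega)]
        congr 1; omega
      rw [h3, hcent p, ← h4]
      simpa using h2
    · apply Finset.eq_of_subset_of_card_le _ hDcard.le
      intro B hB
      have hBQ := hG hB
      rw [hD, Finset.mem_filter]
      refine ⟨hBQ, fun hx => ?_⟩
      rw [mem_Qs] at hBQ
      have hBi : Ind B := by
        rcases hBQ.2 with h | h
        · exact h
        · have h1 := ind_card _ h
          have h2 : Bᶜ.card = 2 * (m + 1) - s := by rw [Finset.card_compl, ZMod.card, hBQ.1]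
          have h3 := ind_compl _ h (by omega)
          rwa [compl_compl] at h3
      obtain ⟨p, a, h1, h2⟩ := hind B hBi hx
      rw [hBQ.1] at h1 h2
      rw [h1, hcent p] at hB
      exact hB h2
  intro B
  rw [hGD, hD, Finset.mem_filter]

theorem ind_count (m t : ℕ) (T : Finset (Finset (Zn m))) (hT : ∀ A ∈ T, A.card = t ∧ Ind A) :
    T.card ≤ (m + 1).choose t * 2 ^ t := by
  classical
  have hcard : ((Finset.powersetCard t (Finset.univ : Finset (Fin (m + 1)))).sigma
      (fun J => J.powerset)).card = (m + 1).choose t * 2 ^ t := by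
    rw [Finset.card_sigma, Finset.sum_congr rfl (g := fun _ => 2 ^ t), Finset.sum_const,
      smul_eq_mul, Finset.card_powersetCard, Finset.card_univ, Fintype.card_fin]
    intro J hJ
    rw [Finset.mem_powersetCard] at hJ
    rw [Finset.card_powerset, hJ.2]
  rw [← hcard]
  apply Finset.card_le_card_of_injOn (fun A => ⟨A.image (fun v => ((psi m).symm v).1),
    Finset.univ.filter (fun i => psi m (i, true) ∈ A)⟩)
  · intro A hA
    obtain ⟨hc, hi⟩ := hT A hA
    rw [Finset.mem_coe, Finset.mem_sigma, Finset.mem_powersetCard, Finset.mem_powerset]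
    refine ⟨⟨Finset.subset_univ _, ?_⟩, ?_⟩
    · rw [Finset.card_image_of_injOn, hc]
      intro v hv w hw hvw
      obtain ⟨i, b, rfl⟩ := psi_surj v
      obtain ⟨j, c, rfl⟩ := psi_surj w
      simp only [Equiv.symm_apply_apply] at hvw
      subst hvw
      have := hi _ hv
      rw [psi_not] at this
      by_cases hbc : c = b
      · rw [hbc]
      · have : c = !b := by cases b <;> cases c <;> simp_all
        rw [this] at hw
        exact absurd hw (by assumption)
    · intro i hi
      rw [Finset.mem_filter] at hi
      rw [Finset.mem_image]
      exact ⟨_, hi.2, by simp⟩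
  · intro A hA B hB hAB
    have hA' := (hT A hA).2
    have hB' := (hT B hB).2
    rw [Sigma.mk.injEq] at hAB
    obtain ⟨h1, h2⟩ := hAB
    have h2 := eq_of_heq h2
    have hmem : ∀ A : Finset (Zn m), Ind A → ∀ i, psi m (i, false) ∈ A ↔
        (i ∈ A.image (fun v => ((psi m).symm v).1) ∧
        i ∉ Finset.univ.filter (fun i => psi m (i, true) ∈ A)) := by
      intro A hA i
      rw [Finset.mem_image, Finset.mem_filter]
      constructor
      · intro h
        refine ⟨⟨_, h, by simp⟩, ?_⟩
        have := hA _ h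
        rw [psi_not] at this
        simpa using this
      · rintro ⟨⟨v, hv, rfl⟩, h⟩
        obtain ⟨j, b, rfl⟩ := psi_surj v
        cases b
        · simpa using hv
        · exfalso; apply h; simpa using hv
    ext v
    obtain ⟨i, b, rfl⟩ := psi_surj v
    cases b
    · rw [hmem A hA', hmem B hB', h1, h2]
    · have := congrArg (fun X => i ∈ X) h2
      simpa using this

theorem Qs_card (m s : ℕ) (hs : s ≤ 2 * (m + 1)) :
    (Qs m s).card ≤ if s ≤ m + 1 then (m + 1).choose s * 2 ^ s
      else (m + 1).choose (2 * (m + 1) - s) * 2 ^ (2 * (m + 1) - s) := by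
  split_ifs with h
  · apply ind_count
    intro B hB
    rw [mem_Qs] at hB
    refine ⟨hB.1, ?_⟩
    rcases hB.2 with h' | h'
    · exact (h' : _)
    · have h1 := ind_card _ h'
      have h2 : Bᶜ.card = 2 * (m + 1) - s := by rw [Finset.card_compl, ZMod.card, hB.1]
      have h3 := ind_compl _ h' (by omega)
      rwa [compl_compl] at h3
  · rw [← Finset.card_image_of_injective (Qs m s) (f := fun B => Bᶜ) compl_injective]
    apply ind_count
    intro B hB
    rw [Finset.mem_image] at hB
    obtain ⟨C, hC, rfl⟩ := hB
    rw [mem_Qs] at hC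
    refine ⟨by rw [Finset.card_compl, ZMod.card, hC.1], ?_⟩
    rcases hC.2 with h' | h'
    · have h1 := ind_card _ h'
      omega
    · exact (h' : _)

def cs (m : ℕ) (A : Finset ℕ) : Finset (Zn m) := A.image (fun x : ℕ => (x : Zn m))

theorem castZn_inj {m x y : ℕ} (hx : x ∈ Finset.Icc 1 (2 * (m + 1)))
    (hy : y ∈ Finset.Icc 1 (2 * (m + 1))) (h : (x : Zn m) = (y : Zn m)) : x = y := by
  rw [Finset.mem_Icc] at hx hy
  rw [ZMod.natCast_eq_natCast_iff'] at h
  rcases Nat.lt_or_ge x (2 * (m + 1)) with h1 | h1 <;>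
    rcases Nat.lt_or_ge y (2 * (m + 1)) with h2 | h2
  · rwa [Nat.mod_eq_of_lt h1, Nat.mod_eq_of_lt h2] at h
  · have : y = 2 * (m + 1) := by omega
    rw [Nat.mod_eq_of_lt h1, this, Nat.mod_self] at h
    omega
  · have : x = 2 * (m + 1) := by omega
    rw [Nat.mod_eq_of_lt h2, this, Nat.mod_self] at h
    omega
  · omega

theorem mem_cs {m x : ℕ} {A : Finset ℕ} (hA : A ⊆ Finset.Icc 1 (2 * (m + 1)))
    (hx : x ∈ Finset.Icc 1 (2 * (m + 1))) : (x : Zn m) ∈ cs m A ↔ x ∈ A := by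
  rw [cs, Finset.mem_image]
  constructor
  · rintro ⟨y, hy, h⟩
    rwa [← castZn_inj (hA hy) hx h]
  · intro h; exact ⟨x, h, rfl⟩

theorem cast_surj {m : ℕ} (z : Zn m) : ∃ x ∈ Finset.Icc 1 (2 * (m + 1)), z = (x : Zn m) := by
  have hz : z.val < 2 * (m + 1) := z.val_lt
  by_cases h : z.val = 0
  · refine ⟨2 * (m + 1), by rw [Finset.mem_Icc]; omega, ?_⟩
    have h1 : ((2 * (m + 1) : ℕ) : Zn m) = 0 := ZMod.natCast_self _
    rw [h1]; exact (ZMod.val_eq_zero z).1 h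
  · exact ⟨z.val, by rw [Finset.mem_Icc]; omega, (ZMod.natCast_zmod_val z).symm⟩

theorem card_cs {m : ℕ} {A : Finset ℕ} (hA : A ⊆ Finset.Icc 1 (2 * (m + 1))) :
    (cs m A).card = A.card :=
  Finset.card_image_of_injOn (fun _ hx _ hy h => castZn_inj (hA hx) (hA hy) h)

theorem cs_inj {m : ℕ} {A B : Finset ℕ} (hA : A ⊆ Finset.Icc 1 (2 * (m + 1)))
    (hB : B ⊆ Finset.Icc 1 (2 * (m + 1))) (h : cs m A = cs m B) : A = B := by
  ext x
  constructor
  · intro hx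
    have h1 := (mem_cs hA (hA hx)).2 hx
    rw [h] at h1
    exact (mem_cs hB (hA hx)).1 h1
  · intro hx
    have h1 := (mem_cs hB (hB hx)).2 hx
    rw [← h] at h1
    exact (mem_cs hA (hB hx)).1 h1

theorem cast_add_half (m x : ℕ) :
    (x : Zn m) + ((m + 1 : ℕ) : Zn m) = ((x + (m + 1) : ℕ) : Zn m) := by push_cast; ring

theorem cast_add_half' (m x : ℕ) :
    ((x + (m + 1) : ℕ) : Zn m) + ((m + 1 : ℕ) : Zn m) = (x : Zn m) := by
  rw [← cast_add_half, half_add_half]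

theorem indep_iff {m : ℕ} (A : Finset ℕ) :
    IsIndepMn (m + 1) A ↔ A ⊆ Finset.Icc 1 (2 * (m + 1)) ∧ Ind (cs m A) := by
  unfold IsIndepMn
  refine and_congr_right (fun hA => ?_)
  constructor
  · intro h v hv hv'
    obtain ⟨x, hx, rfl⟩ := cast_surj v
    rw [mem_cs hA hx] at hv
    rw [Finset.mem_Icc] at hx
    by_cases hxm : x ≤ m + 1
    · rw [cast_add_half, mem_cs hA (by rw [Finset.mem_Icc]; omega)] at hv'
      exact h x (by rw [Finset.mem_Icc]; omega) ⟨hv, hv'⟩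
    · obtain ⟨y, rfl⟩ : ∃ y, x = y + (m + 1) := ⟨x - (m + 1), by omega⟩
      rw [cast_add_half', mem_cs hA (by rw [Finset.mem_Icc]; omega)] at hv'
      exact h y (by rw [Finset.mem_Icc]; omega) ⟨hv', hv⟩
  · rintro h i hi ⟨h1, h2⟩
    apply h (i : Zn m) ((mem_cs hA (hA h1)).2 h1)
    rw [cast_add_half]
    exact (mem_cs hA (hA h2)).2 h2

theorem coindep_iff {m : ℕ} (A : Finset ℕ) (hA : A ⊆ Finset.Icc 1 (2 * (m + 1))) :
    Ind (cs m A)ᶜ ↔ ∀ i ∈ Finset.Icc 1 (m + 1), i ∈ A ∨ i + (m + 1) ∈ A := by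
  constructor
  · intro h i hi
    rw [Finset.mem_Icc] at hi
    by_contra hcon
    push Not at hcon
    have h1 : i ∈ Finset.Icc 1 (2 * (m + 1)) := by rw [Finset.mem_Icc]; omega
    have h2 : i + (m + 1) ∈ Finset.Icc 1 (2 * (m + 1)) := by rw [Finset.mem_Icc]; omega
    apply h (i : Zn m)
    · rw [Finset.mem_compl, mem_cs hA h1]; exact hcon.1
    · rw [cast_add_half, Finset.mem_compl, mem_cs hA h2]; exact hcon.2
  · intro h v hv hv'
    obtain ⟨x, hx, rfl⟩ := cast_surj v
    rw [Finset.mem_compl, mem_cs hA hx] at hv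
    rw [Finset.mem_Icc] at hx
    rw [Finset.mem_compl] at hv'
    by_cases hxm : x ≤ m + 1
    · rw [cast_add_half, mem_cs hA (by rw [Finset.mem_Icc]; omega)] at hv'
      exact (h x (by rw [Finset.mem_Icc]; omega)).elim hv hv'
    · obtain ⟨y, rfl⟩ : ∃ y, x = y + (m + 1) := ⟨x - (m + 1), by omega⟩
      rw [cast_add_half', mem_cs hA (by rw [Finset.mem_Icc]; omega)] at hv'
      exact (h y (by rw [Finset.mem_Icc]; omega)).elim hv' hv

theorem indepNum_eq (m : ℕ) : indepNumMn (m + 1) = m + 1 := by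
  apply IsGreatest.csSup_eq
  constructor
  · refine ⟨Finset.Icc 1 (m + 1), ⟨Finset.Icc_subset_Icc le_rfl (by omega), ?_⟩, by simp⟩
    rintro i hi ⟨-, h2⟩
    rw [Finset.mem_Icc] at hi h2
    omega
  · rintro k ⟨A, hA, rfl⟩
    rw [indep_iff] at hA
    rw [← card_cs hA.1]
    exact ind_card _ hA.2

theorem transversal_iff {m : ℕ} (A : Finset ℕ) (hA : A ⊆ Finset.Icc 1 (2 * (m + 1))) :
    (∃ B ⊆ A, IsIndepMn (m + 1) B ∧ B.card = m + 1) ↔ Ind (cs m A)ᶜ := by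
  classical
  constructor
  · rintro ⟨B, hBA, hB, hBc⟩
    rw [indep_iff] at hB
    have h1 := ind_compl _ hB.2 (by rw [card_cs hB.1, hBc])
    rw [coindep_iff B hB.1] at h1
    rw [coindep_iff A hA]
    intro i hi
    exact (h1 i hi).imp (fun h => hBA h) (fun h => hBA h)
  · rw [coindep_iff A hA]
    intro h
    refine ⟨(Finset.Icc 1 (m + 1)).image (fun i => if i ∈ A then i else i + (m + 1)), ?_, ⟨?_, ?_⟩, ?_⟩
    · intro x hx
      rw [Finset.mem_image] at hx
      obtain ⟨i, hi, rfl⟩ := hx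
      have := h i hi
      split_ifs with h1
      · exact h1
      · exact this.resolve_left h1
    · intro x hx
      rw [Finset.mem_image] at hx
      obtain ⟨i, hi, rfl⟩ := hx
      rw [Finset.mem_Icc] at hi ⊢
      split_ifs <;> omega
    · rintro i hi ⟨h1, h2⟩
      rw [Finset.mem_image] at h1 h2
      obtain ⟨j, hj, h1⟩ := h1
      obtain ⟨l, hl, h2⟩ := h2
      rw [Finset.mem_Icc] at hi hj hl
      have hji : j = i := by split_ifs at h1 <;> omega
      have hli : l = i := by split_ifs at h2 <;> omega
      subst hji
      subst hli
      split_ifs at h1 h2 <;> omega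
    · rw [Finset.card_image_of_injOn, Nat.card_Icc]
      · omega
      · intro i hi j hj hij
        rw [Finset.mem_coe, Finset.mem_Icc] at hi hj
        simp only at hij
        split_ifs at hij <;> omega

theorem famP_iff {m r : ℕ} (A : Finset ℕ) :
    A ∈ famP (m + 1) r ↔ A ⊆ Finset.Icc 1 (2 * (m + 1)) ∧ A.card = r ∧ Ok (cs m A) := by
  have hI : A ∈ famI (m + 1) r ↔ A.card = r ∧ IsIndepMn (m + 1) A := Iff.rfl
  have hM : A ∈ famM (m + 1) r ↔ A ⊆ Finset.Icc 1 (2 * (m + 1)) ∧ A.card = r ∧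
    ∃ B ⊆ A, IsIndepMn (m + 1) B ∧ B.card = indepNumMn (m + 1) := Iff.rfl
  have hP : A ∈ famP (m + 1) r ↔ A ∈ famI (m + 1) r ∨ A ∈ famM (m + 1) r := Iff.rfl
  rw [hP, hI, hM, indepNum_eq, indep_iff]
  constructor
  · rintro (⟨h1, h2, h3⟩ | ⟨h1, h2, h3⟩)
    · exact ⟨h2, h1, Or.inl h3⟩
    · exact ⟨h1, h2, Or.inr ((transversal_iff A h1).1 h3)⟩
  · rintro ⟨h1, h2, h3 | h3⟩
    · exact Or.inl ⟨h2, h1, h3⟩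
    · exact Or.inr ⟨h1, h2, (transversal_iff A h1).2 h3⟩

theorem card_arith (m r : ℕ) (hr : 1 ≤ r) (hrN : r < 2 * (m + 1)) :
    r * (Qs m (2 * (m + 1) - r)).card ≤ 2 * (m + 1) *
      (if r ≤ m + 1 then 2 ^ (r - 1) * (m + 1 - 1).choose (r - 1)
      else 2 ^ (2 * (m + 1) - r) * (m + 1 - 1).choose (2 * (m + 1) - r)
        + 2 ^ (2 * (m + 1) - r - 1) * (m + 1 - 1).choose (2 * (m + 1) - r - 1)) := by
  have hle : (Qs m (2 * (m + 1) - r)).card ≤ if r ≤ m + 1 then (m + 1).choose r * 2 ^ r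
      else (m + 1).choose (2 * (m + 1) - r) * 2 ^ (2 * (m + 1) - r) := by
    have h := Qs_card m (2 * (m + 1) - r) (by omega)
    have h2 : 2 * (m + 1) - (2 * (m + 1) - r) = r := by omega
    rw [h2] at h
    rcases lt_trichotomy r (m + 1) with h1 | h1 | h1
    · rw [if_neg (by omega)] at h; rwa [if_pos h1.le]
    · rw [if_pos (by omega)] at h
      have h3 : 2 * (m + 1) - r = r := by omega
      rw [if_pos h1.le]
      rwa [h3] at h ⊢
    · rw [if_pos (by omega)] at h; rwa [if_neg (by omega)]
  refine (Nat.mul_le_mul_left r hle).trans (le_of_eq ?_)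
  rw [Nat.add_sub_cancel]
  split_ifs with h
  · obtain ⟨q, rfl⟩ : ∃ q, r = q + 1 := ⟨r - 1, by omega⟩
    have := Nat.add_one_mul_choose_eq m q
    rw [Nat.add_sub_cancel, pow_succ]
    zify at this ⊢
    linear_combination (-2 * 2 ^ q : ℤ) * this
  · obtain ⟨q, hq⟩ : ∃ q, 2 * (m + 1) - r = q + 1 := ⟨2 * (m + 1) - r - 1, by omega⟩
    rw [hq, Nat.add_sub_cancel, pow_succ]
    have h1 := Nat.add_one_mul_choose_eq m q
    have h2 := Nat.choose_succ_succ m q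
    have h3 : r + (q + 1) = 2 * (m + 1) := by omega
    rw [Nat.succ_eq_add_one, Nat.succ_eq_add_one] at h2
    generalize (m + 1).choose (q + 1) = c at *
    generalize m.choose (q + 1) = d at *
    generalize m.choose q = e at *
    subst h2
    have h4 : (r : ℤ) = 2 * (m + 1) - (q + 1) := by omega
    zify at h1 ⊢
    rw [h4]
    linear_combination (2 ^ q * 2 : ℤ) * h1

theorem kwise_matching_extremal (n r k : ℕ) (hn : 1 ≤ n) (hr : 1 ≤ r) (hk : 2 ≤ k)
    (hkr : k * r < (k - 1) * (2 * n))
    (𝓕 : Finset (Finset ℕ)) (h𝓕 : ↑𝓕 ⊆ famP n r)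
    (hint : KWiseIntersecting k 𝓕)
    (hcard : 𝓕.card =
      if r ≤ n then 2 ^ (r - 1) * (n - 1).choose (r - 1)
      else 2 ^ (2 * n - r) * (n - 1).choose (2 * n - r)
        + 2 ^ (2 * n - r - 1) * (n - 1).choose (2 * n - r - 1)) :
    ∃ x ∈ Finset.Icc 1 (2 * n), (↑𝓕 : Set (Finset ℕ)) = {A ∈ famP n r | x ∈ A} := by
  classical
  obtain ⟨m, rfl⟩ : ∃ m, n = m + 1 := ⟨n - 1, by omega⟩
  obtain ⟨k', rfl⟩ : ∃ k', k = k' + 1 := ⟨k - 1, by omega⟩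
  rw [Nat.add_sub_cancel] at hkr
  have hrN : r < 2 * (m + 1) := by
    by_contra hcon
    push Not at hcon
    have := Nat.mul_le_mul_left k' hcon
    have h2 := Nat.succ_mul k' r
    rw [Nat.succ_eq_add_one] at h2
    omega
  have hks : 2 * (m + 1) < (k' + 1) * (2 * (m + 1) - r) := by
    obtain ⟨s, hs⟩ : ∃ s, 2 * (m + 1) = r + s := ⟨2 * (m + 1) - r, by omega⟩
    rw [hs] at hkr ⊢
    rw [Nat.add_sub_cancel_left]
    nlinarith
  have hV : ∀ A ∈ 𝓕, A ⊆ Finset.Icc 1 (2 * (m + 1)) ∧ A.card = r ∧ Ok (cs m A) :=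
    fun A hA => (famP_iff A).1 (h𝓕 hA)
  have hinj : ∀ A B : Finset ℕ, A ⊆ Finset.Icc 1 (2 * (m + 1)) →
      B ⊆ Finset.Icc 1 (2 * (m + 1)) → (cs m A)ᶜ = (cs m B)ᶜ → A = B :=
    fun A B hA hB h => cs_inj hA hB (compl_injective h)
  have hQ : ∀ A : Finset ℕ, A ⊆ Finset.Icc 1 (2 * (m + 1)) ∧ A.card = r ∧ Ok (cs m A) →
      (cs m A)ᶜ ∈ Qs m (2 * (m + 1) - r) := by
    rintro A ⟨h1, h2, h3⟩
    rw [mem_Qs]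
    refine ⟨by rw [Finset.card_compl, ZMod.card, card_cs h1, h2], ?_⟩
    rcases h3 with h | h
    · right; rwa [compl_compl]
    · left; exact h
  obtain ⟨z, hz⟩ := core (m := m) (s := 2 * (m + 1) - r) (k := k' + 1) (by omega) (by omega) hks
    (𝓕.image (fun A => (cs m A)ᶜ)) (by
      intro B hB
      rw [Finset.mem_image] at hB
      obtain ⟨A, hA, rfl⟩ := hB
      exact hQ A (hV A hA)) (by
      intro f hf
      have : ∀ i, ∃ A ∈ 𝓕, (cs m A)ᶜ = f i := fun i => by
        have := hf i
        rwa [Finset.mem_image] at this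
      choose g hg hgf using this
      obtain ⟨v, hv⟩ := hint g hg
      refine ⟨(v : Zn m), fun i => ?_⟩
      rw [← hgf i, Finset.mem_compl, not_not]
      exact Finset.mem_image_of_mem _ (hv i)) (by
      rw [Finset.card_image_of_injOn (fun A hA B hB h => hinj A B (hV A hA).1 (hV B hB).1 h), hcard]
      have h2 : 2 * (m + 1) - (2 * (m + 1) - r) = r := by omega
      rw [h2]
      exact card_arith m r hr hrN)
  obtain ⟨x, hx, rfl⟩ := cast_surj z
  refine ⟨x, hx, ?_⟩
  apply Set.ext
  intro A
  show A ∈ 𝓕 ↔ A ∈ famP (m + 1) r ∧ x ∈ A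
  constructor
  · intro hA
    refine ⟨h𝓕 hA, ?_⟩
    have := ((hz _).1 (Finset.mem_image_of_mem _ hA)).2
    rwa [Finset.mem_compl, not_not, mem_cs (hV A hA).1 hx] at this
  · rintro ⟨hA, hxA⟩
    rw [famP_iff] at hA
    have h1 := (hz _).2 ⟨hQ A hA, by
      rw [Finset.mem_compl, not_not, mem_cs hA.1 hx]; exact hxA⟩
    rw [Finset.mem_image] at h1
    obtain ⟨A2, hA2, h2⟩ := h1
    rwa [← hinj A2 A (hV A2 hA2).1 hA.1 h2]
end

section
/- Let 1 ≤ r < n and let 𝓕 ⊆ 𝓘^r(M_n) be an intersecting family with |𝓕| = 2^{r−1}·C(n−1, r−1). Then there exists a vertex x of M_n such that 𝓕 = 𝓘^r_x(M_n), the family of all independent r-subsets of M_n containing x. -/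
namespace BL

open Finset

lemma cast_zero {n : ℕ} (d : ℤ) (h1 : |d| < 2 * n) (h : (d : ZMod (2 * n)) = 0) : d = 0 := by
  rw [ZMod.intCast_zmod_eq_zero_iff_dvd] at h
  exact Int.eq_zero_of_abs_lt_dvd h (by push_cast; exact h1)

/-- the antipode is an involution -/
lemma add_nn {n : ℕ} (v : ZMod (2 * n)) : v + n + n = v := by
  have : ((2 * n : ℕ) : ZMod (2 * n)) = 0 := ZMod.natCast_self _
  push_cast at this
  linear_combination this

lemma nn {n : ℕ} : (n : ZMod (2 * n)) + n = 0 := by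
  simpa using add_nn (0 : ZMod (2 * n))

lemma add_n_ne {n : ℕ} (hn : 0 < n) (v : ZMod (2 * n)) : v + n ≠ v := by
  intro h
  have h2 : ((n : ℤ) : ZMod (2 * n)) = 0 := by
    push_cast; linear_combination h
  have := cast_zero (n : ℤ) (by rw [abs_lt]; omega) h2
  omega

/-- cyclic interval of length r -/
def Iv (n r : ℕ) (s : ZMod (2 * n)) : Finset (ZMod (2 * n)) :=
  (range r).image (fun i : ℕ => s + (i : ZMod (2 * n)))

lemma mem_Iv {n r : ℕ} {s v : ZMod (2 * n)} : v ∈ Iv n r s ↔ ∃ i < r, s + (i : ℕ) = v := by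
  simp [Iv]

lemma mem_Iv_int {n r : ℕ} (hr : r ≤ n) (s : ZMod (2 * n)) (d : ℤ) (h1 : -n ≤ d)
    (h2 : d ≤ n) : s + (d : ZMod (2 * n)) ∈ Iv n r s ↔ 0 ≤ d ∧ d < r := by
  rw [mem_Iv]
  constructor
  · rintro ⟨i, hi, h⟩
    have := cast_zero (n := n) (i - d) (by rw [abs_lt]; omega)
      (by push_cast; linear_combination h)
    omega
  · rintro ⟨h3, h4⟩
    refine ⟨d.toNat, by omega, ?_⟩
    have : ((d.toNat : ℤ) : ZMod (2 * n)) = d := by rw [Int.toNat_of_nonneg h3]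
    rw [← this]; push_cast; rfl

lemma card_Iv {n r : ℕ} (hr : r ≤ n) (s : ZMod (2 * n)) : (Iv n r s).card = r := by
  rw [Iv, card_image_of_injOn, card_range]
  intro i hi j hj h
  simp only [coe_range, Set.mem_Iio] at hi hj
  simp only [add_right_inj] at h
  have := cast_zero (n := n) (i - j) (by rw [abs_lt]; omega)
      (by push_cast; linear_combination h)
  omega

/-- independent sets -/
def Ind {n : ℕ} (A : Finset (ZMod (2 * n))) : Prop := ∀ a ∈ A, a + n ∉ A

/-- signed permutations -/
def IsG {n : ℕ} (σ : Equiv.Perm (ZMod (2 * n))) : Prop := ∀ v, σ (v + n) = σ v + n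

lemma IsG.mul {n : ℕ} {σ τ : Equiv.Perm (ZMod (2 * n))} (h : IsG σ) (h' : IsG τ) :
    IsG (σ * τ) := fun v => by simp [Equiv.Perm.mul_apply, h' v, h (τ v)]

lemma IsG.inv {n : ℕ} {σ : Equiv.Perm (ZMod (2 * n))} (h : IsG σ) : IsG (σ⁻¹) := fun v => by
  rw [Equiv.Perm.inv_eq_iff_eq, h]; simp

lemma isG_add {n : ℕ} (s : ZMod (2 * n)) : IsG (Equiv.addLeft s : Equiv.Perm (ZMod (2 * n))) :=
  fun v => by simp [add_assoc]

lemma Ind_Iv {n r : ℕ} (hr : r < n) (s : ZMod (2 * n)) : Ind (Iv n r s) := by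
  intro a ha
  obtain ⟨i, hi, rfl⟩ := mem_Iv.1 ha
  intro h
  obtain ⟨j, hj, h⟩ := mem_Iv.1 h
  have := cast_zero (n := n) (j - i - n) (by rw [abs_lt]; omega)
      (by push_cast; linear_combination h)
  omega

lemma Ind.image {n : ℕ} {A : Finset (ZMod (2 * n))} (h : Ind A)
    {σ : Equiv.Perm (ZMod (2 * n))} (hσ : IsG σ) : Ind (A.image σ) := by
  intro a ha hb
  simp only [mem_image] at ha hb
  obtain ⟨a, ha, rfl⟩ := ha
  obtain ⟨b, hb, e⟩ := hb
  rw [← hσ, σ.injective.eq_iff] at e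
  exact h a ha (e ▸ hb)

lemma Ind.card_le {n : ℕ} (hn : 0 < n) {A : Finset (ZMod (2 * n))} (h : Ind A) :
    A.card ≤ n := by
  have : NeZero (2 * n) := ⟨by omega⟩
  have hd : Disjoint A (A.image (fun v => v + (n : ZMod (2 * n)))) := by
    rw [Finset.disjoint_left]
    intro a ha hb
    simp only [mem_image] at hb
    obtain ⟨b, hb, e⟩ := hb
    exact h b hb (e ▸ ha)
  have h1 := card_le_univ (A ∪ A.image (fun v => v + (n : ZMod (2 * n))))
  rw [card_union_of_disjoint hd, card_image_of_injective _ (add_left_injective _),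
    ZMod.card] at h1
  omega

lemma step {n : ℕ} (a b : ZMod (2 * n)) : ∃ τ : Equiv.Perm (ZMod (2 * n)), IsG τ ∧
    τ a = b ∧ ∀ v, v ≠ a → v ≠ b → v ≠ a + n → v ≠ b + n → τ v = v := by
  rcases Nat.eq_zero_or_pos n with rfl | hn
  · refine ⟨Equiv.swap a b, fun v => by simp, by simp, fun v h1 h2 _ _ => ?_⟩
    exact Equiv.swap_apply_of_ne_of_ne h1 h2
  by_cases hab : a = b
  · subst hab
    exact ⟨1, fun v => by simp, by simp, by simp⟩
  have inj : ∀ u v : ZMod (2 * n), u + n = v ↔ u = v + n := fun u v => by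
    constructor
    · rintro rfl; rw [add_nn]
    · rintro rfl; rw [add_nn]
  have hne := fun v => add_n_ne hn v
  by_cases hab' : b = a + n
  · subst hab'
    refine ⟨Equiv.swap a (a + n), fun v => ?_, by simp, fun v h1 h2 _ _ =>
      Equiv.swap_apply_of_ne_of_ne h1 h2⟩
    by_cases h1 : v = a
    · subst h1; simp [add_nn]
    by_cases h2 : v = a + n
    · subst h2; simp [add_nn]
    rw [Equiv.swap_apply_of_ne_of_ne h1 h2, Equiv.swap_apply_of_ne_of_ne]
    · rwa [Ne, inj]
    · rwa [Ne, add_left_inj]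
  · have hba' : a ≠ b + n := fun h => hab' (by rw [h, add_nn])
    refine ⟨Equiv.swap a b * Equiv.swap (a + n) (b + n), fun v => ?_, ?_, ?_⟩
    · have h1 := hne a
      have h2 := hne b
      have h3 := add_nn a
      have h4 := add_nn b
      have h5 := add_nn v
      have h6 := inj v a
      have h7 := inj v b
      simp only [Equiv.Perm.mul_apply, Equiv.swap_apply_def]
      clear inj hne
      grind
    · have h1 := (hne a).symm
      rw [Equiv.Perm.mul_apply, Equiv.swap_apply_of_ne_of_ne h1 hba', Equiv.swap_apply_left]
    · intro v h1 h2 h3 h4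
      rw [Equiv.Perm.mul_apply, Equiv.swap_apply_of_ne_of_ne h3 h4,
        Equiv.swap_apply_of_ne_of_ne h1 h2]

/-- prescribed initial positions -/
lemma ext_list {n : ℕ} (hn : 0 < n) (l : List (ZMod (2 * n)))
    (hnd : l.Nodup) (hI : Ind l.toFinset) :
    ∃ σ : Equiv.Perm (ZMod (2 * n)), IsG σ ∧ l.length ≤ n ∧
      ∀ i (h : i < l.length), σ (i : ℕ) = l[i] := by
  have hlen : l.length ≤ n := by
    have := hI.card_le hn
    rwa [List.toFinset_card_of_nodup hnd] at this
  suffices H : ∀ m ≤ l.length, ∃ σ : Equiv.Perm (ZMod (2 * n)), IsG σ ∧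
      ∀ i (h : i < l.length), i < m → σ (i : ℕ) = l[i] by
    obtain ⟨σ, h1, h2⟩ := H l.length le_rfl
    exact ⟨σ, h1, hlen, fun i h => h2 i h h⟩
  intro m
  induction m with
  | zero => exact fun _ => ⟨1, fun v => by simp, fun i _ h => by omega⟩
  | succ m ih =>
    intro hm
    obtain ⟨σ, h1, h2⟩ := ih (by omega)
    obtain ⟨τ, t1, t2, t3⟩ := step (σ (m : ℕ)) (l[m])
    refine ⟨τ * σ, t1.mul h1, fun i hi him => ?_⟩
    rw [Equiv.Perm.mul_apply]
    rcases Nat.lt_succ_iff_lt_or_eq.1 him with h | h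
    · have hp : l[i] ≠ l[m] ∧ l[i] ≠ l[m] + n := by
        constructor
        · intro e
          have := (List.Nodup.getElem_inj_iff hnd).1 e
          omega
        · intro e
          have h3 : l[m] ∈ l.toFinset := List.mem_toFinset.2 (List.getElem_mem _)
          have h4 : l[i] ∈ l.toFinset := List.mem_toFinset.2 (List.getElem_mem _)
          rw [e] at h4
          exact hI _ h3 h4
      rw [h2 i hi h]
      apply t3
      · rw [← h2 i hi h, Ne, σ.injective.eq_iff]
        intro e
        have := cast_zero (n := n) (i - m) (by rw [abs_lt]; omega)
          (by push_cast; linear_combination e)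
        omega
      · exact hp.1
      · rw [← h2 i hi h, Ne, ← h1, σ.injective.eq_iff]
        intro e
        have := cast_zero (n := n) (i - m - n) (by rw [abs_lt]; omega)
          (by push_cast; linear_combination e)
        omega
      · exact hp.2
    · subst h
      exact t2

lemma window {n r s : ℕ} {l : List (ZMod (2 * n))} {σ : Equiv.Perm (ZMod (2 * n))}
    (h : ∀ i (h : i < l.length), σ (i : ℕ) = l[i]) (hs : s + r ≤ l.length) :
    (Iv n r (s : ℕ)).image σ = ((l.drop s).take r).toFinset := by
  ext v
  simp only [mem_image, mem_Iv, List.mem_toFinset, List.mem_iff_getElem, List.length_take,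
    List.length_drop, List.getElem_take, List.getElem_drop]
  constructor
  · rintro ⟨_, ⟨i, hi, rfl⟩, rfl⟩
    refine ⟨i, by omega, ?_⟩
    rw [← h]; push_cast; rfl
  · rintro ⟨i, hi, rfl⟩
    refine ⟨_, ⟨i, by omega, rfl⟩, ?_⟩
    rw [← h]; push_cast; rfl

lemma trans {n r : ℕ} (hn : 0 < n) {A : Finset (ZMod (2 * n))} (hA : Ind A)
    (hc : A.card = r) : ∃ σ : Equiv.Perm (ZMod (2 * n)), IsG σ ∧ (Iv n r 0).image σ = A := by
  obtain ⟨σ, h1, h2, h3⟩ := ext_list hn A.toList A.nodup_toList (by simpa using hA)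
  refine ⟨σ, h1, ?_⟩
  have := window (s := 0) (r := r) h3 (by simp [hc])
  rw [Nat.cast_zero] at this
  rw [this, List.drop_zero, List.take_of_length_le (by simp [hc])]
  simp

/-- moving the window -/
lemma shift {n r : ℕ} (h0 : 0 < r) (hr : r < n) (s : ZMod (2 * n)) (σ : Equiv.Perm (ZMod (2 * n))) :
    (Iv n r (s + 1)).image σ = insert (σ (s + r)) (((Iv n r s).image σ).erase (σ s)) := by
  have : Iv n r (s + 1) = insert (s + (r : ZMod (2 * n))) ((Iv n r s).erase s) := by
    ext v
    simp only [mem_insert, mem_erase, mem_Iv]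
    constructor
    · rintro ⟨i, hi, rfl⟩
      by_cases h : i + 1 = r
      · left; rw [← h]; push_cast; ring
      · right
        refine ⟨fun e => ?_, i + 1, by omega, by push_cast; ring⟩
        have := cast_zero (n := n) (i + 1) (by rw [abs_lt]; omega)
          (by push_cast; linear_combination e)
        omega
    · rintro (rfl | ⟨h, i, hi, rfl⟩)
      · refine ⟨r - 1, by omega, ?_⟩
        push_cast [Nat.cast_sub (show 1 ≤ r by omega)]; ring
      · have : i ≠ 0 := by rintro rfl; simp at h
        refine ⟨i - 1, by omega, ?_⟩
        push_cast [Nat.cast_sub (show 1 ≤ i by omega)]; ring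
  rw [this, image_insert, image_erase σ.injective]

lemma anti {n r : ℕ} (s : ZMod (2 * n)) {σ : Equiv.Perm (ZMod (2 * n))} (h : IsG σ) :
    (Iv n r (s + n)).image σ = ((Iv n r s).image σ).image (fun v => v + (n : ZMod (2 * n))) := by
  ext v
  simp only [mem_image, mem_Iv]
  constructor
  · rintro ⟨_, ⟨i, hi, rfl⟩, rfl⟩
    exact ⟨_, ⟨_, ⟨i, hi, rfl⟩, rfl⟩, by rw [← h]; congr 1; ring⟩
  · rintro ⟨_, ⟨_, ⟨i, hi, rfl⟩, rfl⟩, rfl⟩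
    exact ⟨_, ⟨i, hi, rfl⟩, by rw [← h]; congr 1; ring⟩

end BL

namespace BL

open Finset

/-- circle lemma -/
lemma circle_aux {n r : ℕ} (S : Finset (ZMod (2 * n)))
    (hS : ∀ s ∈ S, ∀ t ∈ S, ¬ Disjoint (Iv n r s) (Iv n r t)) (s t : ZMod (2 * n))
    (hs : s ∈ S) (ht : t ∈ S) : ∃ d : ℤ, |d| < r ∧ t = s + (d : ZMod (2 * n)) := by
  obtain ⟨v, h1, h2⟩ := Finset.not_disjoint_iff.1 (hS s hs t ht)
  obtain ⟨i, hi, e1⟩ := mem_Iv.1 h1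
  obtain ⟨j, hj, e2⟩ := mem_Iv.1 h2
  refine ⟨i - j, by rw [abs_lt]; omega, ?_⟩
  push_cast; linear_combination e2 - e1

lemma circle_no {n r : ℕ} (hr : r < n) (S : Finset (ZMod (2 * n)))
    (hS : ∀ s ∈ S, ∀ t ∈ S, ¬ Disjoint (Iv n r s) (Iv n r t)) (s : ZMod (2 * n)) (k : ℤ)
    (hk : (r : ℤ) ≤ k) (hk' : k ≤ r + 1) (hs : s ∈ S) (ht : s + (k : ZMod (2 * n)) ∈ S) :
    False := by
  obtain ⟨d, hd, e⟩ := circle_aux S hS _ _ hs ht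
  rw [abs_lt] at hd
  have := cast_zero (n := n) (k - d) (by rw [abs_lt]; omega)
      (by push_cast; linear_combination e)
  omega

lemma circle_sub {n r : ℕ} (hr : r < n) (S : Finset (ZMod (2 * n)))
    (hS : ∀ s ∈ S, ∀ t ∈ S, ¬ Disjoint (Iv n r s) (Iv n r t)) (s : ZMod (2 * n)) (hs : s ∈ S) :
    S.card ≤ ((Icc 1 (r - 1)).filter (fun j : ℕ => s + (j : ZMod (2 * n)) ∈ S ∨
      s + (j : ZMod (2 * n)) - r ∈ S)).card + 1 := by
  classical
  refine le_trans (card_le_card (t := insert s (image (fun j : ℕ =>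
    if s + (j : ZMod (2 * n)) ∈ S then s + (j : ZMod (2 * n)) else s + (j : ZMod (2 * n)) - r)
    ((Icc 1 (r - 1)).filter (fun j : ℕ => s + (j : ZMod (2 * n)) ∈ S ∨
      s + (j : ZMod (2 * n)) - r ∈ S)))) ?_)
    ((card_insert_le _ _).trans (Nat.succ_le_succ card_image_le))
  intro t ht
  obtain ⟨d, hd, e⟩ := circle_aux S hS _ _ hs ht
  rw [abs_lt] at hd
  rw [mem_insert, mem_image]
  rcases lt_trichotomy d 0 with h | h | h
  · right
    have e' : s + ((d + r).toNat : ZMod (2 * n)) - r = t := by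
      have : (((d + r).toNat : ℤ) : ZMod (2 * n)) = ((d + r : ℤ) : ZMod (2 * n)) := by
        rw [Int.toNat_of_nonneg (by omega)]
      push_cast at this
      rw [this, e]; ring
    refine ⟨(d + r).toNat, ?_, ?_⟩
    · rw [mem_filter, mem_Icc]
      exact ⟨by omega, Or.inr (e' ▸ ht)⟩
    · rw [if_neg, e']
      intro h'
      refine circle_no hr S hS t r le_rfl (by omega) ht ?_
      rw [← e']; push_cast
      convert h' using 1; ring
  · left; rw [e, h]; simp
  · right
    have e' : s + (d.toNat : ZMod (2 * n)) = t := by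
      have : ((d.toNat : ℤ) : ZMod (2 * n)) = ((d : ℤ) : ZMod (2 * n)) := by
        rw [Int.toNat_of_nonneg (by omega)]
      push_cast at this
      rw [this, e]
    refine ⟨d.toNat, ?_, ?_⟩
    · rw [mem_filter, mem_Icc]
      exact ⟨by omega, Or.inl (e' ▸ ht)⟩
    · rw [if_pos (e' ▸ ht), e']

lemma circle_le {n r : ℕ} (h0 : 0 < r) (hr : r < n) (S : Finset (ZMod (2 * n)))
    (hS : ∀ s ∈ S, ∀ t ∈ S, ¬ Disjoint (Iv n r s) (Iv n r t)) : S.card ≤ r := by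
  rcases S.eq_empty_or_nonempty with rfl | ⟨s, hs⟩
  · simp
  have := circle_sub hr S hS s hs
  have h2 := card_filter_le (Icc 1 (r - 1)) (fun j : ℕ => s + (j : ZMod (2 * n)) ∈ S ∨
      s + (j : ZMod (2 * n)) - r ∈ S)
  rw [Nat.card_Icc] at h2
  omega

lemma circle_eq {n r : ℕ} (hr : r < n) (S : Finset (ZMod (2 * n)))
    (hS : ∀ s ∈ S, ∀ t ∈ S, ¬ Disjoint (Iv n r s) (Iv n r t)) (hc : S.card = r)
    (s : ZMod (2 * n)) (hs : s ∈ S) (hs1 : s + 1 ∉ S) (j : ℕ) (hj : 1 ≤ j) (hj' : j < r) :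
    s + (j : ZMod (2 * n)) - r ∈ S := by
  have := circle_sub hr S hS s hs
  have h2 : (Icc 1 (r - 1)).filter (fun j : ℕ => s + (j : ZMod (2 * n)) ∈ S ∨
      s + (j : ZMod (2 * n)) - r ∈ S) = Icc 1 (r - 1) := by
    apply eq_of_subset_of_card_le (filter_subset _ _)
    rw [Nat.card_Icc]
    omega
  rw [filter_eq_self] at h2
  have h3 : ∀ j : ℕ, 1 ≤ j → j < r → s + (j : ZMod (2 * n)) ∉ S := by
    intro j hj
    induction j, hj using Nat.le_induction with
    | base => intro _; simpa using hs1
    | succ j hj ih =>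
      intro h h'
      rcases h2 j (by rw [mem_Icc]; omega) with h4 | h4
      · exact ih (by omega) h4
      · refine circle_no hr S hS _ (r + 1) (by omega) le_rfl h4 ?_
        convert h' using 1; push_cast; ring
  exact (h2 j (by rw [mem_Icc]; omega)).resolve_left (h3 j hj hj')

open Classical in
/-- number of independent sets -/
lemma card_Ind {n : ℕ} (hn : 0 < n) [Fintype (ZMod (2 * n))] (r : ℕ) :
    (univ.filter (fun A : Finset (ZMod (2 * n)) => A.card = r ∧ Ind A)).card
      ≤ 2 ^ r * n.choose r := by
  have hsig : ((powersetCard r (range n)).sigma (fun T => T.powerset)).card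
      = 2 ^ r * n.choose r := by
    rw [card_sigma, sum_congr rfl (g := fun _ => 2 ^ r)]
    · simp [mul_comm]
    · intro T hT
      rw [card_powerset, (mem_powersetCard.1 hT).2]
  rw [← hsig]
  have hne : NeZero (2 * n) := ⟨by omega⟩
  -- the pair index of a vertex
  have key : ∀ a b : ZMod (2 * n), a.val % n = b.val % n → a = b ∨ a = b + n := by
    intro a b h
    have ha := ZMod.val_lt a
    have hb := ZMod.val_lt b
    rw [← ZMod.natCast_zmod_val a, ← ZMod.natCast_zmod_val b]
    have h1 : a.val = b.val ∨ a.val = b.val + n ∨ a.val + n = b.val := by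
      have e1 : a.val % n = if a.val < n then a.val else a.val - n := by
        split_ifs with h
        · exact Nat.mod_eq_of_lt h
        · rw [Nat.mod_eq_sub_mod (by omega), Nat.mod_eq_of_lt (by omega)]
      have e2 : b.val % n = if b.val < n then b.val else b.val - n := by
        split_ifs with h
        · exact Nat.mod_eq_of_lt h
        · rw [Nat.mod_eq_sub_mod (by omega), Nat.mod_eq_of_lt (by omega)]
      rw [e1, e2] at h
      split_ifs at h <;> omega
    rcases h1 with h1 | h1 | h1
    · left; rw [h1]
    · right; rw [h1]; push_cast; rfl
    · right; rw [← h1]; push_cast; rw [add_nn]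
  apply card_le_card_of_injOn (fun A => (⟨A.image (fun a => a.val % n),
    (A.filter (fun a => a.val < n)).image (fun a => a.val % n)⟩ : (_ : Finset ℕ) × Finset ℕ))
  · intro A hA
    simp only [coe_filter, mem_univ, true_and, Set.mem_ofPred_eq] at hA
    simp only [coe_sigma, Set.mem_sigma_iff, mem_coe, mem_powersetCard, mem_powerset]
    refine ⟨⟨?_, ?_⟩, image_subset_image (filter_subset _ _)⟩
    · intro i hi
      obtain ⟨a, _, rfl⟩ := mem_image.1 hi
      exact mem_range.2 (Nat.mod_lt _ hn)
    · rw [card_image_of_injOn, hA.1]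
      intro a ha b hb h
      rcases key a b h with h | h
      · exact h
      · exact absurd (h ▸ ha) (hA.2 b hb)
  · have main : ∀ A B : Finset (ZMod (2 * n)), Ind A → Ind B →
        A.image (fun a => a.val % n) = B.image (fun a => a.val % n) →
        (A.filter (fun a => a.val < n)).image (fun a => a.val % n) =
        (B.filter (fun a => a.val < n)).image (fun a => a.val % n) → A ⊆ B := by
      intro A B hA hB h1 h2 a ha
      have h3 : a.val % n ∈ B.image (fun a => a.val % n) := by
        rw [← h1]; exact mem_image_of_mem _ ha
      obtain ⟨b, hb, e⟩ := mem_image.1 h3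
      rcases key _ _ e with e | e
      · exact e ▸ hb
      exfalso
      have hlt : a.val < n ↔ ¬ b.val < n := by
        have ha := ZMod.val_lt a
        have hv : b.val = (a.val + n) % (2 * n) := by
          rw [e, ZMod.val_add, ZMod.val_natCast, Nat.add_mod_mod]
        rw [hv]
        by_cases h : a.val < n
        · rw [Nat.mod_eq_of_lt (by omega)]; omega
        · rw [Nat.mod_eq_sub_mod (by omega), Nat.mod_eq_of_lt (by omega)]; omega
      by_cases hlt' : a.val < n
      · have h4 : a.val % n ∈ (B.filter (fun a => a.val < n)).image (fun a => a.val % n) := by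
          rw [← h2]; exact mem_image_of_mem _ (mem_filter.2 ⟨ha, hlt'⟩)
        obtain ⟨c, hc, e'⟩ := mem_image.1 h4
        rw [mem_filter] at hc
        rcases key _ _ e' with e' | e'
        · exact hB a (e' ▸ hc.1) (e ▸ hb)
        · exact hlt.1 hlt' (by rw [e, ← e']; exact hc.2)
      · have hb' : b.val < n := by tauto
        have h4 : b.val % n ∈ (A.filter (fun a => a.val < n)).image (fun a => a.val % n) := by
          rw [h2]; exact mem_image_of_mem _ (mem_filter.2 ⟨hb, hb'⟩)
        obtain ⟨c, hc, e'⟩ := mem_image.1 h4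
        rw [mem_filter] at hc
        rcases key _ _ e' with e' | e'
        · exact hA a ha (by rw [← e, ← e']; exact hc.1)
        · apply hlt'; rw [e, add_nn] at e'; rw [← e']; exact hc.2
    intro A hA B hB h
    simp only [coe_filter, mem_univ, true_and, Set.mem_ofPred_eq] at hA hB
    simp only [Sigma.mk.injEq, heq_eq_eq] at h
    exact (main A B hA.2 hB.2 h.1 h.2).antisymm (main B A hB.2 hA.2 h.1.symm h.2.symm)

open Classical in
lemma full {n r : ℕ} (h0 : 0 < r) (hr : r < n) [Fintype (ZMod (2 * n))]
    (F : Finset (Finset (ZMod (2 * n))))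
    (hF : ∀ A ∈ F, A.card = r ∧ Ind A) (hint : ∀ A ∈ F, ∀ B ∈ F, ¬ Disjoint A B)
    (hcard : F.card = 2 ^ (r - 1) * (n - 1).choose (r - 1))
    (σ : Equiv.Perm (ZMod (2 * n))) (hσ : IsG σ) :
    (univ.filter (fun s => (Iv n r s).image σ ∈ F)).card = r := by
  have hn : 0 < n := by omega
  have hne : NeZero (2 * n) := ⟨by omega⟩
  set G : Finset (Equiv.Perm (ZMod (2 * n))) := univ.filter (fun σ => IsG σ) with hG
  have hle : ∀ σ ∈ G, (univ.filter (fun s => (Iv n r s).image σ ∈ F)).card ≤ r := by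
    intro σ _
    apply circle_le h0 hr
    intro s hs t ht hd
    simp only [mem_filter, mem_univ, true_and] at hs ht
    exact hint _ hs _ ht ((disjoint_image σ.injective).2 hd)
  set N := (G.filter (fun σ : Equiv.Perm (ZMod (2 * n)) => (Iv n r 0).image σ = Iv n r 0)).card with hN
  have hconst : ∀ A, A.card = r → Ind A →
      (G.filter (fun σ : Equiv.Perm (ZMod (2 * n)) => (Iv n r 0).image σ = A)).card = N := by
    intro A hA hI
    obtain ⟨τ, t1, t2⟩ := trans hn hI hA
    symm
    apply card_bij (fun σ _ => τ * σ)
    · intro σ hσ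
      simp only [hG, mem_filter, mem_univ, true_and] at hσ ⊢
      refine ⟨t1.mul hσ.1, ?_⟩
      rw [Equiv.Perm.coe_mul, ← image_image, hσ.2, t2]
    · intro σ _ σ' _ h
      exact mul_left_cancel h
    · intro σ hσ
      simp only [hG, mem_filter, mem_univ, true_and] at hσ
      refine ⟨τ⁻¹ * σ, ?_, by simp⟩
      simp only [hG, mem_filter, mem_univ, true_and]
      refine ⟨t1.inv.mul hσ.1, ?_⟩
      rw [Equiv.Perm.coe_mul, ← image_image, hσ.2, ← t2, image_image, ← Equiv.Perm.coe_mul]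
      simp
  have hGcard : G.card ≤ 2 ^ r * n.choose r * N := by
    rw [card_eq_sum_card_fiberwise (f := fun σ : Equiv.Perm (ZMod (2 * n)) => (Iv n r 0).image σ)
      (t := univ.filter (fun A : Finset (ZMod (2 * n)) => A.card = r ∧ Ind A))]
    · rw [sum_congr rfl (g := fun _ => N), sum_const, smul_eq_mul]
      · exact Nat.mul_le_mul_right _ (card_Ind hn r)
      · intro A hA
        simp only [mem_filter, mem_univ, true_and] at hA
        exact hconst A hA.1 hA.2
    · intro σ hσ
      simp only [hG, coe_filter, mem_univ, true_and, Set.mem_ofPred_eq] at hσ ⊢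
      exact ⟨by rw [card_image_of_injective _ σ.injective, card_Iv hr.le], (Ind_Iv hr 0).image hσ⟩
  have hcol : ∀ s, (G.filter (fun σ : Equiv.Perm (ZMod (2 * n)) => (Iv n r s).image σ ∈ F)).card = F.card * N := by
    intro s
    have hIv : Iv n r s = (Iv n r 0).image (Equiv.addLeft s : Equiv.Perm (ZMod (2 * n))) := by
      ext v
      simp only [mem_image, mem_Iv, Equiv.coe_addLeft]
      constructor
      · rintro ⟨i, hi, rfl⟩
        exact ⟨_, ⟨i, hi, rfl⟩, by ring⟩
      · rintro ⟨_, ⟨i, hi, rfl⟩, rfl⟩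
        exact ⟨i, hi, by ring⟩
    have e1 : (G.filter (fun σ : Equiv.Perm (ZMod (2 * n)) => (Iv n r s).image σ ∈ F)).card =
        (G.filter (fun σ : Equiv.Perm (ZMod (2 * n)) => (Iv n r 0).image σ ∈ F)).card := by
      apply card_bij (fun σ _ => σ * (Equiv.addLeft s : Equiv.Perm (ZMod (2 * n))))
      · intro σ hσ
        simp only [hG, mem_filter, mem_univ, true_and] at hσ ⊢
        refine ⟨hσ.1.mul (isG_add s), ?_⟩
        rw [Equiv.Perm.coe_mul, ← image_image, ← hIv]
        exact hσ.2
      · intro σ _ σ' _ h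
        exact mul_right_cancel h
      · intro σ hσ
        simp only [hG, mem_filter, mem_univ, true_and] at hσ
        refine ⟨σ * (Equiv.addLeft s : Equiv.Perm (ZMod (2 * n)))⁻¹, ?_, inv_mul_cancel_right _ _⟩
        simp only [hG, mem_filter, mem_univ, true_and]
        refine ⟨hσ.1.mul (isG_add s).inv, ?_⟩
        rw [hIv, image_image, ← Equiv.Perm.coe_mul, inv_mul_cancel_right]
        exact hσ.2
    rw [e1, card_eq_sum_card_fiberwise (f := fun σ : Equiv.Perm (ZMod (2 * n)) => (Iv n r 0).image σ) (t := F)]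
    · rw [sum_congr rfl (g := fun _ => N), sum_const, smul_eq_mul]
      intro A hA
      rw [← hconst A (hF A hA).1 (hF A hA).2, filter_filter]
      congr 1
      apply filter_congr
      intro σ _
      constructor
      · exact fun h => h.2
      · exact fun h => ⟨h ▸ hA, h⟩
    · intro σ hσ
      exact (mem_filter.1 hσ).2
  have htot : ∑ σ ∈ G, (univ.filter (fun s => (Iv n r s).image σ ∈ F)).card
      = 2 * n * (F.card * N) := by
    have : ∑ σ ∈ G, (univ.filter (fun s => (Iv n r s).image σ ∈ F)).card
      = ∑ s, (G.filter (fun σ : Equiv.Perm (ZMod (2 * n)) => (Iv n r s).image σ ∈ F)).card := by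
      simp only [card_filter]
      rw [sum_comm]
    rw [this, sum_congr rfl (fun s _ => hcol s), sum_const, smul_eq_mul, card_univ, ZMod.card]
  have hch : n * (n - 1).choose (r - 1) = n.choose r * r := by
    have := Nat.add_one_mul_choose_eq (n - 1) (r - 1)
    rwa [Nat.sub_add_cancel hn, Nat.sub_add_cancel h0] at this
  have htot2 : ∑ σ ∈ G, (univ.filter (fun s => (Iv n r s).image σ ∈ F)).card = ∑ σ ∈ G, r := by
    apply le_antisymm (sum_le_sum hle)
    rw [sum_const, smul_eq_mul, htot, hcard]
    calc G.card * r ≤ 2 ^ r * n.choose r * N * r := Nat.mul_le_mul_right _ hGcard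
      _ = 2 ^ r * N * (n.choose r * r) := by ring
      _ = 2 ^ r * N * (n * (n - 1).choose (r - 1)) := by rw [hch]
      _ = 2 ^ (r - 1 + 1) * N * (n * (n - 1).choose (r - 1)) := by rw [Nat.sub_add_cancel h0]
      _ = 2 * n * (2 ^ (r - 1) * (n - 1).choose (r - 1) * N) := by rw [pow_succ]; ring
      _ ≤ _ := le_rfl
  exact (sum_eq_sum_iff_of_le hle).1 htot2 σ (by simp [hG, hσ])

end BL

namespace BL

open Finset

/-- `v` is not in a pair met by `C`. -/
def Fr {n : ℕ} (v : ZMod (2 * n)) (C : Finset (ZMod (2 * n))) : Prop := v ∉ C ∧ v + n ∉ C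

lemma Fr_insert {n : ℕ} {v a : ZMod (2 * n)} {C : Finset (ZMod (2 * n))} :
    Fr v (insert a C) ↔ (v ≠ a ∧ v ≠ a + n) ∧ Fr v C := by
  have : v + n = a ↔ v = a + n := by
    constructor
    · rintro rfl; rw [add_nn]
    · rintro rfl; rw [add_nn]
  simp only [Fr, mem_insert, not_or, this]; tauto

lemma Ind_insert {n : ℕ} (hn : 0 < n) {v : ZMod (2 * n)} {C : Finset (ZMod (2 * n))}
    (hC : Ind C) (hv : Fr v C) : Ind (insert v C) := by
  intro a ha hb
  rw [mem_insert] at ha hb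
  rcases ha with rfl | ha <;> rcases hb with hb | hb
  · exact add_n_ne hn _ hb
  · exact hv.2 hb
  · apply hv.2; rw [← hb, add_nn]; exact ha
  · exact hC a ha hb

lemma Ind.mono {n : ℕ} {A B : Finset (ZMod (2 * n))} (h : Ind A) (hs : B ⊆ A) : Ind B :=
  fun a ha hb => h a (hs ha) (hs hb)

lemma Fr.mono {n : ℕ} {A B : Finset (ZMod (2 * n))} {v} (h : Fr v A) (hs : B ⊆ A) : Fr v B :=
  ⟨fun hb => h.1 (hs hb), fun hb => h.2 (hs hb)⟩

lemma Fr.anti {n : ℕ} {A : Finset (ZMod (2 * n))} {v : ZMod (2 * n)} (h : Fr v A) :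
    Fr (v + (n : ZMod (2 * n))) A := ⟨h.2, by rw [add_nn]; exact h.1⟩

lemma Fr_of_Ind {n : ℕ} {A : Finset (ZMod (2 * n))} {v : ZMod (2 * n)}
    (h : Ind (insert v A)) (hv : v ∉ A) : Fr v A :=
  ⟨hv, fun hb => h v (mem_insert_self _ _) (mem_insert_of_mem hb)⟩

lemma exists_free {n : ℕ} {A : Finset (ZMod (2 * n))} (hc : A.card < n) : ∃ w, Fr w A := by
  have : NeZero (2 * n) := ⟨by omega⟩
  by_contra! h
  have h1 : (univ : Finset (ZMod (2 * n))) ⊆ A ∪ A.image (fun v => v + (n : ZMod (2 * n))) := by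
    intro v _
    rw [mem_union]
    by_contra hv
    push Not at hv
    refine h v ⟨hv.1, fun h2 => hv.2 ?_⟩
    exact mem_image.2 ⟨_, h2, add_nn v⟩
  have h2 := card_le_card h1
  rw [card_univ, ZMod.card] at h2
  have h3 := card_union_le A (A.image (fun v => v + (n : ZMod (2 * n))))
  have h4 := card_image_le (s := A) (f := (fun v => v + (n : ZMod (2 * n))))
  omega

/-- working hypotheses on the family -/
structure Ctx (n r : ℕ) (F : Finset (Finset (ZMod (2 * n)))) : Prop where
  h0 : 0 < r
  hr : r < n
  card : ∀ A ∈ F, A.card = r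
  ind : ∀ A ∈ F, Ind A
  int : ∀ A ∈ F, ∀ B ∈ F, Disjoint A B → False
  ex : ∀ σ : Equiv.Perm (ZMod (2 * n)), IsG σ → ∃ s, (Iv n r s).image σ ∈ F ∧
    (Iv n r (s + 1)).image σ ∉ F
  run : ∀ σ : Equiv.Perm (ZMod (2 * n)), IsG σ → ∀ s, (Iv n r s).image σ ∈ F →
    (Iv n r (s + 1)).image σ ∉ F → ∀ i : ℕ, i < r → (Iv n r (s - i)).image σ ∈ F

variable {n r : ℕ} {F : Finset (Finset (ZMod (2 * n)))}

lemma not_last (hr : r < n) (σ : Equiv.Perm (ZMod (2 * n))) (k : ℕ) (hk : 0 < k)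
    (hk' : k + r < 2 * n + 1) : σ k ∉ (Iv n r (0 - ((r - 1 : ℕ) : ZMod (2 * n)))).image σ := by
  intro h
  obtain ⟨v, hv, e⟩ := mem_image.1 h
  rw [σ.injective.eq_iff] at e
  subst e
  obtain ⟨i, hi, e⟩ := mem_Iv.1 hv
  have := cast_zero (n := n) (i - (r - 1 : ℕ) - k) (by rw [abs_lt]; omega)
      (by push_cast; linear_combination e)
  omega

lemma KL (H : Ctx n r F) (x : ZMod (2 * n)) (b : List (ZMod (2 * n)))
    (hnd : (x :: b).Nodup) (hI : Ind (x :: b).toFinset) (hlen : r ≤ b.length + 1)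
    (hmem : ((x :: b).take r).toFinset ∈ F)
    (hnot : ∀ σ : Equiv.Perm (ZMod (2 * n)), IsG σ →
      (∀ i (h : i < (x :: b).length), σ (i : ℕ) = (x :: b)[i]) →
      (Iv n r (0 + 1)).image σ ∉ F) :
    ∃ D ∈ F, (∀ v ∈ b, v ∉ D) ∧ x + n ∉ D ∧ ∀ c b', b = c :: b' → c + n ∉ D := by
  have hr := H.hr
  have h0 := H.h0
  obtain ⟨σ, hσ, hl, h⟩ := ext_list (by omega) (x :: b) hnd hI
  have hw := window (s := 0) (r := r) h (by simpa using hlen)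
  rw [List.drop_zero, Nat.cast_zero] at hw
  have hD := H.run σ hσ 0 (hw ▸ hmem) (hnot σ hσ h) (r - 1) (by omega)
  rw [List.length_cons] at hl
  refine ⟨_, hD, ?_, ?_, ?_⟩
  · intro v hv
    obtain ⟨i, hi, rfl⟩ := List.mem_iff_getElem.1 hv
    have := h (i + 1) (by simp; omega)
    rw [List.getElem_cons_succ] at this
    rw [← this]
    exact not_last hr σ (i + 1) (by omega) (by omega)
  · have := h 0 (by simp)
    rw [List.getElem_cons_zero] at this
    rw [← this, ← hσ]
    have h2 := not_last hr σ n (by omega) (by omega)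
    simpa using h2
  · rintro c b' rfl
    have := h 1 (by simp)
    simp only [List.getElem_cons_succ, List.getElem_cons_zero] at this
    rw [← this, ← hσ]
    have h2 := not_last hr σ (1 + n) (by omega) (by omega)
    simpa using h2

lemma toList_cons_nodup {x : ZMod (2 * n)} {B : Finset (ZMod (2 * n))} {t : List (ZMod (2 * n))}
    (hx : x ∉ B) (ht : (x :: t).Nodup) (hB : ∀ v ∈ t, v ∉ B) : (x :: (B.toList ++ t)).Nodup := by
  rw [List.nodup_cons] at ht ⊢
  refine ⟨by simp [hx, ht.1], ?_⟩
  rw [List.nodup_append]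
  refine ⟨B.nodup_toList, ht.2, ?_⟩
  intro a ha b hb e
  subst e
  exact hB a hb (mem_toList.1 ha)

lemma KW (H : Ctx n r F) {x z : ZMod (2 * n)} {B : Finset (ZMod (2 * n))} (hx : x ∉ B)
    (hmem : insert x B ∈ F) (hz : Fr z (insert x B)) (hnot : insert z B ∉ F)
    (t : List (ZMod (2 * n))) (hnd : (x :: (B.toList ++ z :: t)).Nodup)
    (hI : Ind (x :: (B.toList ++ z :: t)).toFinset) :
    ∃ D ∈ F, (∀ v ∈ B, v ∉ D) ∧ (∀ v ∈ t, v ∉ D) ∧ x + n ∉ D := by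
  have hc := H.card _ hmem
  rw [card_insert_of_notMem hx] at hc
  obtain ⟨D, hD, h1, h2, -⟩ := KL H x (B.toList ++ z :: t) hnd hI
    (by simp; omega)
    (by
      rw [← hc, List.take_succ_cons, List.take_left' (by simp)]
      simpa using hmem)
    (by
      intro σ hσ h
      have hw := window (s := 1) (r := r) h (by simp; omega)
      rw [Nat.cast_one] at hw
      rw [zero_add, hw]
      have : List.take r (List.drop 1 (x :: (B.toList ++ z :: t))) = B.toList ++ [z] := by
        rw [List.drop_one, List.tail_cons, ← hc, ← List.singleton_append (x := z), ← List.append_assoc,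
          List.take_left' (by simp)]
      rw [this]
      convert hnot using 2
      ext v; simp)
  refine ⟨D, hD, fun v hv => h1 v ?_, fun v hv => h1 v ?_, h2⟩
  · simp [hv]
  · simp [hv]

lemma K0 (H : Ctx n r F) {x z : ZMod (2 * n)} {B : Finset (ZMod (2 * n))} (hx : x ∉ B)
    (hmem : insert x B ∈ F) (hz : Fr z (insert x B)) (hnot : insert z B ∉ F) :
    insert (x + n) B ∉ F := by
  intro hmem'
  have hr := H.hr
  have hz1 := (Fr_insert.1 hz)
  obtain ⟨D, hD, h1, -, h2⟩ := KW H hx hmem hz hnot []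
    (toList_cons_nodup hx (by simp [hz1.1.1.symm]) (by simpa using hz1.2.1))
    (by
      have := Ind_insert (by omega) (H.ind _ hmem) hz
      convert this using 1
      ext v; simp; tauto)
  refine H.int _ hmem' _ hD (Finset.disjoint_left.2 ?_)
  intro a ha
  rcases mem_insert.1 ha with rfl | ha
  · exact h2
  · exact h1 a ha

lemma K1 (H : Ctx n r F) {x y z : ZMod (2 * n)} {B : Finset (ZMod (2 * n))} (hx : x ∉ B)
    (hmem : insert x B ∈ F) (hz : Fr z (insert x B)) (hnot : insert z B ∉ F)
    (hy : Fr y (insert z (insert x B))) : insert y B ∉ F := by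
  intro hmem'
  have hr := H.hr
  have hz1 := (Fr_insert.1 hz)
  have hy1 := (Fr_insert.1 hy)
  have hy2 := (Fr_insert.1 hy1.2)
  obtain ⟨D, hD, h1, h2, -⟩ := KW H hx hmem hz hnot [y]
    (toList_cons_nodup hx (by simp [hz1.1.1.symm, hy2.1.1.symm, hy1.1.1.symm])
      (by simpa using ⟨hz1.2.1, hy2.2.1⟩))
    (by
      have := Ind_insert (by omega) (Ind_insert (by omega) (H.ind _ hmem) hz) hy
      convert this using 1
      ext v; simp; tauto)
  refine H.int _ hmem' _ hD (Finset.disjoint_left.2 ?_)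
  intro a ha
  rcases mem_insert.1 ha with rfl | ha
  · exact h2 _ (by simp)
  · exact h1 a ha

lemma special (H : Ctx n r F) (hn : n = r + 1) {x z : ZMod (2 * n)} {B : Finset (ZMod (2 * n))}
    (hx : x ∉ B) (hmem : insert x B ∈ F) (hz : Fr z (insert x B)) (hnot : insert z B ∉ F) :
    insert (z + n) B ∉ F := by
  intro hmem'
  have hr := H.hr
  have h0 := H.h0
  have hx' := K0 H hx hmem hz hnot
  have hz1 := (Fr_insert.1 hz)
  have hc := H.card _ hmem
  have hIx := H.ind _ hmem
  have hFx := Fr_of_Ind hIx hx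
  have hB : Ind B := hIx.mono (subset_insert _ _)
  rw [card_insert_of_notMem hx] at hc
  obtain ⟨σ, hσ, -, h⟩ := ext_list (by omega) (x :: z :: B.toList)
    (by
      have := B.nodup_toList
      simp only [List.nodup_cons, List.mem_cons, not_or, mem_toList]
      exact ⟨⟨hz1.1.1.symm, hx⟩, hz1.2.1, this⟩)
    (by
      have := Ind_insert (by omega) hIx hz
      convert this using 1
      ext v; simp; tauto)
  have w1 : (Iv n r (1 : ZMod (2 * n))).image σ = insert z B := by
    have hw := window (s := 1) (r := r) h (by simp; omega)
    rw [Nat.cast_one] at hw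
    rw [hw, List.drop_one, List.tail_cons, List.take_of_length_le (by simp; omega)]
    ext v; simp
  have hs0 : σ 0 = x := by simpa using h 0 (by simp)
  have hs1 : σ 1 = z := by simpa using h 1 (by simp)
  have w2 : (Iv n r (1 + 1 : ZMod (2 * n))).image σ = insert (x + n) B := by
    rw [shift h0 hr, w1, hs1, erase_insert hz1.2.1]
    have : (1 + (r : ZMod (2 * n))) = 0 + (n : ZMod (2 * n)) := by
      rw [zero_add]
      have : ((r + 1 : ℕ) : ZMod (2 * n)) = (n : ZMod (2 * n)) := by rw [hn]
      rw [← this]; push_cast; ring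
    rw [this, hσ, hs0]
  have b1 : (Iv n r (1 : ZMod (2 * n))).image σ ∉ F := by rw [w1]; exact hnot
  have b2 : (Iv n r (1 + 1 : ZMod (2 * n))).image σ ∉ F := by rw [w2]; exact hx'
  have inj : ∀ u v : ZMod (2 * n), u + n = v ↔ u = v + n := fun u v => by
    constructor
    · rintro rfl; rw [add_nn]
    · rintro rfl; rw [add_nn]
  have b3 : (Iv n r (1 + n : ZMod (2 * n))).image σ ∉ F := by
    rw [anti _ hσ, w1]
    intro h3
    refine H.int _ hmem _ h3 (Finset.disjoint_left.2 ?_)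
    intro a ha hb
    obtain ⟨b, hb, e⟩ := mem_image.1 hb
    have e : b + n = a := e
    rcases mem_insert.1 hb with rfl | hb
    · exact hz.2 (e ▸ ha)
    · rcases mem_insert.1 ha with rfl | ha
      · exact hIx a (mem_insert_self _ _) (by rw [← e, add_nn]; exact mem_insert_of_mem hb)
      · exact hB b hb (e ▸ ha)
  have b4 : (Iv n r (1 + 1 + n : ZMod (2 * n))).image σ ∉ F := by
    rw [anti _ hσ, w2]
    intro h3
    refine H.int _ hmem' _ h3 (Finset.disjoint_left.2 ?_)
    intro a ha hb
    obtain ⟨b, hb1, e⟩ := mem_image.1 hb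
    have e : b + n = a := e
    rcases mem_insert.1 hb1 with rfl | hb'
    · rw [add_nn] at e
      subst e
      rcases mem_insert.1 ha with ha | ha
      · exact hz1.1.2 (by rw [ha, add_nn])
      · exact hx ha
    · rcases mem_insert.1 ha with rfl | ha
      · rw [add_left_inj] at e
        exact hz1.2.1 (e ▸ hb')
      · exact hB b hb' (e ▸ ha)
  obtain ⟨p, p1, p2⟩ := H.ex σ hσ
  have hrun := H.run σ hσ p p1 p2
  have : NeZero (2 * n) := ⟨by omega⟩
  obtain ⟨k, hk, rfl⟩ : ∃ k : ℕ, k < 2 * n ∧ p = 1 + (k : ZMod (2 * n)) :=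
    ⟨(p - 1).val, ZMod.val_lt _, by rw [ZMod.natCast_zmod_val]; ring⟩
  have hrn : (r : ZMod (2 * n)) = n - 1 := by
    have : ((r + 1 : ℕ) : ZMod (2 * n)) = (n : ZMod (2 * n)) := by rw [hn]
    rw [← this]; push_cast; ring
  have hnn := nn (n := n)
  rcases lt_or_ge k r with h1 | h1
  · apply b1
    convert hrun k h1 using 3
    ring
  rcases h1.eq_or_lt with h1 | h1
  · apply b2
    convert hrun (r - 1) (by omega) using 3
    rw [← h1, Nat.cast_sub (by omega)]; push_cast; ring
  rcases lt_or_ge k (2 * n - 1) with h2 | h2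
  · apply b3
    convert hrun (k - n) (by omega) using 3
    rw [Nat.cast_sub (by omega)]; ring
  · have : k = 2 * n - 1 := by omega
    apply b4
    convert hrun (r - 1) (by omega) using 3
    rw [this, Nat.cast_sub (by omega), Nat.cast_sub (by omega), hrn]; push_cast
    ring

/-- `x` is the essential element of `insert x B` -/
def SE (F : Finset (Finset (ZMod (2 * n)))) (x : ZMod (2 * n)) (B : Finset (ZMod (2 * n))) : Prop :=
  x ∉ B ∧ insert x B ∈ F ∧ ∀ z, Fr z (insert x B) → insert z B ∉ F

lemma weak_strong (H : Ctx n r F) {x z : ZMod (2 * n)} {B : Finset (ZMod (2 * n))} (hx : x ∉ B)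
    (hmem : insert x B ∈ F) (hz : Fr z (insert x B)) (hnot : insert z B ∉ F) : SE F x B := by
  refine ⟨hx, hmem, fun y hy => ?_⟩
  have hr := H.hr
  by_cases h1 : y = z
  · rw [h1]; exact hnot
  by_cases h2 : y = z + n
  · subst h2
    by_cases h3 : n = r + 1
    · exact special H h3 hx hmem hz hnot
    obtain ⟨w, hw⟩ := exists_free (A := insert z (insert x B))
      (by rw [card_insert_of_notMem hz.1, H.card _ hmem]; omega)
    have hwn := K1 H hx hmem hz hnot hw
    have hw1 := Fr_insert.1 hw
    refine K1 H hx hmem hw1.2 hwn (Fr_insert.2 ⟨⟨?_, ?_⟩, hy⟩)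
    · exact fun h => hw1.1.2 h.symm
    · intro h; exact hw1.1.1 (add_right_cancel h).symm
  · exact K1 H hx hmem hz hnot (Fr_insert.2 ⟨⟨h1, h2⟩, hy⟩)

end BL

namespace BL

open Finset

variable {n r : ℕ} {F : Finset (Finset (ZMod (2 * n)))}

lemma free_shift (hr : r < n) {σ : Equiv.Perm (ZMod (2 * n))} (hσ : IsG σ) (h0 : 0 < r)
    (s : ZMod (2 * n)) : Fr (σ (s + r)) ((Iv n r s).image σ) := by
  constructor
  · intro h
    obtain ⟨v, hv, e⟩ := mem_image.1 h
    rw [σ.injective.eq_iff] at e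
    subst e
    obtain ⟨i, hi, e⟩ := mem_Iv.1 hv
    have := cast_zero (n := n) (i - r) (by rw [abs_lt]; omega)
      (by push_cast; linear_combination e)
    omega
  · intro h
    rw [← hσ] at h
    obtain ⟨v, hv, e⟩ := mem_image.1 h
    rw [σ.injective.eq_iff] at e
    subst e
    obtain ⟨i, hi, e⟩ := mem_Iv.1 hv
    have := cast_zero (n := n) (i - r - n) (by rw [abs_lt]; omega)
      (by push_cast; linear_combination e)
    omega

set_option maxHeartbeats 2000000 in
lemma SE_step (H : Ctx n r F) {x c d : ZMod (2 * n)} {B : Finset (ZMod (2 * n))} (hS : SE F x B)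
    (hc : c ∈ B) (hd : Fr d (insert x B)) : SE F x (insert d (B.erase c)) := by
  obtain ⟨hx, hmem, hnot⟩ := hS
  have hr := H.hr
  have h0 := H.h0
  have hd1 := Fr_insert.1 hd
  have hcard := H.card _ hmem
  have hIx := H.ind _ hmem
  rw [card_insert_of_notMem hx] at hcard
  obtain ⟨B0, hcB0, rfl⟩ : ∃ B0, c ∉ B0 ∧ insert c B0 = B :=
    ⟨B.erase c, notMem_erase _ _, insert_erase hc⟩
  rw [erase_insert hcB0]
  rw [card_insert_of_notMem hcB0] at hcard
  have hx2 : x ≠ c ∧ x ∉ B0 := by simpa [not_or] using hx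
  have hd2 := Fr_insert.1 hd1.2
  have hx' : x ∉ insert d B0 := by
    simp [hx2.2, hd1.1.1.symm]
  -- the new set is in the family
  have hnew : insert x (insert d B0) ∈ F := by
    obtain ⟨σ, hσ, -, h⟩ := ext_list (by omega) (d :: x :: (B0.toList ++ [c]))
      (by
        rw [List.nodup_cons]
        refine ⟨?_, toList_cons_nodup hx2.2 (by simp [hx2.1]) (by simpa using hcB0)⟩
        simp [hd1.1.1, hd2.1.1, hd2.2.1])
      (by
        have := Ind_insert (by omega) hIx hd
        convert this using 1
        ext v; simp)
    have w1 : (Iv n r (1 : ZMod (2 * n))).image σ = insert x (insert c B0) := by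
      have hw := window (s := 1) (r := r) h (by simp; omega)
      rw [Nat.cast_one] at hw
      rw [hw, List.drop_one, List.tail_cons, List.take_of_length_le (by simp; omega)]
      ext v; simp
    have w0 : (Iv n r (0 : ZMod (2 * n))).image σ = insert x (insert d B0) := by
      have hw := window (s := 0) (r := r) h (by simp; omega)
      rw [Nat.cast_zero] at hw
      have e : d :: x :: (B0.toList ++ [c]) = (d :: x :: B0.toList) ++ [c] := by simp
      rw [hw, List.drop_zero, e, List.take_left' (by simp; omega)]
      ext v; simp; tauto
    have hs1 : σ 1 = x := by simpa using h 1 (by simp)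
    have w2 : (Iv n r (1 + 1 : ZMod (2 * n))).image σ ∉ F := by
      rw [shift h0 hr, w1, hs1, erase_insert hx]
      apply hnot
      rw [← w1]
      exact free_shift hr hσ h0 1
    have := H.run σ hσ 1 (by rw [w1]; exact hmem) w2 1 (by omega)
    rw [Nat.cast_one, sub_self, w0] at this
    exact this
  refine ⟨hx', hnew, fun e he hE => ?_⟩
  have he1 := Fr_insert.1 he
  have he2 := Fr_insert.1 he1.2
  have main : ∀ t : List (ZMod (2 * n)), (x :: c :: (B0.toList ++ t)).Nodup →
      Ind (x :: c :: (B0.toList ++ t)).toFinset → d ∈ t → (e ∈ t ∨ e = c ∨ e = c + n) →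
      False := by
    intro t hnd hI hdt het
    obtain ⟨D, hD, h1, -, h3⟩ := KL H x (c :: (B0.toList ++ t)) hnd hI (by simp; omega)
      (by
        have e : x :: c :: (B0.toList ++ t) = (x :: c :: B0.toList) ++ t := by simp
        rw [e, List.take_left' (by simp; omega)]
        simpa using hmem)
      (by
        intro σ hσ h
        have hs0 : σ 0 = x := by simpa using h 0 (by simp)
        have w0 : (Iv n r (0 : ZMod (2 * n))).image σ = insert x (insert c B0) := by
          have hw := window (s := 0) (r := r) h (by simp; omega)
          rw [Nat.cast_zero] at hw
          have e : x :: c :: (B0.toList ++ t) = (x :: c :: B0.toList) ++ t := by simp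
          rw [hw, List.drop_zero, e, List.take_left' (by simp; omega)]
          simp
        rw [shift h0 hr, w0, hs0, erase_insert hx]
        apply hnot
        rw [← w0]
        exact free_shift hr hσ h0 0)
    refine H.int _ hE _ hD (Finset.disjoint_left.2 ?_)
    intro a ha
    rcases mem_insert.1 ha with rfl | ha
    · rcases het with h | h | h
      · exact h1 _ (by simp [h])
      · exact h1 _ (by simp [h])
      · rw [h]; exact h3 _ _ rfl
    rcases mem_insert.1 ha with rfl | ha
    · exact h1 _ (by simp [hdt])
    · exact h1 _ (by simp [ha])
  by_cases hec : e = c ∨ e = c + n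
  · refine main [d] ?_ ?_ (by simp) (Or.inr hec)
    · rw [List.nodup_cons]
      refine ⟨?_, toList_cons_nodup hcB0 (by simp [hd2.1.1.symm]) (by simpa using hd2.2.1)⟩
      simp [hx2, hd1.1.1.symm]
    · have := Ind_insert (by omega) hIx hd
      convert this using 1
      ext v; simp; tauto
  · push Not at hec
    refine main [d, e] ?_ ?_ (by simp) (Or.inl (by simp))
    · rw [List.nodup_cons]
      refine ⟨?_, toList_cons_nodup hcB0 (by simp [hd2.1.1.symm, hec.1.symm, he2.1.1.symm])
        (by simpa using ⟨hd2.2.1, he2.2.1⟩)⟩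
      simp [hx2, hd1.1.1.symm, he1.1.1.symm]
    · have h1 : Fr e (insert d (insert x (insert c B0))) := by
        simp only [Fr_insert]
        exact ⟨he2.1, he1.1, hec, he2.2⟩
      have := Ind_insert (by omega) (Ind_insert (by omega) hIx hd) h1
      convert this using 1
      ext v; simp; tauto

lemma SE_flip (H : Ctx n r F) {x c : ZMod (2 * n)} {B : Finset (ZMod (2 * n))} (hS : SE F x B)
    (hc : c ∈ B) : SE F x (insert (c + n) (B.erase c)) := by
  have hr := H.hr
  have hIx := H.ind _ hS.2.1
  obtain ⟨d, hd⟩ := exists_free (A := insert x B) (by rw [H.card _ hS.2.1]; exact hr)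
  have h1 := SE_step H hS hc hd
  have hd1 := Fr_insert.1 hd
  have hcn : Fr (c + (n : ZMod (2 * n))) (insert x (insert d (B.erase c))) := by
    have hcf : Fr c (insert x (B.erase c)) := by
      apply Fr_of_Ind
      · rw [insert_comm, insert_erase hc]; exact hIx
      · have : c ≠ x := fun h => hS.1 (h ▸ hc)
        simp [this]
    have hcf' := Fr_insert.1 hcf
    have : Fr c (insert x (insert d (B.erase c))) := by
      rw [Fr_insert, Fr_insert]
      refine ⟨hcf'.1, ⟨fun h => hd1.2.1 (h ▸ hc), fun h => hd1.2.2 (h ▸ hc)⟩, hcf'.2⟩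
    exact this.anti
  have h2 := SE_step H h1 (mem_insert_self d _) hcn
  rwa [erase_insert (fun h => hd1.2.1 (mem_of_mem_erase h))] at h2

lemma star_sub (H : Ctx n r F) {x : ZMod (2 * n)} (A : Finset (ZMod (2 * n))) (hA : Ind A)
    (hAc : A.card = r) (hxA : x ∈ A) (m : ℕ) : ∀ B, SE F x B → ((A.erase x) \ B).card = m →
    A ∈ F := by
  induction m using Nat.strong_induction_on with
  | _ m ih =>
  intro B hS hm
  have hBc : B.card + 1 = r := by rw [← H.card _ hS.2.1, card_insert_of_notMem hS.1]
  have hAc' : (A.erase x).card + 1 = r := by rw [card_erase_add_one hxA, hAc]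
  rcases (A.erase x \ B).eq_empty_or_nonempty with he | ⟨d, hd⟩
  · rw [sdiff_eq_empty_iff_subset] at he
    have : A.erase x = B := eq_of_subset_of_card_le he (by omega)
    rw [← insert_erase hxA, this]
    exact hS.2.1
  rw [mem_sdiff] at hd
  have key : ∀ c ∈ B, c ∉ A.erase x → SE F x (insert d (B.erase c)) → A ∈ F := by
    intro c hc hcA hS'
    refine ih _ ?_ _ hS' rfl
    rw [← hm]
    apply card_lt_card
    rw [ssubset_iff_of_subset]
    · exact ⟨d, mem_sdiff.2 hd, by simp⟩
    · intro v hv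
      rw [mem_sdiff] at hv ⊢
      refine ⟨hv.1, fun h => hv.2 ?_⟩
      rw [mem_insert, mem_erase]
      exact Or.inr ⟨fun e => hcA (e ▸ hv.1), h⟩
  have hdA := mem_of_mem_erase hd.1
  by_cases hdn : d + n ∈ B
  · refine key _ hdn (fun h => hA d hdA (mem_of_mem_erase h)) ?_
    have := SE_flip H hS hdn
    rwa [add_nn] at this
  · have hlt : (B \ A.erase x).Nonempty := by
      rw [nonempty_iff_ne_empty]
      intro h
      rw [sdiff_eq_empty_iff_subset] at h
      have := eq_of_subset_of_card_le h (by omega)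
      exact hd.2 (this ▸ hd.1)
    obtain ⟨c, hc⟩ := hlt
    rw [mem_sdiff] at hc
    refine key c hc.1 hc.2 (SE_step H hS hc.1 (Fr_insert.2 ⟨⟨ne_of_mem_erase hd.1, ?_⟩, hd.2, hdn⟩))
    intro h
    exact hA x hxA (h ▸ hdA)

lemma abstract_thm (H : Ctx n r F) : ∃ x, ∀ A, A ∈ F ↔ (A.card = r ∧ Ind A ∧ x ∈ A) := by
  have hr := H.hr
  have h0 := H.h0
  obtain ⟨p, p1, p2⟩ := H.ex 1 (fun v => by simp)
  have hp : (1 : Equiv.Perm (ZMod (2 * n))) p ∈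
      (Iv n r p).image (1 : Equiv.Perm (ZMod (2 * n))) :=
    mem_image_of_mem _ (mem_Iv.2 ⟨0, h0, by simp⟩)
  rw [shift h0 hr] at p2
  have hfr := free_shift hr (σ := (1 : Equiv.Perm (ZMod (2 * n)))) (fun v => by simp) h0 p
  generalize (Iv n r p).image (1 : Equiv.Perm (ZMod (2 * n))) = C at *
  generalize (1 : Equiv.Perm (ZMod (2 * n))) p = x at *
  have hS : SE F x (C.erase x) := by
    refine weak_strong H (notMem_erase _ _) ?_ ?_ p2
    · rw [insert_erase hp]; exact p1
    · rw [insert_erase hp]; exact hfr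
  have hsub : ∀ A, A.card = r ∧ Ind A ∧ x ∈ A → A ∈ F := fun A hA =>
    star_sub H A hA.2.1 hA.1 hA.2.2 _ _ hS rfl
  refine ⟨x, fun A => ⟨fun hA => ⟨H.card A hA, H.ind A hA, ?_⟩, hsub A⟩⟩
  by_contra hxA
  obtain ⟨σ, hσ, e⟩ := trans (by omega) (H.ind A hA) (H.card A hA)
  have : NeZero (2 * n) := ⟨by omega⟩
  obtain ⟨k, hk, hkx⟩ : ∃ k : ℕ, k < 2 * n ∧ σ (k : ZMod (2 * n)) = x :=
    ⟨(σ.symm x).val, ZMod.val_lt _, by rw [ZMod.natCast_zmod_val]; simp⟩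
  have hkr : r ≤ k := by
    by_contra! h
    apply hxA
    rw [← e, ← hkx]
    exact mem_image_of_mem _ (mem_Iv.2 ⟨k, h, by simp⟩)
  have main : ∀ s : ℕ, s ≤ k → k < s + r → r ≤ s → s + r ≤ 2 * n → False := by
    intro s h1 h2 h3 h4
    have hD : (Iv n r (s : ZMod (2 * n))).image σ ∈ F := by
      apply hsub
      refine ⟨by rw [card_image_of_injective _ σ.injective, card_Iv hr.le],
        (Ind_Iv hr _).image hσ, ?_⟩
      rw [← hkx]
      refine mem_image_of_mem _ (mem_Iv.2 ⟨k - s, by omega, ?_⟩)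
      rw [Nat.cast_sub h1]; ring
    refine H.int _ hA _ hD ?_
    rw [← e, disjoint_image σ.injective, Finset.disjoint_left]
    intro a ha hb
    obtain ⟨i, hi, rfl⟩ := mem_Iv.1 ha
    obtain ⟨j, hj, e⟩ := mem_Iv.1 hb
    have := cast_zero (n := n) (s + j - i) (by rw [abs_lt]; omega)
      (by push_cast; linear_combination e)
    omega
  by_cases h : k + r ≤ 2 * n
  · exact main k le_rfl (by omega) hkr h
  · exact main (2 * n - r) (by omega) (by omega) (by omega) (by omega)

lemma mkCtx (h0 : 0 < r) (hr : r < n)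
    (hF : ∀ A ∈ F, A.card = r ∧ Ind A) (hint : ∀ A ∈ F, ∀ B ∈ F, ¬ Disjoint A B)
    (hcard : F.card = 2 ^ (r - 1) * (n - 1).choose (r - 1)) : Ctx n r F := by
  classical
  have : NeZero (2 * n) := ⟨by omega⟩
  have hfull := full h0 hr F hF hint hcard
  have hS : ∀ σ : Equiv.Perm (ZMod (2 * n)), ∀ s ∈ univ.filter (fun s => (Iv n r s).image σ ∈ F),
      ∀ t ∈ univ.filter (fun s => (Iv n r s).image σ ∈ F),
      ¬ Disjoint (Iv n r s) (Iv n r t) := by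
    intro σ s hs t ht hd
    simp only [mem_filter, mem_univ, true_and] at hs ht
    exact hint _ hs _ ht ((disjoint_image σ.injective).2 hd)
  refine ⟨h0, hr, fun A hA => (hF A hA).1, fun A hA => (hF A hA).2, hint, ?_, ?_⟩
  · intro σ hσ
    by_contra! hcon
    have hc := hfull σ hσ
    obtain ⟨s, hs⟩ := card_pos.1 (by rw [hc]; exact h0)
    have hall : ∀ k : ℕ, (Iv n r (s + k)).image σ ∈ F := by
      intro k
      induction k with
      | zero => simpa using hs
      | succ k ih =>
        have := hcon _ ih
        convert this using 3
        push_cast; ring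
    have : univ.filter (fun s => (Iv n r s).image σ ∈ F) = univ := by
      rw [filter_eq_self]
      intro t _
      have := hall (t - s).val
      rwa [ZMod.natCast_zmod_val, add_sub_cancel] at this
    rw [this, card_univ, ZMod.card] at hc
    omega
  · intro σ hσ s hs hs1 i hi
    rcases Nat.eq_zero_or_pos i with rfl | hi0
    · simpa using hs
    have := circle_eq hr _ (hS σ) (hfull σ hσ) s (by simpa using hs) (by simpa using hs1)
      (r - i) (by omega) (by omega)
    rw [mem_filter] at this
    convert this.2 using 3
    rw [Nat.cast_sub hi.le]; ring

end BL

/-- **Bollobás–Leader theorem (uniqueness).** For `1 ≤ r < n`, an intersecting family of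
independent `r`-subsets of `Mₙ` of maximum size `2^(r−1)·C(n−1, r−1)` is a star. -/
theorem bollobas_leader_extremal (n r : ℕ) (hr : 1 ≤ r) (hrn : r < n)
    (𝓕 : Finset (Finset ℕ)) (h𝓕 : ↑𝓕 ⊆ famI n r)
    (hint : ∀ A ∈ 𝓕, ∀ B ∈ 𝓕, ∃ v, v ∈ A ∧ v ∈ B)
    (hcard : 𝓕.card = 2 ^ (r - 1) * (n - 1).choose (r - 1)) :
    ∃ x ∈ Finset.Icc 1 (2 * n), (↑𝓕 : Set (Finset ℕ)) = {A ∈ famI n r | x ∈ A} := by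
  classical
  have hne : NeZero (2 * n) := ⟨by omega⟩
  have cinj : ∀ a ∈ Finset.Icc 1 (2 * n), ∀ b ∈ Finset.Icc 1 (2 * n),
      (a : ZMod (2 * n)) = b → a = b := by
    intro a ha b hb h
    rw [Finset.mem_Icc] at ha hb
    have := BL.cast_zero (n := n) (a - b) (by rw [abs_lt]; omega)
      (by push_cast; linear_combination h)
    omega
  -- the image of an independent set
  set φ : Finset ℕ → Finset (ZMod (2 * n)) := fun A => A.image (fun a : ℕ => (a : ZMod (2 * n)))
    with hφ
  have hmem : ∀ A : Finset ℕ, A ⊆ Finset.Icc 1 (2 * n) → ∀ a ∈ Finset.Icc 1 (2 * n),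
      ((a : ZMod (2 * n)) ∈ φ A ↔ a ∈ A) := by
    intro A hA a ha
    constructor
    · intro h
      obtain ⟨b, hb, e⟩ := Finset.mem_image.1 h
      rw [← cinj b (hA hb) a ha e]; exact hb
    · intro h
      exact Finset.mem_image_of_mem _ h
  have hφinj : ∀ A : Finset ℕ, A ⊆ Finset.Icc 1 (2 * n) → ∀ B : Finset ℕ,
      B ⊆ Finset.Icc 1 (2 * n) → φ A = φ B → A = B := by
    intro A hA B hB h
    ext a
    constructor
    · intro ha
      rw [← hmem B hB a (hA ha), ← h, hmem A hA a (hA ha)]; exact ha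
    · intro ha
      rw [← hmem A hA a (hB ha), h, hmem B hB a (hB ha)]; exact ha
  have hφI : ∀ A ∈ famI n r, (φ A).card = r ∧ BL.Ind (φ A) := by
    rintro A ⟨hc, hs, hi⟩
    constructor
    · rw [hφ, Finset.card_image_of_injOn, hc]
      intro a ha b hb h
      exact cinj a (hs ha) b (hs hb) h
    · intro v hv hv'
      obtain ⟨a, ha, rfl⟩ := Finset.mem_image.1 hv
      obtain ⟨b, hb, e⟩ := Finset.mem_image.1 hv'
      have ha' := Finset.mem_Icc.1 (hs ha)
      have hb' := Finset.mem_Icc.1 (hs hb)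
      by_cases h : a ≤ n
      · have : b = a + n := by
          apply cinj _ (hs hb) _ (Finset.mem_Icc.2 (by omega))
          rw [e]; push_cast; rfl
        exact hi a (Finset.mem_Icc.2 (by omega)) ⟨ha, this ▸ hb⟩
      · have : a = b + n := by
          have h2 : b = a - n := by
            apply cinj _ (hs hb) _ (Finset.mem_Icc.2 (by omega))
            have h3 : (b : ZMod (2 * n)) = a + n := e
            have h4 := BL.nn (n := n)
            rw [h3, Nat.cast_sub (by omega)]
            linear_combination h4
          omega
        exact hi b (Finset.mem_Icc.2 (by omega)) ⟨hb, this ▸ ha⟩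
  have hsubs : ∀ A ∈ 𝓕, A ⊆ Finset.Icc 1 (2 * n) := fun A hA => (h𝓕 hA).2.1
  have H : BL.Ctx n r (𝓕.image φ) := by
    apply BL.mkCtx hr hrn
    · intro A hA
      obtain ⟨A, hA1, rfl⟩ := Finset.mem_image.1 hA
      exact hφI A (h𝓕 hA1)
    · intro A hA B hB
      obtain ⟨A, hA1, rfl⟩ := Finset.mem_image.1 hA
      obtain ⟨B, hB1, rfl⟩ := Finset.mem_image.1 hB
      obtain ⟨v, h1, h2⟩ := hint A hA1 B hB1
      exact Finset.not_disjoint_iff.2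
        ⟨v, Finset.mem_image_of_mem _ h1, Finset.mem_image_of_mem _ h2⟩
    · rw [Finset.card_image_of_injOn, hcard]
      intro A hA B hB h
      exact hφinj A (hsubs A hA) B (hsubs B hB) h
  obtain ⟨x, hx⟩ := BL.abstract_thm H
  obtain ⟨y, hy, rfl⟩ : ∃ y ∈ Finset.Icc 1 (2 * n), (y : ZMod (2 * n)) = x := by
    by_cases h : x.val = 0
    · refine ⟨2 * n, Finset.mem_Icc.2 (by omega), ?_⟩
      rw [ZMod.natCast_self, ← ZMod.natCast_zmod_val x, h, Nat.cast_zero]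
    · have := ZMod.val_lt x
      exact ⟨x.val, Finset.mem_Icc.2 (by omega), ZMod.natCast_zmod_val x⟩
  refine ⟨y, hy, ?_⟩
  ext A
  constructor
  · intro hA
    refine ⟨h𝓕 hA, ?_⟩
    have := ((hx (φ A)).1 (Finset.mem_image_of_mem _ hA)).2.2
    rwa [hmem A (hsubs A hA) y hy] at this
  · rintro ⟨hA, hyA⟩
    have h1 := hφI A hA
    have := (hx (φ A)).2 ⟨h1.1, h1.2, Finset.mem_image_of_mem _ hyA⟩
    obtain ⟨B, hB, e⟩ := Finset.mem_image.1 this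
    rw [← hφinj B (hsubs B hB) A hA.2.1 e]
    exact hB
end

section
/- Let k ≥ 2, let n < r satisfy k·r < (k−1)·2n, and let 𝓕 ⊆ 𝓟^r(M_n) be k-wise intersecting. Let σ be a good cyclic ordering of V(M_n) that is 0-saturated with respect to 𝓕, and let μ be the good cyclic ordering obtained from σ by exchanging the values at indices n−1 and 2n−1. If μ is saturated with respect to 𝓕, then μ is 0-saturated with respect to 𝓕. -/
/-- A good cyclic ordering of `V(Mₙ)`: a bijection `c : ℤ/2nℤ → {1,…,2n}` such that
`c(i+n)` is always the partner of `c(i)`. -/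
def IsGoodCyclic (n : ℕ) (c : ZMod (2 * n) → ℕ) : Prop :=
  Function.Injective c ∧ (∀ i, c i ∈ Finset.Icc 1 (2 * n)) ∧
    ∀ i, c (i + (n : ZMod (2 * n))) = partnerMn n (c i)

/-- The `c`-interval of length `r` beginning at index `x`: `{c(x), c(x+1), …, c(x+r−1)}`. -/
def gInterval (n : ℕ) (c : ZMod (2 * n) → ℕ) (r : ℕ) (x : ZMod (2 * n)) : Finset ℕ :=
  (Finset.range r).image fun j : ℕ => c (x + (j : ZMod (2 * n)))

/-- `c` is saturated with respect to `𝓕`: exactly `r` members of `𝓕` are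
`c`-intervals of length `r`. -/
def Saturated (n r : ℕ) (𝓕 : Finset (Finset ℕ)) (c : ZMod (2 * n) → ℕ) : Prop :=
  {A : Finset ℕ | A ∈ 𝓕 ∧ ∃ x, A = gInterval n c r x}.ncard = r

/-- `c` is `x`-saturated with respect to `𝓕`: it is saturated and every member of `𝓕`
that is a `c`-interval contains the index `x` (equivalently, the element `c(x)`). -/
def XSaturated (n r : ℕ) (𝓕 : Finset (Finset ℕ)) (c : ZMod (2 * n) → ℕ)
    (x : ZMod (2 * n)) : Prop :=
  Saturated n r 𝓕 c ∧ ∀ A ∈ 𝓕, (∃ y, A = gInterval n c r y) → c x ∈ A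

lemma notMem_aux (n r : ℕ) (c : ZMod (2 * n) → ℕ) (hc : Function.Injective c)
    (z t : ℤ) (h1 : z - (2 * n - r) ≤ t) (h2 : t < z) :
    c (t : ZMod (2 * n)) ∉ gInterval n c r (z : ZMod (2 * n)) := by
  intro h
  simp only [gInterval, Finset.mem_image, Finset.mem_range] at h
  obtain ⟨j, hj, he⟩ := h
  have h3 := hc he
  have h4 : ((z + j : ℤ) : ZMod (2 * n)) = ((t : ℤ) : ZMod (2 * n)) := by
    push_cast; exact h3
  rw [ZMod.intCast_eq_intCast_iff_dvd_sub] at h4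
  obtain ⟨m, hm⟩ := h4
  push_cast at hm
  have hj' : (j : ℤ) < r := by exact_mod_cast hj
  have hb1 : t - (z + j) < 0 := by omega
  have hb2 : -(2 * (n : ℤ)) < t - (z + j) := by omega
  rw [hm] at hb1 hb2
  have hn0 : (0 : ℤ) ≤ 2 * n := by positivity
  have : m < 0 := by
    by_contra hcon
    push Not at hcon
    nlinarith
  have : -1 < m := by
    by_contra hcon
    push Not at hcon
    nlinarith
  omega

lemma mem_aux (n r : ℕ) (c : ZMod (2 * n) → ℕ)
    (z t : ℤ) (h1 : z ≤ t) (h2 : t < z + r) :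
    c (t : ZMod (2 * n)) ∈ gInterval n c r (z : ZMod (2 * n)) := by
  simp only [gInterval, Finset.mem_image, Finset.mem_range]
  refine ⟨(t - z).toNat, by omega, ?_⟩
  congr 1
  have : (((t - z).toNat : ℤ) : ZMod (2 * n)) = ((t - z : ℤ) : ZMod (2 * n)) := by
    rw [Int.toNat_of_nonneg (by omega)]
  rw [Int.cast_natCast] at this
  rw [this]; push_cast; ring

lemma rep_aux (N : ℕ) (hN : 0 < N) (x : ZMod N) (y : ℤ) :
    ∃ t : ℤ, y ≤ t ∧ t < y + N ∧ (t : ZMod N) = x := by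
  have : NeZero N := ⟨hN.ne'⟩
  have hN' : (0 : ℤ) < N := by exact_mod_cast hN
  refine ⟨y + ((x.val : ℤ) - y) % N, ?_, ?_, ?_⟩
  · have := Int.emod_nonneg ((x.val : ℤ) - y) hN'.ne'
    omega
  · have := Int.emod_lt_of_pos ((x.val : ℤ) - y) hN'
    omega
  · have h : (((x.val : ℤ) : ℤ) : ZMod N) = x := by simp
    conv_rhs => rw [← h]
    rw [ZMod.intCast_eq_intCast_iff_dvd_sub]
    have := Int.mul_ediv_add_emod ((x.val : ℤ) - y) N
    exact ⟨((x.val : ℤ) - y) / N, by linarith⟩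

/-- The members of a family that are intervals, counted by starting point. -/
lemma count_aux (n r : ℕ) (𝓕 : Finset (Finset ℕ)) (c : ZMod (2 * n) → ℕ)
    (hc : Saturated n r 𝓕 c) (T : Finset ℤ)
    (hT : ∀ x : ZMod (2 * n), gInterval n c r x ∈ 𝓕 → ∃ z ∈ T, (z : ZMod (2 * n)) = x) :
    r ≤ (T.filter fun z : ℤ => gInterval n c r (z : ZMod (2 * n)) ∈ 𝓕).card := by
  classical
  have h : {A : Finset ℕ | A ∈ 𝓕 ∧ ∃ x, A = gInterval n c r x} ⊆
      (((T.filter fun z : ℤ => gInterval n c r (z : ZMod (2 * n)) ∈ 𝓕).image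
        fun z : ℤ => gInterval n c r (z : ZMod (2 * n)) : Finset (Finset ℕ)) : Set (Finset ℕ)) := by
    rintro A ⟨hA, x, rfl⟩
    obtain ⟨z, hz, rfl⟩ := hT x hA
    simp only [Finset.coe_image, Set.mem_image, Finset.mem_coe, Finset.mem_filter]
    exact ⟨z, ⟨hz, hA⟩, rfl⟩
  have h2 := Set.ncard_le_ncard h (Finset.finite_toSet _)
  rw [Set.ncard_coe_finset] at h2
  have h3 : Set.ncard {A : Finset ℕ | A ∈ 𝓕 ∧ ∃ x, A = gInterval n c r x} = r := hc
  rw [h3] at h2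
  exact h2.trans Finset.card_image_le

/-- The covering argument. -/
lemma cover_aux (n r k : ℕ) (hnr : n < r) (s : ℤ) (hs : s = 2 * n - r) (hs0 : 0 < s)
    (hks : 2 * (n : ℤ) < k * s)
    (𝓕 : Finset (Finset ℕ)) (hint : KWiseIntersecting k 𝓕)
    (σ μ : ZMod (2 * n) → ℕ) (hσi : Function.Injective σ) (hμi : Function.Injective μ)
    (hI : ∀ z : ℤ, s + 1 ≤ z → z ≤ 2 * n → gInterval n σ r (z : ZMod (2 * n)) ∈ 𝓕)
    (hμ1 : μ ((-1 : ℤ) : ZMod (2 * n)) = σ ((n - 1 : ℤ) : ZMod (2 * n)))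
    (hμ2 : μ ((n - 1 : ℤ) : ZMod (2 * n)) = σ ((-1 : ℤ) : ZMod (2 * n)))
    (hμ3 : ∀ j : ZMod (2 * n), j ≠ ((n - 1 : ℤ) : ZMod (2 * n)) → j ≠ ((-1 : ℤ) : ZMod (2 * n)) →
      μ j = σ j)
    (y x q e : ℤ) (hy1 : 1 ≤ y) (hy2 : y < s) (hx1 : n ≤ x) (hx2 : x < n + s)
    (he0 : 0 ≤ e) (he1 : e ≤ 1) (hxy : x = y + q * s - e)
    (hJy : gInterval n μ r (y : ZMod (2 * n)) ∈ 𝓕)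
    (hJx : gInterval n μ r (x : ZMod (2 * n)) ∈ 𝓕) : False := by
  have hsn : s < n := by omega
  have hq0 : 0 < q := by
    by_contra hcon
    push Not at hcon
    nlinarith
  have hqk : q < k := by
    by_contra hcon
    push Not at hcon
    nlinarith
  let S : ℤ → Finset ℕ := fun i =>
    if i = 0 then gInterval n μ r (y : ZMod (2 * n))
    else if i < q then gInterval n σ r ((y + i * s : ℤ) : ZMod (2 * n))
    else if i = q then gInterval n μ r (x : ZMod (2 * n))
    else gInterval n σ r ((min (x + (i - q) * s) (2 * n) : ℤ) : ZMod (2 * n))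
  have hS0 : S 0 = gInterval n μ r (y : ZMod (2 * n)) := by simp [S]
  have hSq : S q = gInterval n μ r (x : ZMod (2 * n)) := by
    simp only [S]; rw [if_neg (by omega), if_neg (by omega)]; simp
  have hS1 : ∀ i, 0 < i → i < q → S i = gInterval n σ r ((y + i * s : ℤ) : ZMod (2 * n)) := by
    intro i h1 h2
    simp only [S]; rw [if_neg (by omega), if_pos h2]
  have hS2 : ∀ i, q < i →
      S i = gInterval n σ r ((min (x + (i - q) * s) (2 * n) : ℤ) : ZMod (2 * n)) := by
    intro i h1
    simp only [S]; rw [if_neg (by omega), if_neg (by omega), if_neg (by omega)]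
  have hSF : ∀ i, 0 ≤ i → S i ∈ 𝓕 := by
    intro i hi
    rcases eq_or_lt_of_le hi with h | h
    · rw [← h, hS0]; exact hJy
    rcases lt_trichotomy i q with h' | h' | h'
    · rw [hS1 i h h']
      apply hI
      · nlinarith
      · have : i * s ≤ (q - 1) * s := by
          apply mul_le_mul_of_nonneg_right _ hs0.le; omega
        nlinarith
    · rw [h', hSq]; exact hJx
    · rw [hS2 i h']
      apply hI
      · have : 1 * s ≤ (i - q) * s := by
          apply mul_le_mul_of_nonneg_right _ hs0.le; omega
        apply le_min <;> omega
      · exact min_le_right _ _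
  obtain ⟨v, hv⟩ := hint (fun i => S (i : ℕ)) (fun i => hSF _ (by positivity))
  have hv' : ∀ i : ℤ, 0 ≤ i → i < k → v ∈ S i := by
    intro i h1 h2
    have := hv ⟨i.toNat, by omega⟩
    simpa [Int.toNat_of_nonneg h1] using this
  have hv0 := hv' 0 le_rfl (by omega)
  rw [hS0] at hv0
  have hvq := hv' q hq0.le hqk
  rw [hSq] at hvq
  -- `v` as a value of `μ`
  obtain ⟨w, hw⟩ : ∃ w, v = μ w := by
    simp only [gInterval, Finset.mem_image] at hv0
    obtain ⟨j, -, hj⟩ := hv0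
    exact ⟨_, hj.symm⟩
  by_cases hwn : w = ((n - 1 : ℤ) : ZMod (2 * n))
  · rw [hw, hwn] at hvq
    exact notMem_aux n r μ hμi x (n - 1) (by omega) (by omega) hvq
  by_cases hw1 : w = ((-1 : ℤ) : ZMod (2 * n))
  · rw [hw, hw1] at hv0
    exact notMem_aux n r μ hμi y (-1) (by omega) (by omega) hv0
  have hμσ := hμ3 w hwn hw1
  obtain ⟨t, ht1, ht2, ht3⟩ := rep_aux (2 * n) (by omega) w (y - s)
  push_cast at ht2
  subst ht3
  rcases lt_or_ge t y with hty | hty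
  · rw [hw] at hv0
    exact notMem_aux n r μ hμi y t (by omega) hty hv0
  rcases lt_or_ge t (y + (q - 1) * s) with htq | htq
  · have hd := Int.mul_ediv_add_emod (t - y) s
    have hd1 := Int.emod_nonneg (t - y) hs0.ne'
    have hd2 := Int.emod_lt_of_pos (t - y) hs0
    set d := (t - y) / s with hdd
    have hd0 : 0 ≤ d := Int.ediv_nonneg (by omega) hs0.le
    have hdq : d < q - 1 := by
      by_contra hcon
      push Not at hcon
      nlinarith
    have := hv' (d + 1) (by omega) (by omega)
    rw [hS1 _ (by omega) (by omega), hw, hμσ] at this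
    exact notMem_aux n r σ hσi _ t (by nlinarith) (by nlinarith) this
  rcases lt_or_ge t x with htx | htx
  · rw [hw] at hvq
    exact notMem_aux n r μ hμi x t (by nlinarith) htx hvq
  · have hd := Int.mul_ediv_add_emod (t - x) s
    have hd1 := Int.emod_nonneg (t - x) hs0.ne'
    have hd2 := Int.emod_lt_of_pos (t - x) hs0
    set d := (t - x) / s with hdd
    have hd0 : 0 ≤ d := Int.ediv_nonneg (by omega) hs0.le
    have hdk : d < k - 1 - q := by
      by_contra hcon
      push Not at hcon
      nlinarith
    have := hv' (q + 1 + d) (by omega) (by omega)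
    rw [hS2 _ (by omega), hw, hμσ] at this
    have e1 : (q + 1 + d - q) * s = s * d + s := by ring
    rw [e1] at this
    refine notMem_aux n r σ hσi _ t ?_ ?_ this
    · have := min_le_left (x + (s * d + s)) (2 * (n : ℤ))
      omega
    · apply lt_min <;> omega

/-- Swap lemma: if `σ` is `0`-saturated and `μ` is obtained from `σ` by exchanging the
values at indices `n−1` and `2n−1`, and `μ` is saturated, then `μ` is `0`-saturated. -/
theorem swap_saturated (n r k : ℕ) (hn : 1 ≤ n) (hk : 2 ≤ k) (hnr : n < r)
    (hkr : k * r < (k - 1) * (2 * n))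
    (𝓕 : Finset (Finset ℕ)) (h𝓕 : ↑𝓕 ⊆ famP n r)
    (hint : KWiseIntersecting k 𝓕)
    (σ μ : ZMod (2 * n) → ℕ) (hσ : IsGoodCyclic n σ)
    (hsat : XSaturated n r 𝓕 σ 0)
    (hμ : ∀ j : ZMod (2 * n), μ j =
      if j = ((n - 1 : ℕ) : ZMod (2 * n)) then σ ((2 * n - 1 : ℕ) : ZMod (2 * n))
      else if j = ((2 * n - 1 : ℕ) : ZMod (2 * n)) then σ ((n - 1 : ℕ) : ZMod (2 * n))
      else σ j)
    (hμsat : Saturated n r 𝓕 μ) :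
    XSaturated n r 𝓕 μ 0 := by
  classical
  obtain ⟨hσi, -, -⟩ := hσ
  obtain ⟨s, hs⟩ : ∃ s : ℤ, s = 2 * n - r := ⟨_, rfl⟩
  have hkr' : (k : ℤ) * r < (k - 1) * (2 * n) := by
    have h : ((k * r : ℕ) : ℤ) < (((k - 1) * (2 * n) : ℕ) : ℤ) := by exact_mod_cast hkr
    rw [Nat.cast_mul, Nat.cast_mul, Nat.cast_sub (by omega)] at h
    push_cast at h
    exact h
  have hks : 2 * (n : ℤ) < k * s := by rw [hs]; nlinarith
  have hs0 : 0 < s := by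
    by_contra hcon
    push Not at hcon
    nlinarith
  have hsn : s < n := by omega
  have ea : ((n - 1 : ℕ) : ZMod (2 * n)) = ((n - 1 : ℤ) : ZMod (2 * n)) := by
    rw [Nat.cast_sub hn]; push_cast; rfl
  have h2n : (2 : ZMod (2 * n)) * (n : ZMod (2 * n)) = 0 := by
    have := ZMod.natCast_self (2 * n)
    push_cast at this
    exact this
  have eb : ((2 * n - 1 : ℕ) : ZMod (2 * n)) = ((-1 : ℤ) : ZMod (2 * n)) := by
    rw [Nat.cast_sub (by omega)]; push_cast; rw [h2n]; ring
  rw [ea, eb] at hμ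
  have hswap : ∀ j, μ j = σ (Equiv.swap ((n - 1 : ℤ) : ZMod (2 * n)) ((-1 : ℤ) : ZMod (2 * n)) j) := by
    intro j
    rw [hμ, Equiv.swap_apply_def]
    split_ifs <;> rfl
  have hμi : Function.Injective μ := by
    intro a b hab
    rw [hswap, hswap] at hab
    exact (Equiv.swap _ _).injective (hσi hab)
  have hμ1 : μ ((-1 : ℤ) : ZMod (2 * n)) = σ ((n - 1 : ℤ) : ZMod (2 * n)) := by
    rw [hswap, Equiv.swap_apply_right]
  have hμ2 : μ ((n - 1 : ℤ) : ZMod (2 * n)) = σ ((-1 : ℤ) : ZMod (2 * n)) := by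
    rw [hswap, Equiv.swap_apply_left]
  have hμ3 : ∀ j : ZMod (2 * n), j ≠ ((n - 1 : ℤ) : ZMod (2 * n)) →
      j ≠ ((-1 : ℤ) : ZMod (2 * n)) → μ j = σ j := by
    intro j h1 h2
    rw [hswap, Equiv.swap_apply_of_ne_of_ne h1 h2]
  have hrep : ∀ x : ZMod (2 * n), ∃ z : ℤ, 1 ≤ z ∧ z ≤ 2 * n ∧ (z : ZMod (2 * n)) = x := by
    intro x
    obtain ⟨z, h1, h2, h3⟩ := rep_aux (2 * n) (by omega) x 1
    push_cast at h2
    exact ⟨z, h1, by omega, h3⟩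
  obtain ⟨hsat1, hsat2⟩ := hsat
  have hInot : ∀ z : ℤ, 1 ≤ z → z ≤ s → gInterval n σ r (z : ZMod (2 * n)) ∉ 𝓕 := by
    intro z h1 h2 h3
    have h4 := hsat2 _ h3 ⟨_, rfl⟩
    have h5 := notMem_aux n r σ hσi z 0 (by omega) (by omega)
    rw [Int.cast_zero] at h5
    exact h5 h4
  have hI : ∀ z : ℤ, s + 1 ≤ z → z ≤ 2 * n → gInterval n σ r (z : ZMod (2 * n)) ∈ 𝓕 := by
    have h := count_aux n r 𝓕 σ hsat1 (Finset.Icc (s + 1) (2 * n)) (by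
      intro x hx
      obtain ⟨z, h1, h2, rfl⟩ := hrep x
      refine ⟨z, ?_, rfl⟩
      rw [Finset.mem_Icc]
      refine ⟨?_, h2⟩
      by_contra hcon
      exact hInot z h1 (by omega) hx)
    have hcard : (Finset.Icc (s + 1) (2 * (n : ℤ))).card = r := by
      rw [Int.card_Icc]; omega
    have heq := Finset.eq_of_subset_of_card_le (Finset.filter_subset
      (fun z : ℤ => gInterval n σ r (z : ZMod (2 * n)) ∈ 𝓕) (Finset.Icc (s + 1) (2 * (n : ℤ))))
      (by rw [hcard]; exact h)
    intro z h1 h2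
    have hz : z ∈ Finset.Icc (s + 1) (2 * (n : ℤ)) := Finset.mem_Icc.2 ⟨h1, h2⟩
    rw [← heq, Finset.mem_filter] at hz
    exact hz.2
  have em1 : ((2 * n - 1 : ℤ) : ZMod (2 * n)) = ((-1 : ℤ) : ZMod (2 * n)) := by
    push_cast; rw [h2n]; ring
  have hJs : gInterval n μ r (s : ZMod (2 * n)) = gInterval n σ r (s : ZMod (2 * n)) := by
    have hcσ : (gInterval n σ r (s : ZMod (2 * n))).card ≤ r :=
      Finset.card_image_le.trans (by simp)
    have m1 := mem_aux n r σ s (n - 1) (by omega) (by omega)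
    have m2 := mem_aux n r σ s (2 * n - 1) (by omega) (by omega)
    have m3 := mem_aux n r μ s (n - 1) (by omega) (by omega)
    have m4 := mem_aux n r μ s (2 * n - 1) (by omega) (by omega)
    rw [em1] at m2 m4
    rw [hμ1] at m4
    rw [hμ2] at m3
    ext v
    constructor
    · intro hv
      obtain ⟨j, hj, rfl⟩ := Finset.mem_image.1 hv
      by_cases h1 : (s : ZMod (2 * n)) + (j : ZMod (2 * n)) = ((n - 1 : ℤ) : ZMod (2 * n))
      · simp only [h1, hμ2]; exact m2
      by_cases h2 : (s : ZMod (2 * n)) + (j : ZMod (2 * n)) = ((-1 : ℤ) : ZMod (2 * n))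
      · simp only [h2, hμ1]; exact m1
      · simp only [hμ3 _ h1 h2]
        exact Finset.mem_image.2 ⟨j, hj, rfl⟩
    · intro hv
      obtain ⟨j, hj, rfl⟩ := Finset.mem_image.1 hv
      by_cases h1 : (s : ZMod (2 * n)) + (j : ZMod (2 * n)) = ((n - 1 : ℤ) : ZMod (2 * n))
      · simp only [h1]; exact m4
      by_cases h2 : (s : ZMod (2 * n)) + (j : ZMod (2 * n)) = ((-1 : ℤ) : ZMod (2 * n))
      · simp only [h2]; exact m3
      · simp only [← hμ3 _ h1 h2]
        exact Finset.mem_image.2 ⟨j, hj, rfl⟩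
  -- the bad starting points of `μ`
  set P : ℤ → Prop := fun z => gInterval n μ r (z : ZMod (2 * n)) ∈ 𝓕 with hP
  have hPs : ¬ P s := by
    simp only [hP]; rw [hJs]; exact hInot s (by omega) le_rfl
  have hG := count_aux n r 𝓕 μ hμsat (Finset.Icc 1 (2 * n)) (by
      intro x hx
      obtain ⟨z, h1, h2, rfl⟩ := hrep x
      exact ⟨z, Finset.mem_Icc.2 ⟨h1, h2⟩, rfl⟩)
  have hB : (((Finset.Icc 1 (2 * (n : ℤ))).filter fun z => ¬ P z).card : ℤ) ≤ s := by
    have h1 := Finset.card_filter_add_card_filter_not (s := Finset.Icc 1 (2 * (n : ℤ))) P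
    rw [Int.card_Icc] at h1
    have h2 : r ≤ ((Finset.Icc 1 (2 * (n : ℤ))).filter P).card := hG
    omega
  have key : ∀ y : ℤ, 1 ≤ y → y ≤ s → ¬ P y := by
    by_contra hcon
    push Not at hcon
    obtain ⟨y1, hy1, hy2, hy3⟩ := hcon
    set Y := (Finset.Icc 1 s).filter P with hY
    have hYne : Y.Nonempty := ⟨y1, by rw [hY, Finset.mem_filter, Finset.mem_Icc]; exact ⟨⟨hy1, hy2⟩, hy3⟩⟩
    have hYm : ∀ y ∈ Y, 1 ≤ y ∧ y < s ∧ P y := by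
      intro y hy
      rw [hY, Finset.mem_filter, Finset.mem_Icc] at hy
      refine ⟨hy.1.1, lt_of_le_of_ne hy.1.2 ?_, hy.2⟩
      rintro rfl
      exact hPs hy.2
    set y0 := Y.min' hYne with hy0
    have hy0m : y0 ∈ Y := Finset.min'_mem _ _
    have hy0n : y0 - 1 ∉ Y := by
      intro h
      have := Finset.min'_le _ _ h
      omega
    let g : ℤ → ℤ := fun t => n + (t - n) % s
    have hg1 : ∀ t, n ≤ g t := fun t => by
      have := Int.emod_nonneg (t - n) hs0.ne'
      simp only [g]; omega
    have hg2 : ∀ t, g t < n + s := fun t => by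
      have := Int.emod_lt_of_pos (t - n) hs0
      simp only [g]; omega
    have hg3 : ∀ t, g t = t + (-((t - n) / s)) * s := fun t => by
      have := Int.mul_ediv_add_emod (t - n) s
      simp only [g]; linarith
    have hcov : ∀ y x q e : ℤ, y ∈ Y → n ≤ x → x < n + s → 0 ≤ e → e ≤ 1 →
        x = y + q * s - e → ¬ P x := by
      intro y x q e hy h1 h2 h3 h4 h5 h6
      obtain ⟨a1, a2, a3⟩ := hYm y hy
      exact cover_aux n r k hnr s hs hs0 hks 𝓕 hint σ μ hσi hμi hI hμ1 hμ2 hμ3 y x q e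
        a1 a2 h1 h2 h3 h4 h5 a3 h6
    have hZ : ∀ t ∈ insert (y0 - 1) Y, ¬ P (g t) ∧ 0 ≤ t ∧ t < s := by
      intro t ht
      rcases Finset.mem_insert.1 ht with rfl | ht
      · obtain ⟨a1, a2, a3⟩ := hYm y0 hy0m
        refine ⟨hcov y0 _ (-((y0 - 1 - n) / s)) 1 hy0m (hg1 _) (hg2 _) (by norm_num) le_rfl ?_, by omega, by omega⟩
        rw [hg3]
        ring
      · obtain ⟨a1, a2, a3⟩ := hYm t ht
        refine ⟨hcov t _ (-((t - n) / s)) 0 ht (hg1 _) (hg2 _) le_rfl (by norm_num) ?_, by omega, by omega⟩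
        rw [hg3]
        ring
    have hginj : Set.InjOn g (insert (y0 - 1) Y : Finset ℤ) := by
      intro t ht u hu h
      obtain ⟨-, t1, t2⟩ := hZ t ht
      obtain ⟨-, u1, u2⟩ := hZ u hu
      rw [hg3, hg3] at h
      have h' : t % s = u % s := by
        have := congrArg (· % s) h
        simpa only [Int.add_mul_emod_self_right] using this
      rwa [Int.emod_eq_of_lt t1 t2, Int.emod_eq_of_lt u1 u2] at h'
    have hsub : ((Finset.Icc 1 s).filter fun z => ¬ P z) ∪ (insert (y0 - 1) Y).image g ⊆
        (Finset.Icc 1 (2 * (n : ℤ))).filter fun z => ¬ P z := by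
      intro z hz
      rw [Finset.mem_filter, Finset.mem_Icc]
      rcases Finset.mem_union.1 hz with h | h
      · rw [Finset.mem_filter, Finset.mem_Icc] at h
        exact ⟨⟨h.1.1, by omega⟩, h.2⟩
      · obtain ⟨t, ht, rfl⟩ := Finset.mem_image.1 h
        have b1 := hg1 t
        have b2 := hg2 t
        exact ⟨⟨by omega, by omega⟩, (hZ t ht).1⟩
    have hdisj : Disjoint ((Finset.Icc 1 s).filter fun z => ¬ P z)
        ((insert (y0 - 1) Y).image g) := by
      rw [Finset.disjoint_left]
      intro z hz h
      rw [Finset.mem_filter, Finset.mem_Icc] at hz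
      obtain ⟨t, ht, rfl⟩ := Finset.mem_image.1 h
      have b1 := hg1 t
      omega
    have hcard := Finset.card_le_card hsub
    rw [Finset.card_union_of_disjoint hdisj, Finset.card_image_of_injOn hginj,
      Finset.card_insert_of_notMem hy0n] at hcard
    have h1 := Finset.card_filter_add_card_filter_not (s := Finset.Icc 1 s) P
    rw [Int.card_Icc] at h1
    have h2 : Y.card = ((Finset.Icc 1 s).filter P).card := by
      rw [hY]
    omega
  refine ⟨hμsat, ?_⟩
  rintro A hA ⟨y, rfl⟩
  obtain ⟨z, h1, h2, rfl⟩ := hrep y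
  rcases le_or_gt z s with h | h
  · exact absurd hA (key z h1 h)
  · have := mem_aux n r μ z (2 * n) h2 (by omega)
    have e0 : ((2 * n : ℤ) : ZMod (2 * n)) = 0 := by push_cast; exact h2n
    rwa [e0] at this
end
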